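/- For every integer k ≥ 1: if k is even, then GR_k(H3) = 21·17^((k−2)/2) + 1, and if k is odd, then GR_k(H3) = 4·17^((k−1)/2) + 1. -/

import Mathlib

open SimpleGraph

/-- A rainbow triangle in an edge-coloring of a complete graph: three distinct
vertices whose three pairwise edges receive three pairwise distinct colors. -/
def HasRainbowTriangle {n k : ℕ} (c : Fin n → Fin n → Fin k) : Prop :=
  ∃ u v w : Fin n, u ≠ v ∧ u ≠ w ∧ v ≠ w ∧
    c u v ≠ c u w ∧ c u v ≠ c v w ∧ c u w ≠ c v w

/-- A Gallai `k`-coloring of `K_n`: a symmetric edge-coloring with no rainbow triangle. -/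
def IsGallaiColoring {n k : ℕ} (c : Fin n → Fin n → Fin k) : Prop :=
  (∀ u v, c u v = c v u) ∧ ¬ HasRainbowTriangle c

/-- A monochromatic copy of the graph `F` in color `i`: an injection of the vertices
of `F` into the vertices of `K_n` mapping every edge of `F` to an edge colored `i`. -/
def HasMonoCopy {V : Type} (F : SimpleGraph V) {n k : ℕ}
    (c : Fin n → Fin n → Fin k) (i : Fin k) : Prop :=
  ∃ f : V → Fin n, Function.Injective f ∧ ∀ a b, F.Adj a b → c (f a) (f b) = i

/-- The Gallai-Ramsey number `GR(F₁, …, F_k)`: the least `n` such that every Gallai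
`k`-coloring of `K_n` contains, for some color `i`, a monochromatic copy of `Fᵢ`
in color `i`. -/
noncomputable def GR (k : ℕ) (F : Fin k → Σ V : Type, SimpleGraph V) : ℕ :=
  sInf {n : ℕ | ∀ c : Fin n → Fin n → Fin k, IsGallaiColoring c →
    ∃ i : Fin k, HasMonoCopy (F i).2 c i}

/-- The triangle `K₃`. -/
def GK3 : SimpleGraph (Fin 3) := ⊤

/-- The path `P₃` on three vertices (edges 0–1 and 1–2). -/
def GP3 : SimpleGraph (Fin 3) := SimpleGraph.fromRel (fun a _ => a = 1)

/-- `H₁`: a `K₄` on `{0,1,2,3}` together with the extra vertex `4` adjacent to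
exactly the vertex `3`. -/
def GH1 : SimpleGraph (Fin 5) :=
  SimpleGraph.fromRel (fun a b => (a ≠ 4 ∧ b ≠ 4) ∨ (a = 3 ∧ b = 4))

/-- `H₂`: `K₅` minus the two edges 0–1 and 1–2 of a path on three vertices. -/
def GH2 : SimpleGraph (Fin 5) :=
  (⊤ : SimpleGraph (Fin 5)) \
    SimpleGraph.fromRel (fun a b => (a = 0 ∧ b = 1) ∨ (a = 1 ∧ b = 2))

/-- `H₃`: `K₅` minus the edge 0–1. -/
def GH3 : SimpleGraph (Fin 5) :=
  (⊤ : SimpleGraph (Fin 5)) \ SimpleGraph.fromRel (fun a b => a = 0 ∧ b = 1)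


namespace GRH
section
open scoped Classical

variable {α K : Type}

/-- `u` and `v` are joined by an edge of color `a`. -/
def Ed (c : α → α → K) (a : K) (u v : α) : Prop := u ≠ v ∧ c u v = a

def NoE (c : α → α → K) (a : K) (W : Finset α) : Prop :=
  ∀ x ∈ W, ∀ y ∈ W, ¬ Ed c a x y

def NoP (c : α → α → K) (a : K) (W : Finset α) : Prop :=
  ∀ x ∈ W, ∀ y ∈ W, ∀ z ∈ W, y ≠ z → Ed c a x y → Ed c a x z → False

def NoT (c : α → α → K) (a : K) (W : Finset α) : Prop :=
  ∀ x ∈ W, ∀ y ∈ W, ∀ z ∈ W, Ed c a x y → Ed c a x z → Ed c a y z → False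

def NoH (c : α → α → K) (a : K) (W : Finset α) : Prop :=
  ∀ x ∈ W, ∀ y ∈ W, ∀ p ∈ W, ∀ q ∈ W, ∀ r ∈ W, x ≠ y →
    Ed c a p q → Ed c a p r → Ed c a q r →
    Ed c a x p → Ed c a x q → Ed c a x r →
    Ed c a y p → Ed c a y q → Ed c a y r → False

def Sy (c : α → α → K) : Prop := ∀ u v, c u v = c v u

def Gal (c : α → α → K) : Prop := ∀ u v w, u ≠ v → u ≠ w → v ≠ w →
  c u v = c u w ∨ c u v = c v w ∨ c u w = c v w

theorem Ed.symm {c : α → α → K} (hs : Sy c) {a : K} {u v : α} (h : Ed c a u v) : Ed c a v u :=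
  ⟨h.1.symm, by rw [hs]; exact h.2⟩

theorem NoE.mono {c : α → α → K} {a : K} {W W' : Finset α} (h : NoE c a W) (hw : W' ⊆ W) :
    NoE c a W' := fun x hx y hy => h x (hw hx) y (hw hy)
theorem NoP.mono {c : α → α → K} {a : K} {W W' : Finset α} (h : NoP c a W) (hw : W' ⊆ W) :
    NoP c a W' := fun x hx y hy z hz => h x (hw hx) y (hw hy) z (hw hz)
theorem NoT.mono {c : α → α → K} {a : K} {W W' : Finset α} (h : NoT c a W) (hw : W' ⊆ W) :
    NoT c a W' := fun x hx y hy z hz => h x (hw hx) y (hw hy) z (hw hz)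
theorem NoH.mono {c : α → α → K} {a : K} {W W' : Finset α} (h : NoH c a W) (hw : W' ⊆ W) :
    NoH c a W' := fun x hx y hy p hp q hq r hr =>
      h x (hw hx) y (hw hy) p (hw hp) q (hw hq) r (hw hr)

theorem NoE.noP {c : α → α → K} {a : K} {W : Finset α} (h : NoE c a W) : NoP c a W :=
  fun x hx y hy _ _ _ e _ => h x hx y hy e
theorem NoP.noT {c : α → α → K} {a : K} {W : Finset α} (h : NoP c a W) : NoT c a W :=
  fun x hx y hy z hz e f g => h x hx y hy z hz g.1 e f
theorem NoT.noH {c : α → α → K} {a : K} {W : Finset α} (h : NoT c a W) : NoH c a W :=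
  fun _ _ _ _ p hp q hq r hr _ e f g _ _ _ _ _ _ => h p hp q hq r hr e f g
theorem NoE.noT {c : α → α → K} {a : K} {W : Finset α} (h : NoE c a W) : NoT c a W := h.noP.noT
theorem NoP.noH {c : α → α → K} {a : K} {W : Finset α} (h : NoP c a W) : NoH c a W := h.noT.noH

/-! ### Gallai's theorem -/

/-- Graph of edges inside `V` whose color is neither `a` nor `b`. -/
def OG (c : α → α → K) (hs : Sy c) (V : Finset α) (a b : K) : SimpleGraph α where
  Adj u v := u ≠ v ∧ u ∈ V ∧ v ∈ V ∧ c u v ≠ a ∧ c u v ≠ b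
  symm := ⟨fun u v ⟨h1, h2, h3, h4, h5⟩ => ⟨h1.symm, h3, h2, by rwa [hs], by rwa [hs]⟩⟩
  loopless := ⟨fun _ h => h.1 rfl⟩

theorem OG_reach_mem {c : α → α → K} {hs : Sy c} {V : Finset α} {a b : K} {u v : α}
    (h : (OG c hs V a b).Reachable u v) (hu : u ∈ V) : v ∈ V := by
  obtain ⟨w⟩ := h
  induction w with
  | nil => exact hu
  | cons h _ ih => exact ih h.2.2.1

theorem OG_cross {c : α → α → K} {hs : Sy c} {V : Finset α} {a b : K} {u v : α}
    (hu : u ∈ V) (hv : v ∈ V) (h : ¬ (OG c hs V a b).Reachable u v) :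
    c u v = a ∨ c u v = b := by
  by_contra hc
  push Not at hc
  apply h
  by_cases huv : u = v
  · subst huv; exact SimpleGraph.Reachable.refl _
  · exact SimpleGraph.Adj.reachable ⟨huv, hu, hv, hc.1, hc.2⟩

theorem OG_unif {c : α → α → K} {hs : Sy c} (hg : Gal c) {V : Finset α} {a b : K} {u v w : α}
    (hw : w ∈ V) (h : (OG c hs V a b).Reachable u v) (hn : ¬ (OG c hs V a b).Reachable u w) :
    c u w = c v w := by
  obtain ⟨p⟩ := h
  induction p with
  | nil => rfl
  | @cons x y z h p ih =>
    have hxy : (OG c hs V a b).Reachable x y := SimpleGraph.Adj.reachable h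
    have hn' : ¬ (OG c hs V a b).Reachable y w := fun h' => hn (hxy.trans h')
    have h1 := OG_cross h.2.1 hw hn
    have h2 := OG_cross h.2.2.1 hw hn'
    have hxw : x ≠ w := fun e => hn (e ▸ SimpleGraph.Reachable.refl _)
    have hyw : y ≠ w := fun e => hn' (e ▸ SimpleGraph.Reachable.refl _)
    rw [← ih hn']
    obtain ⟨q1, _, _, q2, q3⟩ := h
    have := hg x y w q1 hxw hyw
    grind

theorem gallai_split (c : α → α → K) (hs : Sy c) (hg : Gal c) (V : Finset α) (hV : 2 ≤ V.card) :
    ∃ a b : K, ∃ S ⊆ V, S.Nonempty ∧ S ≠ V ∧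
      ∀ u ∈ S, ∀ v ∈ V, v ∉ S → (c u v = a ∨ c u v = b) := by
  induction V using Finset.induction_on with
  | empty => simp at hV
  | @insert x V' hx ih =>
    rw [Finset.card_insert_of_notMem hx] at hV
    by_cases h2 : 2 ≤ V'.card
    · obtain ⟨a, b, S, hSV, ⟨s, hs1⟩, hSne, hcr⟩ := ih h2
      set O := OG c hs V' a b with hO
      have ht : ∃ t ∈ V', t ∉ S := by
        by_contra hcon
        push Not at hcon
        exact hSne (Finset.Subset.antisymm hSV hcon)
      obtain ⟨t, ht1, ht2⟩ := ht
      have hstep : ∀ u v, O.Reachable u v → u ∈ S → v ∈ S := by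
        intro u v ⟨p⟩
        induction p with
        | nil => exact id
        | @cons x y z h p ih' =>
          intro hxS
          apply ih'
          by_contra hy
          have := hcr x hxS y h.2.2.1 hy
          obtain ⟨_, _, _, q2, q3⟩ := h
          tauto
      have hst : ¬ O.Reachable s t := fun h => ht2 (hstep s t h hs1)
      have hsV := hSV hs1
      -- any vertex has a vertex in another component
      by_cases hex : ∃ z ∈ V', ∀ y ∈ V', O.Reachable z y → (c y x = a ∨ c y x = b)
      · obtain ⟨z, hz, hzy⟩ := hex
        refine ⟨a, b, V'.filter (fun y => O.Reachable z y), ?_, ⟨z, ?_⟩, ?_, ?_⟩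
        · exact (Finset.filter_subset _ _).trans (Finset.subset_insert _ _)
        · simp [hz]
        · intro h
          have : x ∈ V'.filter (fun y => O.Reachable z y) := by rw [h]; simp
          simp [hx] at this
        · intro u hu v hv hvn
          simp only [Finset.mem_filter] at hu hvn
          rcases Finset.mem_insert.1 hv with rfl | hv
          · exact hzy u hu.1 hu.2
          · exact OG_cross hu.1 hv (fun h => hvn ⟨hv, hu.2.trans h⟩)
      · push Not at hex
        -- each component has a vertex with a foreign color to `x`
        choose! g hg1 hg2 hg3 using hex
        have hne : ∀ y ∈ V', y ≠ x := fun y hy e => hx (e ▸ hy)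
        have key : ∀ u ∈ V', ∀ v ∈ V', ¬ O.Reachable u v → c u x ≠ a → c u x ≠ b →
            c v x = c u x ∨ c v x = c u v := by
          intro u hu v hv hn h1 h2
          have h3 := OG_cross hu hv hn
          have huv : u ≠ v := fun e => hn (e ▸ SimpleGraph.Reachable.refl _)
          have := hg u v x huv (hne u hu) (hne v hv)
          grind
        have gn : ∀ u ∈ V', ∀ v ∈ V', ¬ O.Reachable u v → ¬ O.Reachable (g u) v :=
          fun u hu v hv hn h => hn ((hg2 u hu).trans h)
        have hsame : ∀ u ∈ V', ∀ v ∈ V', ¬ O.Reachable u v → c (g u) x = c (g v) x := by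
          intro u hu v hv hn
          have h1 : ¬ O.Reachable (g u) (g v) := fun h =>
            hn ((hg2 u hu).trans (h.trans (hg2 v hv).symm))
          have h2 := key _ (hg1 u hu) _ (hg1 v hv) h1 (hg3 u hu).1 (hg3 u hu).2
          have h3 := OG_cross (hg1 u hu) (hg1 v hv) h1
          have h4 := hg3 v hv
          grind
        set γ := c (g s) x with hγ
        have hall : ∀ u ∈ V', c (g u) x = γ := by
          intro u hu
          by_cases h : O.Reachable u s
          · have h' : ¬ O.Reachable u t := fun h' => hst (h.symm.trans h')
            rw [hsame u hu t ht1 h', hγ, hsame s hsV t ht1 hst]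
          · exact hsame u hu s hsV h
        have hother : ∀ u ∈ V', ∃ w ∈ V', ¬ O.Reachable u w := by
          intro u hu
          by_cases h : O.Reachable u s
          · exact ⟨t, ht1, fun h' => hst (h.symm.trans h')⟩
          · exact ⟨s, hsV, h⟩
        -- a non-γ edge at z equals c z (g w)
        have hz : ∀ z ∈ V', ∀ w ∈ V', ¬ O.Reachable z w → c z x ≠ γ → c z x = c w z := by
          intro z hz w hw hn hzγ
          have h1 : ¬ O.Reachable (g w) z := gn w hw z hz (fun h => hn h.symm)
          have h2 := key _ (hg1 w hw) z hz h1 (hg3 w hw).1 (hg3 w hw).2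
          have h3 : c (g w) z = c w z := OG_unif hg hz (hg2 w hw).symm h1
          rw [hall w hw, h3] at h2
          tauto
        have hrho : ∀ z ∈ V', ∀ z' ∈ V', c z x ≠ γ → c z' x ≠ γ → c z x = c z' x := by
          intro z hz1 z' hz2 h1 h2
          by_cases h : O.Reachable z z'
          · obtain ⟨w, hw, hn⟩ := hother z hz1
            have hn' : ¬ O.Reachable z' w := fun h' => hn (h.trans h')
            rw [hz z hz1 w hw hn h1, hz z' hz2 w hw hn' h2, hs w z, hs w z']
            exact OG_unif hg hw h hn
          · rw [hz z hz1 z' hz2 h h1, hz z' hz2 z hz1 (fun h' => h h'.symm) h2, hs]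
        by_cases hz0 : ∃ z ∈ V', c z x ≠ γ
        · obtain ⟨z, hz1, hz2⟩ := hz0
          refine ⟨γ, c z x, {x}, by simp, by simp, ?_, ?_⟩
          · intro h
            have : s ∈ ({x} : Finset α) := by rw [h]; simp [hsV]
            simp at this
            exact hx (this ▸ hsV)
          · intro u hu v hv hvn
            simp only [Finset.mem_singleton] at hu hvn
            subst hu
            have hv' : v ∈ V' := by
              rcases Finset.mem_insert.1 hv with h | h
              · exact absurd h hvn
              · exact h
            rw [hs]
            by_cases h : c v u = γ
            · exact Or.inl h
            · exact Or.inr (hrho v hv' z hz1 h hz2)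
        · push Not at hz0
          refine ⟨γ, γ, {x}, by simp, by simp, ?_, ?_⟩
          · intro h
            have : s ∈ ({x} : Finset α) := by rw [h]; simp [hsV]
            simp at this
            exact hx (this ▸ hsV)
          · intro u hu v hv hvn
            simp only [Finset.mem_singleton] at hu hvn
            subst hu
            have hv' : v ∈ V' := by
              rcases Finset.mem_insert.1 hv with h | h
              · exact absurd h hvn
              · exact h
            rw [hs]
            exact Or.inl (hz0 v hv')
    · have h1 : V'.card = 1 := by omega
      obtain ⟨y, rfl⟩ := Finset.card_eq_one.1 h1
      have hxy : x ≠ y := by simpa using hx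
      refine ⟨c x y, c x y, {x}, by simp, by simp, ?_, ?_⟩
      · intro h
        have : y ∈ ({x} : Finset α) := by rw [h]; simp
        simp at this
        exact hxy this.symm
      · intro u hu v hv hvn
        simp at hu hv hvn
        subst hu
        rcases hv with rfl | rfl
        · exact absurd rfl hvn
        · exact Or.inl rfl
end
end GRH


namespace GRH
section
open scoped Classical

variable {α K : Type}

/-! ### Small Ramsey facts -/

noncomputable def nb (c : α → α → K) (a : K) (v : α) (T : Finset α) : Finset α :=
  T.filter (fun u => Ed c a v u)

theorem mem_nb {c : α → α → K} {a : K} {v u : α} {T : Finset α} :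
    u ∈ nb c a v T ↔ u ∈ T ∧ Ed c a v u := by simp [nb]

theorem nb_subset {c : α → α → K} {a : K} {v : α} {T : Finset α} : nb c a v T ⊆ T :=
  Finset.filter_subset _ _

/-- All edges inside `T` have color `a` or `b`. -/
def Two (c : α → α → K) (a b : K) (T : Finset α) : Prop :=
  ∀ u ∈ T, ∀ v ∈ T, u ≠ v → (c u v = a ∨ c u v = b)

theorem Two.mono {c : α → α → K} {a b : K} {T T' : Finset α} (h : Two c a b T) (h' : T' ⊆ T) :
    Two c a b T' := fun u hu v hv => h u (h' hu) v (h' hv)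

theorem Two.swap {c : α → α → K} {a b : K} {T : Finset α} (h : Two c a b T) :
    Two c b a T := fun u hu v hv n => (h u hu v hv n).symm

theorem Two.ed {c : α → α → K} {a b : K} {T : Finset α} (h : Two c a b T) {u v : α}
    (hu : u ∈ T) (hv : v ∈ T) (n : u ≠ v) (hn : ¬ Ed c a u v) : Ed c b u v :=
  ⟨n, (h u hu v hv n).resolve_left (fun e => hn ⟨n, e⟩)⟩

theorem Two.card {c : α → α → K} {a b : K} (hab : a ≠ b) {T : Finset α} (h : Two c a b T) {v : α}
    (hv : v ∈ T) : T.card = 1 + (nb c a v T).card + (nb c b v T).card := by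
  have h1 : T = insert v (nb c a v T ∪ nb c b v T) := by
    ext u
    simp only [Finset.mem_insert, Finset.mem_union, mem_nb]
    constructor
    · intro hu
      by_cases e : u = v
      · exact Or.inl e
      · by_cases e' : Ed c a v u
        · exact Or.inr (Or.inl ⟨hu, e'⟩)
        · exact Or.inr (Or.inr ⟨hu, h.ed hv hu (Ne.symm e) e'⟩)
    · rintro (rfl | h | h)
      · exact hv
      · exact h.1
      · exact h.1
  have h2 : v ∉ nb c a v T ∪ nb c b v T := by simp [mem_nb, Ed]
  have h3 : Disjoint (nb c a v T) (nb c b v T) := by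
    rw [Finset.disjoint_left]
    intro u h1 h2
    exact hab ((mem_nb.1 h1).2.2.symm.trans (mem_nb.1 h2).2.2)
  conv_lhs => rw [h1]
  rw [Finset.card_insert_of_notMem h2, Finset.card_union_of_disjoint h3]
  omega

/-- Twice the number of edges of color `a` inside `T`. -/
noncomputable def deg2 (c : α → α → K) (a : K) (T : Finset α) : ℕ := ∑ v ∈ T, (nb c a v T).card

theorem deg2_insert {c : α → α → K} (hs : Sy c) {a : K} {T : Finset α} {x : α} (hx : x ∉ T) :
    deg2 c a (insert x T) = deg2 c a T + 2 * (nb c a x T).card := by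
  unfold deg2
  rw [Finset.sum_insert hx]
  have h1 : nb c a x (insert x T) = nb c a x T := by
    ext u; simp [mem_nb, Ed]; grind
  have h2 : ∀ v ∈ T, (nb c a v (insert x T)).card
      = (nb c a v T).card + (if Ed c a x v then 1 else 0) := by
    intro v hv
    unfold nb
    rw [Finset.filter_insert]
    by_cases h : Ed c a x v
    · rw [if_pos (h.symm hs), if_pos h, Finset.card_insert_of_notMem (by simp [hx])]
    · rw [if_neg (fun h' => h (h'.symm hs)), if_neg h]; rfl
  rw [Finset.sum_congr rfl h2, Finset.sum_add_distrib, h1]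
  have h3 : (∑ v ∈ T, if Ed c a x v then 1 else 0) = (nb c a x T).card := by
    simp [nb]
  rw [h3]; omega

theorem deg2_even {c : α → α → K} (hs : Sy c) {a : K} (T : Finset α) : Even (deg2 c a T) := by
  induction T using Finset.induction_on with
  | empty => simp [deg2]
  | insert x T hx ih => rw [deg2_insert hs hx]; exact ih.add (by simp)

theorem exists3 {T : Finset α} (h : 3 ≤ T.card) : ∃ x ∈ T, ∃ y ∈ T, ∃ z ∈ T,
    x ≠ y ∧ x ≠ z ∧ y ≠ z := by
  obtain ⟨S, hS, hc⟩ := Finset.exists_subset_card_eq h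
  obtain ⟨x, y, z, h1, h2, h3, rfl⟩ := Finset.card_eq_three.1 hc
  exact ⟨x, hS (by simp), y, hS (by simp), z, hS (by simp), h1, h2, h3⟩

theorem exists2 {T : Finset α} (h : 2 ≤ T.card) : ∃ x ∈ T, ∃ y ∈ T, x ≠ y := by
  obtain ⟨x, y, h1, h2, h3⟩ := Finset.one_lt_card_iff.1 h
  exact ⟨x, h1, y, h2, h3⟩

theorem exists4 {T : Finset α} (h : 4 ≤ T.card) : ∃ w ∈ T, ∃ x ∈ T, ∃ y ∈ T, ∃ z ∈ T,
    w ≠ x ∧ w ≠ y ∧ w ≠ z ∧ x ≠ y ∧ x ≠ z ∧ y ≠ z := by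
  obtain ⟨w, hw⟩ := Finset.card_pos.1 (by omega : 0 < T.card)
  have := Finset.card_erase_of_mem hw
  obtain ⟨x, hx, y, hy, z, hz, h1, h2, h3⟩ := exists3 (T := T.erase w) (by omega)
  simp only [Finset.mem_erase] at hx hy hz
  exact ⟨w, hw, x, hx.2, y, hy.2, z, hz.2, hx.1.symm, hy.1.symm, hz.1.symm, h1, h2, h3⟩

theorem exists5 {T : Finset α} (h : 5 ≤ T.card) : ∃ v ∈ T, ∃ w ∈ T, ∃ x ∈ T, ∃ y ∈ T, ∃ z ∈ T,
    v ≠ w ∧ v ≠ x ∧ v ≠ y ∧ v ≠ z ∧ w ≠ x ∧ w ≠ y ∧ w ≠ z ∧ x ≠ y ∧ x ≠ z ∧ y ≠ z := by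
  obtain ⟨w, hw⟩ := Finset.card_pos.1 (by omega : 0 < T.card)
  have := Finset.card_erase_of_mem hw
  obtain ⟨v, hv, x, hx, y, hy, z, hz, h1⟩ := exists4 (T := T.erase w) (by omega)
  simp only [Finset.mem_erase] at hv hx hy hz
  exact ⟨w, hw, v, hv.2, x, hx.2, y, hy.2, z, hz.2, hv.1.symm, hx.1.symm, hy.1.symm, hz.1.symm, h1⟩

/-- No `K₄` in color `a`. -/
def NoK4 (c : α → α → K) (a : K) (W : Finset α) : Prop :=
  ∀ w ∈ W, ∀ x ∈ W, ∀ y ∈ W, ∀ z ∈ W, Ed c a w x → Ed c a w y → Ed c a w z →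
    Ed c a x y → Ed c a x z → Ed c a y z → False

theorem NoK4.mono {c : α → α → K} {a : K} {W W' : Finset α} (h : NoK4 c a W) (hw : W' ⊆ W) :
    NoK4 c a W' := fun x hx y hy p hp q hq => h x (hw hx) y (hw hy) p (hw hp) q (hw hq)

/-- No `K₄ - e` (two vertices `x`, `y` both joined to the edge `p q`). -/
def NoD (c : α → α → K) (a : K) (W : Finset α) : Prop :=
  ∀ x ∈ W, ∀ y ∈ W, ∀ p ∈ W, ∀ q ∈ W, x ≠ y → Ed c a p q → Ed c a x p → Ed c a x q →
    Ed c a y p → Ed c a y q → False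

theorem NoD.mono {c : α → α → K} {a : K} {W W' : Finset α} (h : NoD c a W) (hw : W' ⊆ W) :
    NoD c a W' := fun x hx y hy p hp q hq => h x (hw hx) y (hw hy) p (hw hp) q (hw hq)

theorem NoD.noK4 {c : α → α → K} (_hs : Sy c) {a : K} {W : Finset α} (h : NoD c a W) :
    NoK4 c a W := fun w hw x hx y hy z hz h1 h2 h3 h4 h5 h6 =>
  h w hw x hx y hy z hz h1.1 h6 h2 h3 h4 h5

theorem nb_noE {c : α → α → K} {a : K} {T : Finset α} {v : α} (hv : v ∈ T) (h : NoT c a T) :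
    NoE c a (nb c a v T) := by
  intro x hx y hy e
  rw [mem_nb] at hx hy
  exact h v hv x hx.1 y hy.1 hx.2 hy.2 e

theorem nb_noT {c : α → α → K} {a : K} {T : Finset α} {v : α} (hv : v ∈ T) (h : NoK4 c a T) :
    NoT c a (nb c a v T) := by
  intro x hx y hy z hz e f g
  rw [mem_nb] at hx hy hz
  exact h v hv x hx.1 y hy.1 z hz.1 hx.2 hy.2 hz.2 e f g

theorem nb_noP {c : α → α → K} {a : K} {T : Finset α} {v : α} (hs : Sy c) (hv : v ∈ T)
    (h : NoD c a T) :
    NoP c a (nb c a v T) := by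
  intro x hx y hy z hz hyz e f
  rw [mem_nb] at hx hy hz
  exact h y hy.1 z hz.1 v hv x hx.1 hyz hx.2 (hy.2.symm hs) (e.symm hs) (hz.2.symm hs) (f.symm hs)

theorem nb_noD {c : α → α → K} {a : K} {T : Finset α} {v : α} (hs : Sy c) (hv : v ∈ T)
    (h : NoH c a T) :
    NoD c a (nb c a v T) := by
  intro x hx y hy p hp q hq hxy e1 e2 e3 e4 e5
  rw [mem_nb] at hx hy hp hq
  exact h x hx.1 y hy.1 v hv p hp.1 q hq.1 hxy hp.2 hq.2 e1 (hx.2.symm hs) e2 e3 (hy.2.symm hs) e4 e5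

theorem card_E_T {c : α → α → K} {a b : K} {T : Finset α} (h2 : Two c a b T) (ha : NoE c a T)
    (hb : NoT c b T) : T.card ≤ 2 := by
  by_contra h
  obtain ⟨x, hx, y, hy, z, hz, h1, h3, h4⟩ := exists3 (T := T) (by omega)
  exact hb x hx y hy z hz (h2.ed hx hy h1 (ha _ hx _ hy)) (h2.ed hx hz h3 (ha _ hx _ hz))
    (h2.ed hy hz h4 (ha _ hy _ hz))

theorem card_E_P {c : α → α → K} {a b : K} {T : Finset α} (h2 : Two c a b T) (ha : NoE c a T)
    (hb : NoP c b T) : T.card ≤ 2 := card_E_T h2 ha hb.noT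

theorem card_E_K4 {c : α → α → K} {a b : K} {T : Finset α} (h2 : Two c a b T) (ha : NoE c a T)
    (hb : NoK4 c b T) : T.card ≤ 3 := by
  by_contra h
  obtain ⟨w, hw, x, hx, y, hy, z, hz, n1, n2, n3, n4, n5, n6⟩ := exists4 (T := T) (by omega)
  have q := fun {u v} hu hv n => h2.ed (u := u) (v := v) hu hv n (ha _ hu _ hv)
  exact hb w hw x hx y hy z hz (q hw hx n1) (q hw hy n2) (q hw hz n3) (q hx hy n4) (q hx hz n5)
    (q hy hz n6)

theorem card_E_H {c : α → α → K} {a b : K} {T : Finset α} (h2 : Two c a b T) (ha : NoE c a T)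
    (hb : NoH c b T) : T.card ≤ 4 := by
  by_contra h
  obtain ⟨v, hv, w, hw, x, hx, y, hy, z, hz, m1, m2, m3, m4, n1, n2, n3, n4, n5, n6⟩ :=
    exists5 (T := T) (by omega)
  have q := fun {u v} hu hv n => h2.ed (u := u) (v := v) hu hv n (ha _ hu _ hv)
  exact hb v hv w hw x hx y hy z hz m1 (q hx hy n4) (q hx hz n5) (q hy hz n6) (q hv hx m2)
    (q hv hy m3) (q hv hz m4) (q hw hx n1) (q hw hy n2) (q hw hz n3)

/-- `R(3,3) ≤ 6`. -/
theorem card_T_T {c : α → α → K} {a b : K} (hab : a ≠ b) {T : Finset α} (h2 : Two c a b T)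
    (ha : NoT c a T) (hb : NoT c b T) : T.card ≤ 5 := by
  by_contra h
  obtain ⟨v, hv⟩ := Finset.card_pos.1 (by omega : 0 < T.card)
  have h0 := h2.card hab hv
  have h3 := card_E_T (h2.mono nb_subset) (nb_noE hv ha) (hb.mono nb_subset)
  have h4 := card_E_T (h2.swap.mono nb_subset) (nb_noE hv hb) (ha.mono nb_subset)
  omega

/-- `R(3,4) ≤ 9`. -/
theorem card_T_K4 {c : α → α → K} (hs : Sy c) {a b : K} (hab : a ≠ b) {T : Finset α}
    (h2 : Two c a b T) (ha : NoT c a T) (hb : NoK4 c b T) : T.card ≤ 8 := by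
  by_contra h
  obtain ⟨S, hS, hc⟩ := Finset.exists_subset_card_eq (by omega : 9 ≤ T.card)
  replace h2 := h2.mono hS
  replace ha := ha.mono hS
  replace hb := hb.mono hS
  have h5 : ∀ v ∈ S, (nb c a v S).card = 3 := by
    intro v hv
    have h0 := h2.card hab hv
    have h3 := card_E_K4 (h2.mono nb_subset) (nb_noE hv ha) (hb.mono nb_subset)
    have h4 := card_T_T hab (h2.mono nb_subset) (ha.mono nb_subset) (nb_noT hv hb)
    omega
  have := deg2_even hs (a := a) S
  unfold deg2 at this
  rw [Finset.sum_congr rfl h5, Finset.sum_const, hc] at this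
  revert this; decide

theorem card_P_T {c : α → α → K} {a b : K} (hab : a ≠ b) {T : Finset α}
    (h2 : Two c a b T) (ha : NoP c a T) (hb : NoT c b T) : T.card ≤ 4 := by
  by_cases h : T.card = 0
  · omega
  obtain ⟨v, hv⟩ := Finset.card_pos.1 (by omega : 0 < T.card)
  have h0 := h2.card hab hv
  have h3 := card_E_T (h2.swap.mono nb_subset) (nb_noE hv hb) (ha.noT.mono nb_subset)
  have h4 : (nb c a v T).card ≤ 1 := by
    rw [Finset.card_le_one]
    intro x hx y hy
    rw [mem_nb] at hx hy
    by_contra hn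
    exact ha v hv x hx.1 y hy.1 hn hx.2 hy.2
  omega

/-- `R(K₃, K₄ - e) ≤ 7`. -/
theorem card_D_T {c : α → α → K} (hs : Sy c) {a b : K} (hab : a ≠ b) {T : Finset α}
    (h2 : Two c a b T) (ha : NoD c a T) (hb : NoT c b T) : T.card ≤ 6 := by
  by_contra h
  obtain ⟨S, hS, hc⟩ := Finset.exists_subset_card_eq (by omega : 7 ≤ T.card)
  replace h2 := h2.mono hS
  replace ha := ha.mono hS
  replace hb := hb.mono hS
  have h5 : ∀ v ∈ S, (nb c a v S).card = 3 := by
    intro v hv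
    have h0 := h2.card hab hv
    have h3 := card_E_K4 (h2.swap.mono nb_subset) (nb_noE hv hb) ((ha.noK4 hs).mono nb_subset)
    have hP := nb_noP hs hv ha
    have h4 := card_P_T hab (h2.mono nb_subset) hP (hb.mono nb_subset)
    by_contra h6
    have h7 : (nb c a v S).card = 4 := by omega
    obtain ⟨x, hx⟩ := Finset.card_pos.1 (by omega : 0 < (nb c b v S).card)
    set A := nb c a v S with hA
    have h2A : Two c a b A := h2.mono nb_subset
    have hbA : NoT c b A := hb.mono nb_subset
    -- x is joined in color b to at most ... vertices of A
    have e1 : A = nb c a x A ∪ nb c b x A := by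
      ext u
      simp only [Finset.mem_union, mem_nb]
      constructor
      · intro hu
        have hux : x ≠ u := by
          rintro rfl
          exact hab ((mem_nb.1 hu).2.2.symm.trans (mem_nb.1 hx).2.2)
        by_cases e' : Ed c a x u
        · exact Or.inl ⟨hu, e'⟩
        · exact Or.inr ⟨hu, h2.ed (nb_subset hx) (nb_subset hu) hux e'⟩
      · tauto
    have e2 : NoE c a (nb c a x A) := by
      intro p hp q hq e
      rw [mem_nb] at hp hq hx
      have hp1 := mem_nb.1 hp.1
      have hq1 := mem_nb.1 hq.1
      exact ha x hx.1 v hv p hp1.1 q hq1.1 hx.2.1.symm e hp.2 hq.2 hp1.2 hq1.2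
    have e3 : NoE c b (nb c b x A) := by
      intro p hp q hq e
      rw [mem_nb] at hp hq
      exact hb x (nb_subset hx) p (nb_subset hp.1) q (nb_subset hq.1) hp.2 hq.2 e
    have e4 := card_E_T (h2A.mono nb_subset) e2 (hbA.mono nb_subset)
    have e5 := card_E_T (h2A.swap.mono nb_subset) e3 (hP.noT.mono nb_subset)
    have e6 := Finset.card_union_le (nb c a x A) (nb c b x A)
    rw [← e1, h7] at e6
    -- an a-free pair p,p' red to x, a b-free pair q,q' blue to x
    obtain ⟨p, hp, p', hp', hpp⟩ := exists2 (T := nb c a x A) (by omega)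
    obtain ⟨q, hq, q', hq', hqq⟩ := exists2 (T := nb c b x A) (by omega)
    have f1 := h2A.ed (nb_subset hp) (nb_subset hp') hpp (e2 _ hp _ hp')
    have f2 := h2A.swap.ed (nb_subset hq) (nb_subset hq') hqq (e3 _ hq _ hq')
    have dis : ∀ u ∈ nb c a x A, ∀ w ∈ nb c b x A, u ≠ w := by
      intro u hu w hw e
      subst e
      exact hab ((mem_nb.1 hu).2.2.symm.trans (mem_nb.1 hw).2.2)
    -- q has no further a-neighbour, so q is b-joined to p, p'
    have g1 : Ed c b q p := h2A.ed (nb_subset hq) (nb_subset hp) (dis _ hp _ hq).symm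
      (fun e => hP q (nb_subset hq) p (nb_subset hp) q' (nb_subset hq') (dis _ hp _ hq') e f2)
    have g2 : Ed c b q p' := h2A.ed (nb_subset hq) (nb_subset hp') (dis _ hp' _ hq).symm
      (fun e => hP q (nb_subset hq) p' (nb_subset hp') q' (nb_subset hq') (dis _ hp' _ hq') e f2)
    exact hbA q (nb_subset hq) p (nb_subset hp) p' (nb_subset hp') g1 g2 f1
  have := deg2_even hs (a := a) S
  unfold deg2 at this
  rw [Finset.sum_congr rfl h5, Finset.sum_const, hc] at this
  revert this; decide

/-- `R(K₃, K₅ - e) ≤ 11`. -/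
theorem card_H_T {c : α → α → K} (hs : Sy c) {a b : K} (hab : a ≠ b) {T : Finset α}
    (h2 : Two c a b T) (ha : NoH c a T) (hb : NoT c b T) : T.card ≤ 10 := by
  by_contra h
  obtain ⟨S, hS, hc⟩ := Finset.exists_subset_card_eq (by omega : 11 ≤ T.card)
  replace h2 := h2.mono hS
  replace ha := ha.mono hS
  replace hb := hb.mono hS
  have hdeg : ∀ v ∈ S, (nb c a v S).card = 6 ∧ (nb c b v S).card = 4 := by
    intro v hv
    have h0 := h2.card hab hv
    have h3 := card_E_H (h2.swap.mono nb_subset) (nb_noE hv hb) (ha.mono nb_subset)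
    have h4 := card_D_T hs hab (h2.mono nb_subset) (nb_noD hs hv ha) (hb.mono nb_subset)
    omega
  obtain ⟨v, hv⟩ := Finset.card_pos.1 (by omega : 0 < S.card)
  obtain ⟨hR6, hB4⟩ := hdeg v hv
  set R := nb c a v S with hR
  set B := nb c b v S with hB
  have hRS : R ⊆ S := nb_subset
  have hBS : B ⊆ S := nb_subset
  have hBE : NoE c b B := nb_noE hv hb
  have hBa : ∀ p ∈ B, ∀ q ∈ B, p ≠ q → Ed c a p q := fun p hp q hq n =>
    (h2.mono hBS).swap.ed hp hq n (hBE _ hp _ hq)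
  have hRBd : ∀ u ∈ R, ∀ p ∈ B, u ≠ p := by
    intro u hu p hp e
    subst e
    exact hab ((mem_nb.1 hu).2.2.symm.trans (mem_nb.1 hp).2.2)
  have hRBcard : ∀ u ∈ R, (nb c a u B).card + (nb c b u B).card = 4 := by
    intro u hu
    rw [← hB4, ← Finset.card_union_of_disjoint]
    · congr 1
      ext p
      simp only [Finset.mem_union, mem_nb]
      constructor
      · tauto
      · intro hp
        by_cases e : Ed c a u p
        · exact Or.inl ⟨hp, e⟩
        · exact Or.inr ⟨hp, h2.ed (hRS hu) (hBS hp) (hRBd u hu p hp) e⟩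
    · rw [Finset.disjoint_left]
      intro p h1 h2
      exact hab ((mem_nb.1 h1).2.2.symm.trans (mem_nb.1 h2).2.2)
  have hβ2 : ∀ u ∈ R, 2 ≤ (nb c b u B).card := by
    intro u hu
    by_contra hlt
    have h1 := hRBcard u hu
    obtain ⟨p, hp, q, hq, r, hr, n1, n2, n3⟩ := exists3 (T := nb c a u B) (by omega)
    have : ∃ s ∈ B, s ≠ p ∧ s ≠ q ∧ s ≠ r := by
      by_contra hcon
      push Not at hcon
      have hsub : B ⊆ {p, q, r} := by
        intro s hs'
        have := hcon s hs'
        simp only [Finset.mem_insert, Finset.mem_singleton]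
        tauto
      have := Finset.card_le_card hsub
      have := Finset.card_le_three (a := p) (b := q) (c := r)
      omega
    obtain ⟨s, hs1, m1, m2, m3⟩ := this
    rw [mem_nb] at hp hq hr
    exact ha u (hRS hu) s (hBS hs1) p (hBS hp.1) q (hBS hq.1) r (hBS hr.1) (hRBd u hu s hs1)
      (hBa _ hp.1 _ hq.1 n1) (hBa _ hp.1 _ hr.1 n2) (hBa _ hq.1 _ hr.1 n3) hp.2 hq.2 hr.2
      (hBa _ hs1 _ hp.1 m1) (hBa _ hs1 _ hq.1 m2) (hBa _ hs1 _ hr.1 m3)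
  have hSsplit : ∀ u ∈ S, u ≠ v → u ∈ R ∨ u ∈ B := by
    intro u hu n
    by_cases e : Ed c a v u
    · exact Or.inl (mem_nb.2 ⟨hu, e⟩)
    · exact Or.inr (mem_nb.2 ⟨hu, h2.ed hv hu n.symm e⟩)
  have hB3 : ∀ s ∈ B, (nb c b s R).card = 3 := by
    intro s hs1
    have h4 := (hdeg s (hBS hs1)).2
    have h5 : nb c b s S = insert v (nb c b s R) := by
      ext u
      simp only [Finset.mem_insert, mem_nb]
      constructor
      · intro ⟨hu, e⟩
        by_cases n : u = v
        · exact Or.inl n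
        · rcases hSsplit u hu n with h | h
          · exact Or.inr ⟨h, e⟩
          · exact absurd e (hBE _ hs1 _ h)
      · rintro (rfl | h)
        · exact ⟨hv, (mem_nb.1 hs1).2.symm hs⟩
        · exact ⟨hRS h.1, h.2⟩
    have h6 : v ∉ nb c b s R := by
      intro h6
      exact ((mem_nb.1 (mem_nb.1 h6).1).2.1) rfl
    rw [h5, Finset.card_insert_of_notMem h6] at h4
    omega
  have hsum : ∑ u ∈ R, (nb c b u B).card = 12 := by
    have h1 : ∑ u ∈ R, (nb c b u B).card = ∑ s ∈ B, (nb c b s R).card := by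
      have : ∀ u ∈ R, (nb c b u B).card = ∑ s ∈ B, if Ed c b u s then 1 else 0 := by
        intro u _; simp [nb]
      rw [Finset.sum_congr rfl this, Finset.sum_comm]
      apply Finset.sum_congr rfl
      intro s _
      simp only [nb, Finset.card_filter]
      apply Finset.sum_congr rfl
      intro u _
      have : Ed c b u s ↔ Ed c b s u := ⟨Ed.symm hs, Ed.symm hs⟩
      simp [this]
    rw [h1, Finset.sum_congr rfl hB3, Finset.sum_const, hB4]; rfl
  have hβ : ∀ u ∈ R, (nb c b u B).card = 2 := by
    intro u hu
    by_contra hne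
    have hlt : 2 < (nb c b u B).card := lt_of_le_of_ne (hβ2 u hu) (Ne.symm hne)
    have := Finset.sum_lt_sum (f := fun _ => 2) (g := fun u => (nb c b u B).card) (s := R) hβ2 ⟨u, hu, hlt⟩
    simp only [Finset.sum_const, hsum, hR6] at this
    simp at this
  have hRb : ∀ u ∈ R, (nb c b u R).card = 2 := by
    intro u hu
    have h4 := (hdeg u (hRS hu)).2
    have h5 : nb c b u S = nb c b u B ∪ nb c b u R := by
      ext w
      simp only [Finset.mem_union, mem_nb]
      constructor
      · intro ⟨hw, e⟩
        have n : w ≠ v := by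
          rintro rfl
          exact hab ((mem_nb.1 hu).2.2.symm.trans ((hs _ _).trans e.2))
        rcases hSsplit w hw n with h | h
        · exact Or.inr ⟨h, e⟩
        · exact Or.inl ⟨h, e⟩
      · rintro (h | h)
        · exact ⟨hBS h.1, h.2⟩
        · exact ⟨hRS h.1, h.2⟩
    have h6 : Disjoint (nb c b u B) (nb c b u R) := by
      rw [Finset.disjoint_left]
      intro w h1 h2
      exact hRBd w (mem_nb.1 h2).1 w (mem_nb.1 h1).1 rfl
    rw [h5, Finset.card_union_of_disjoint h6, hβ u hu] at h4
    omega
  -- blue neighbours in R have complementary sets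
  have hcomp : ∀ u ∈ R, ∀ w ∈ R, Ed c b u w → nb c b w B = B \ nb c b u B := by
    intro u hu w hw e
    apply Finset.eq_of_subset_of_card_le
    · intro p hp
      rw [Finset.mem_sdiff]
      refine ⟨nb_subset hp, fun hp' => ?_⟩
      exact hb u (hRS hu) w (hRS hw) p (hBS (nb_subset hp)) e (mem_nb.1 hp').2 (mem_nb.1 hp).2
    · rw [hβ w hw, Finset.card_sdiff_of_subset nb_subset, hB4, hβ u hu]
  let C : Finset α → Finset α := fun P => R.filter (fun u => nb c b u B = P)
  have hC2 : ∀ u ∈ R, 2 ≤ (C (B \ nb c b u B)).card := by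
    intro u hu
    rw [← hRb u hu]
    apply Finset.card_le_card
    intro w hw
    rw [mem_nb] at hw
    exact Finset.mem_filter.2 ⟨hw.1, hcomp u hu w hw.1 hw.2⟩
  have hC2' : ∀ u ∈ R, 2 ≤ (C (nb c b u B)).card := by
    intro u hu
    obtain ⟨w, hw⟩ := Finset.card_pos.1 (by have := hRb u hu; omega : 0 < (nb c b u R).card)
    rw [mem_nb] at hw
    have h1 := hcomp w hw.1 u hu (hw.2.symm hs)
    rw [h1]
    exact hC2 w hw.1
  obtain ⟨u0, hu0⟩ := Finset.card_pos.1 (by omega : 0 < R.card)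
  set P := nb c b u0 B with hP
  have hPB : P ⊆ B := nb_subset
  have hP2 : P.card = 2 := hβ u0 hu0
  have hcov : ∀ w ∈ R, nb c b w B = P ∨ nb c b w B = B \ P := by
    intro w hw
    by_contra hcon
    push Not at hcon
    set Q := nb c b w B with hQ
    have hQB : Q ⊆ B := nb_subset
    have hQ2 : Q.card = 2 := hβ w hw
    have k1 : 2 ≤ (C (B \ P)).card := hC2 u0 hu0
    have k2 : 2 ≤ (C P).card := hC2' u0 hu0
    have k3 : 2 ≤ (C (B \ Q)).card := hC2 w hw
    have k4 : 2 ≤ (C Q).card := hC2' w hw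
    have hdis : ∀ X Y : Finset α, X ≠ Y → Disjoint (C X) (C Y) := by
      intro X Y hXY
      rw [Finset.disjoint_left]
      intro z h1 h2
      exact hXY ((Finset.mem_filter.1 h1).2.symm.trans (Finset.mem_filter.1 h2).2)
    have hPc : P ≠ B \ P := by
      intro e
      obtain ⟨p, hp⟩ := Finset.card_pos.1 (by omega : 0 < P.card)
      have := e ▸ hp
      exact (Finset.mem_sdiff.1 this).2 hp
    have hQc : Q ≠ B \ Q := by
      intro e
      obtain ⟨p, hp⟩ := Finset.card_pos.1 (by omega : 0 < Q.card)
      have := e ▸ hp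
      exact (Finset.mem_sdiff.1 this).2 hp
    have hQP' : B \ Q ≠ P := by
      intro e; apply hcon.2; rw [← e, Finset.sdiff_sdiff_eq_self hQB]
    have hQP'' : B \ Q ≠ B \ P := by
      intro e; apply hcon.1
      rw [← Finset.sdiff_sdiff_eq_self hQB, e, Finset.sdiff_sdiff_eq_self hPB]
    have hsub : (C P ∪ C (B \ P)) ∪ (C Q ∪ C (B \ Q)) ⊆ R := by
      intro z hz
      simp only [Finset.mem_union, C, Finset.mem_filter] at hz
      tauto
    have := Finset.card_le_card hsub
    rw [Finset.card_union_of_disjoint, Finset.card_union_of_disjoint (hdis _ _ hPc),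
      Finset.card_union_of_disjoint (hdis _ _ hQc)] at this
    · omega
    · rw [Finset.disjoint_union_left, Finset.disjoint_union_right, Finset.disjoint_union_right]
      exact ⟨⟨hdis _ _ hcon.1.symm, hdis _ _ hQP'.symm⟩, ⟨hdis _ _ hcon.2.symm, hdis _ _ hQP''.symm⟩⟩
  obtain ⟨s, hs1⟩ := Finset.card_pos.1 (by omega : 0 < P.card)
  have hT3 := hB3 s (hPB hs1)
  have hTP : ∀ u ∈ nb c b s R, nb c b u B = P := by
    intro u hu
    rw [mem_nb] at hu
    rcases hcov u hu.1 with h | h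
    · exact h
    · have : s ∈ nb c b u B := mem_nb.2 ⟨hPB hs1, hu.2.symm hs⟩
      rw [h] at this
      exact absurd hs1 (Finset.mem_sdiff.1 this).2
  obtain ⟨x, hx, y, hy, z, hz, n1, n2, n3⟩ := exists3 (T := nb c b s R) (by omega)
  obtain ⟨p, hp, q, hq, npq⟩ := exists2 (T := B \ P) (by
    rw [Finset.card_sdiff_of_subset hPB, hB4]; omega)
  have red1 : ∀ u ∈ nb c b s R, ∀ w ∈ nb c b s R, u ≠ w → Ed c a u w := by
    intro u hu w hw n
    rw [mem_nb] at hu hw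
    refine h2.swap.ed (hRS hu.1) (hRS hw.1) n (fun e => ?_)
    exact hb s (hBS (hPB hs1)) u (hRS hu.1) w (hRS hw.1) hu.2 hw.2 e
  have red2 : ∀ u ∈ nb c b s R, ∀ w ∈ B \ P, Ed c a w u := by
    intro u hu w hw
    have hu' := mem_nb.1 hu
    rw [Finset.mem_sdiff] at hw
    refine h2.swap.ed (hBS hw.1) (hRS hu'.1) (hRBd u hu'.1 w hw.1).symm (fun e => ?_)
    apply hw.2
    rw [← hTP u hu]
    exact mem_nb.2 ⟨hw.1, e.symm hs⟩
  have hS' : ∀ u ∈ nb c b s R, u ∈ S := fun u hu => hRS (nb_subset hu)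
  exact ha p (hBS (Finset.mem_sdiff.1 hp).1) q (hBS (Finset.mem_sdiff.1 hq).1) x (hS' x hx) y
    (hS' y hy) z (hS' z hz) npq (red1 x hx y hy n1) (red1 x hx z hz n2) (red1 y hy z hz n3)
    (red2 x hx p hp) (red2 y hy p hp) (red2 z hz p hp) (red2 x hx q hq) (red2 y hy q hq)
    (red2 z hz q hq)
end
end GRH


namespace GRH
/-! ### Certified enumeration of small graphs: the computable part -/

/-- Bit test. -/
def tb (m n : ℕ) : Bool := Nat.beq (Nat.land (Nat.shiftRight m n) 1) 1

/-- Evaluate a number before passing it on. -/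
def force {β : Type} (n : ℕ) (f : ℕ → β) : β := Nat.casesOn n (f 0) (fun k => f (k + 1))

/-- Adjacency in a graph given by its lower triangular rows. -/
def rd (g : List ℕ) (i j : ℕ) : Bool :=
  cond (Nat.blt j i) (tb (g.getD i 0) j) (cond (Nat.blt i j) (tb (g.getD j 0) i) false)

def bl (g : List ℕ) (i j : ℕ) : Bool :=
  cond (Nat.blt j i) (!tb (g.getD i 0) j) (cond (Nat.blt i j) (!tb (g.getD j 0) i) false)

def subm (m S : ℕ) : Bool := Nat.beq (Nat.land S m) m

def bit (i : ℕ) : ℕ := Nat.shiftLeft 1 i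

/-- Forbidden sets (largest element `i`) for the neighbourhood of a new vertex, chain version. -/
def bsS (m : ℕ) (g : List ℕ) (i : ℕ) : List ℕ :=
  (List.range i).flatMap fun j =>
    cond (rd g i j && (List.range m).any fun k => rd g i k && rd g j k)
      [Nat.lor (bit i) (bit j)]
      ((List.range j).flatMap fun k =>
        cond ((rd g i j && (rd g i k || rd g j k)) || (rd g i k && rd g j k))
          [Nat.lor (Nat.lor (bit i) (bit j)) (bit k)] [])

/-- Forbidden sets for the neighbourhood of a cone: red triangles. -/
def bsC (g : List ℕ) (i : ℕ) : List ℕ :=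
  (List.range i).flatMap fun j => cond (rd g i j)
      ((List.range j).flatMap fun k =>
        cond (rd g i k && rd g j k) [Nat.lor (Nat.lor (bit i) (bit j)) (bit k)] []) []

/-- Forbidden sets for the complement. -/
def bsT (m : ℕ) (g : List ℕ) (i : ℕ) : List ℕ :=
  (List.range i).flatMap fun j => (List.range j).flatMap fun k =>
    cond (bl g i j && bl g i k && bl g j k)
      (cond ((List.range m).any fun l => bl g l i && bl g l j && bl g l k)
        [Nat.lor (Nat.lor (bit i) (bit j)) (bit k)]
        ((List.range k).flatMap fun l =>
          cond ((bl g i l && (bl g j l || bl g k l)) || (bl g j l && bl g k l))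
            [Nat.lor (Nat.lor (Nat.lor (bit i) (bit j)) (bit k)) (bit l)] []))
      (cond ((bl g i j && (bl g i k || bl g j k)) || (bl g i k && bl g j k))
        ((List.range k).flatMap fun l =>
          cond (bl g i l && bl g j l && bl g k l)
            [Nat.lor (Nat.lor (Nat.lor (bit i) (bit j)) (bit k)) (bit l)] []) [])

/-- All admissible neighbourhoods, with their sizes. -/
def dfs : List (ℕ × List ℕ × List ℕ) → ℕ → ℕ → ℕ → List (ℕ × ℕ)
  | [], S, _, d => [(S, d)]
  | (i, bs, bt) :: r, S, T, d =>
    (force (Nat.lor S (bit i)) fun S' => cond (bs.any fun m => subm m S') []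
      (force (d + 1) fun d' => dfs r S' T d')) ++
    (force (Nat.lor T (bit i)) fun T' => cond (bt.any fun m => subm m T') [] (dfs r S T' d))

def lvS (m : ℕ) (g : List ℕ) : List (ℕ × List ℕ × List ℕ) :=
  (List.range m).map fun i => (i, bsS m g i, bsT m g i)

def lvC (m : ℕ) (g : List ℕ) : List (ℕ × List ℕ × List ℕ) :=
  (List.range m).map fun i => (i, bsC g i, bsT m g i)

def pm (p i : ℕ) : ℕ := Nat.land (Nat.shiftRight p (4 * i)) 15

/-- The permutation `p` maps `h` (on `n` vertices) into `g` (on `m` vertices). -/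
def isoChk (m n : ℕ) (g h : List ℕ) (p : ℕ) : Bool :=
  (List.range n).all fun i => force (pm p i) fun x => Nat.blt x m && (List.range i).all fun j =>
    force (pm p j) fun y => !Nat.beq x y && (rd g x y == tb (h.getD i 0) j)

/-- Every large extension is isomorphic to a listed graph, as witnessed by the hints. -/
def hintChk (m thr e : ℕ) (g : List ℕ) (N : List (ℕ × List ℕ)) :
    List (ℕ × ℕ) → List ℕ → Bool
  | [], _ => true
  | (S, d) :: r, hs =>
    cond (Nat.ble (d * (m + 1)) (2 * (e + d)) && Nat.ble thr (e + d))
      (match hs with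
        | [] => false
        | h :: hs' => (match N[h % 128]? with
            | none => false
            | some (e', g') => Nat.beq e' (e + d) && isoChk (m + 1) (m + 1) (g ++ [S]) g' (h / 128)) &&
              hintChk m thr e g N r hs')
      (hintChk m thr e g N r hs)

def stepChk (m thr : ℕ) (N : List (ℕ × List ℕ)) : List (ℕ × List ℕ) → List (List ℕ) → Bool
  | [], _ => true
  | (_, _) :: _, [] => false
  | (e, g) :: r, h :: hs => hintChk m thr e g N (dfs (lvS m g) 0 0 0) h && stepChk m thr N r hs

def G1 : List (ℕ × List ℕ) := [(0, [0])]
def G2 : List (ℕ × List ℕ) := [(1, [0, 1])]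
def G3 : List (ℕ × List ℕ) := [(2, [0, 0, 3]), (3, [0, 1, 3])]
def G4 : List (ℕ × List ℕ) := [(4, [0, 1, 1, 6]), (4, [0, 0, 2, 7])]
def G5 : List (ℕ × List ℕ) := [(6, [0, 1, 0, 5, 14]), (6, [0, 1, 0, 4, 15]), (6, [0, 0, 0, 7, 7])]
def G6 : List (ℕ × List ℕ) := [(8, [0, 0, 3, 1, 10, 28]), (8, [0, 0, 1, 5, 6, 26]), (8, [0, 0, 1,
  1, 14, 14]), (9, [0, 1, 3, 1, 10, 28]), (9, [0, 1, 1, 1, 14, 14]), (8, [0, 0, 0, 3, 5, 30]), (8,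
  [0, 0, 0, 3, 12, 23]), (8, [0, 0, 0, 0, 15, 15])]
def G7 : List (ℕ × List ℕ) := [(10, [0, 1, 1, 6, 2, 20, 56]), (10, [0, 1, 1, 2, 10, 12, 52]), (10,
  [0, 1, 1, 2, 2, 28, 28]), (10, [0, 0, 1, 1, 6, 10, 60]), (10, [0, 0, 1, 1, 6, 12, 58]), (10, [0,
  0, 1, 1, 2, 28, 30]), (11, [0, 1, 1, 1, 6, 10, 60]), (10, [0, 0, 2, 5, 1, 20, 58]), (10, [0, 0, 0,
  1, 1, 30, 30]), (11, [0, 0, 3, 3, 1, 18, 60]), (10, [0, 0, 0, 1, 10, 7, 60]), (10, [0, 0, 0, 1,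
  10, 13, 54]), (10, [0, 0, 0, 1, 10, 21, 46]), (10, [0, 0, 0, 1, 2, 29, 30]), (10, [0, 0, 0, 1, 8,
  23, 30]), (10, [0, 0, 0, 0, 7, 11, 60]), (10, [0, 0, 2, 6, 2, 20, 57]), (10, [0, 0, 0, 6, 6, 6,
  57]), (10, [0, 0, 1, 6, 4, 24, 51]), (10, [0, 0, 1, 2, 12, 12, 51]), (10, [0, 0, 1, 2, 12, 20,
  43]), (10, [0, 0, 0, 1, 10, 12, 55]), (11, [0, 0, 2, 2, 2, 29, 29]), (11, [0, 0, 2, 2, 12, 7,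
  57]), (11, [0, 0, 2, 2, 4, 27, 29]), (11, [0, 0, 0, 6, 6, 7, 57]), (12, [0, 0, 0, 0, 15, 15, 15])]
def G8 : List (ℕ × List ℕ) := [(13, [0, 1, 1, 1, 2, 2, 60, 60]), (13, [0, 1, 1, 1, 2, 4, 58, 60]),
  (14, [0, 0, 0, 1, 1, 30, 30, 30]), (13, [0, 1, 2, 1, 1, 4, 58, 60]), (13, [0, 0, 3, 1, 1, 10, 18,
  124]), (15, [0, 0, 1, 1, 1, 30, 30, 30]), (16, [0, 1, 1, 1, 1, 30, 30, 30]), (13, [0, 1, 0, 4, 4,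
  5, 58, 58]), (13, [0, 1, 0, 4, 4, 25, 14, 114]), (13, [0, 1, 0, 4, 4, 9, 54, 58]), (13, [0, 1, 0,
  4, 0, 21, 30, 58]), (13, [0, 1, 0, 4, 4, 25, 26, 102]), (13, [0, 1, 1, 2, 12, 1, 38, 120]), (13,
  [0, 1, 1, 2, 12, 1, 42, 116]), (13, [0, 1, 1, 2, 12, 1, 50, 108]), (13, [0, 0, 0, 4, 5, 5, 58,
  58]), (13, [0, 0, 0, 4, 5, 25, 22, 106]), (13, [0, 0, 0, 4, 5, 25, 38, 90]), (13, [0, 0, 0, 4, 5,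
  9, 54, 58]), (13, [0, 0, 0, 0, 13, 13, 22, 106]), (14, [0, 1, 0, 4, 5, 5, 58, 58]), (14, [0, 1, 0,
  4, 5, 25, 22, 106]), (14, [0, 1, 0, 4, 5, 25, 38, 90]), (14, [0, 1, 0, 0, 13, 13, 14, 114]), (14,
  [0, 1, 0, 0, 13, 13, 22, 106]), (13, [0, 1, 1, 2, 4, 8, 51, 60]), (13, [0, 1, 1, 2, 4, 8, 57,
  54]), (13, [0, 1, 0, 5, 2, 20, 7, 120]), (13, [0, 0, 0, 0, 13, 14, 37, 90]), (14, [0, 1, 0, 0, 13,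
  14, 37, 90]), (13, [0, 0, 0, 3, 5, 6, 7, 120]), (13, [0, 0, 2, 2, 2, 13, 21, 120]), (13, [0, 0, 2,
  2, 2, 13, 49, 92]), (13, [0, 0, 2, 2, 4, 19, 13, 120]), (13, [0, 0, 2, 4, 2, 11, 25, 116]), (13,
  [0, 0, 2, 4, 2, 11, 49, 92]), (13, [0, 0, 2, 2, 4, 25, 35, 92]), (13, [0, 0, 2, 2, 0, 29, 19,
  92]), (13, [0, 0, 2, 2, 0, 29, 21, 90]), (13, [0, 0, 2, 2, 4, 25, 25, 102]), (13, [0, 0, 0, 2, 4,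
  7, 57, 30]), (14, [0, 0, 0, 0, 15, 7, 11, 108]), (13, [0, 1, 0, 4, 4, 8, 54, 59]), (13, [0, 0, 0,
  4, 4, 25, 26, 103]), (13, [0, 0, 0, 4, 4, 25, 42, 87]), (14, [0, 0, 1, 2, 0, 19, 60, 31]), (13,
  [0, 0, 2, 2, 4, 8, 51, 61]), (13, [0, 0, 0, 6, 2, 20, 7, 121])]
def G9 : List (ℕ × List ℕ) := [(16, [0, 1, 1, 0, 9, 10, 44, 50, 212]), (16, [0, 1, 1, 0, 9, 10,
  44, 82, 180]), (16, [0, 1, 1, 0, 9, 10, 12, 114, 116]), (16, [0, 0, 2, 1, 9, 10, 50, 44, 212]),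
  (16, [0, 0, 2, 1, 9, 10, 50, 76, 180]), (16, [0, 0, 2, 1, 9, 10, 18, 108, 116]), (16, [0, 0, 2, 1,
  1, 26, 26, 44, 212]), (16, [0, 0, 0, 3, 5, 6, 50, 44, 216]), (16, [0, 0, 0, 3, 1, 22, 22, 44,
  216]), (16, [0, 0, 2, 1, 1, 26, 28, 74, 180]), (16, [0, 0, 0, 1, 1, 30, 14, 22, 216]), (16, [0, 0,
  0, 1, 9, 14, 14, 50, 212]), (16, [0, 0, 0, 1, 9, 22, 14, 42, 212]), (16, [0, 0, 0, 1, 1, 30, 14,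
  26, 212]), (16, [0, 0, 0, 1, 1, 30, 6, 90, 92]), (16, [0, 0, 0, 3, 1, 22, 28, 44, 210]), (16, [0,
  0, 0, 3, 1, 6, 60, 28, 178]), (17, [0, 0, 3, 1, 9, 10, 50, 44, 212]), (17, [0, 0, 3, 1, 9, 10, 50,
  76, 180]), (17, [0, 0, 3, 1, 9, 10, 18, 108, 116]), (17, [0, 0, 3, 1, 1, 26, 26, 28, 228]), (17,
  [0, 0, 3, 1, 1, 26, 26, 44, 212]), (18, [0, 1, 3, 1, 9, 10, 10, 116, 116]), (18, [0, 1, 3, 1, 9,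
  10, 50, 44, 212]), (18, [0, 1, 3, 1, 9, 10, 50, 76, 180]), (18, [0, 1, 3, 1, 1, 26, 28, 74, 180]),
  (16, [0, 1, 1, 0, 0, 25, 26, 28, 230]), (16, [0, 1, 1, 0, 8, 9, 50, 100, 158]), (17, [0, 0, 3, 1,
  10, 17, 10, 108, 116]), (16, [0, 0, 1, 1, 2, 17, 38, 42, 220]), (16, [0, 0, 2, 0, 9, 1, 42, 116,
  62]), (16, [0, 0, 0, 0, 3, 5, 42, 92, 62]), (16, [0, 1, 0, 4, 3, 5, 42, 28, 240]), (16, [0, 1, 0,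
  4, 3, 5, 10, 116, 120]), (16, [0, 1, 0, 0, 3, 5, 42, 60, 92]), (16, [0, 1, 0, 0, 13, 3, 6, 108,
  120]), (16, [0, 1, 0, 4, 5, 5, 26, 42, 240]), (16, [0, 1, 0, 4, 5, 9, 38, 26, 240]), (16, [0, 1,
  0, 0, 13, 9, 38, 38, 216]), (16, [0, 1, 0, 0, 5, 25, 38, 26, 204]), (16, [0, 1, 0, 0, 13, 5, 42,
  44, 210]), (16, [0, 1, 0, 0, 13, 5, 10, 108, 114]), (16, [0, 0, 1, 2, 3, 3, 12, 116, 120]), (16,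
  [0, 0, 1, 2, 3, 9, 6, 116, 120]), (17, [0, 0, 1, 6, 5, 9, 38, 26, 240]), (17, [0, 0, 1, 6, 9, 9,
  22, 38, 240]), (16, [0, 1, 1, 0, 0, 26, 25, 44, 214]), (17, [0, 0, 1, 1, 14, 14, 5, 74, 240]),
  (16, [0, 0, 1, 1, 2, 6, 49, 42, 220]), (16, [0, 1, 0, 4, 5, 26, 3, 84, 232]), (16, [0, 1, 0, 0,
  13, 14, 3, 84, 232]), (16, [0, 1, 0, 4, 5, 26, 3, 88, 228]), (16, [0, 1, 0, 0, 13, 14, 5, 82,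
  232]), (16, [0, 1, 0, 0, 13, 14, 5, 98, 216]), (16, [0, 1, 0, 0, 13, 10, 37, 38, 216]), (16, [0,
  1, 0, 0, 5, 26, 37, 26, 204]), (16, [0, 1, 0, 0, 5, 26, 25, 38, 204]), (16, [0, 0, 1, 2, 3, 28, 3,
  84, 232]), (16, [0, 0, 1, 2, 5, 26, 3, 100, 216]), (16, [0, 0, 1, 2, 9, 22, 3, 84, 232]), (16, [0,
  0, 1, 2, 9, 22, 3, 100, 216]), (17, [0, 0, 1, 2, 13, 14, 9, 70, 240]), (16, [0, 0, 1, 2, 0, 19,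
  25, 22, 236]), (16, [0, 0, 2, 1, 0, 21, 19, 42, 220]), (16, [0, 0, 0, 0, 15, 3, 3, 108, 108]),
  (16, [0, 0, 0, 0, 15, 3, 37, 42, 204]), (16, [0, 0, 0, 0, 15, 3, 37, 74, 172]), (16, [0, 0, 0, 0,
  11, 7, 21, 42, 204]), (17, [0, 0, 0, 6, 3, 5, 9, 120, 118]), (16, [0, 0, 0, 0, 7, 11, 37, 28,
  202]), (16, [0, 1, 1, 0, 10, 28, 10, 81, 228]), (16, [0, 1, 1, 0, 10, 28, 10, 97, 212]), (16, [0,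
  1, 0, 0, 13, 14, 12, 81, 226]), (16, [0, 1, 0, 0, 13, 14, 12, 97, 210]), (16, [0, 0, 1, 2, 1, 2,
  12, 121, 118]), (17, [0, 0, 0, 3, 5, 18, 44, 97, 158]), (16, [0, 1, 0, 4, 0, 21, 42, 81, 158]),
  (16, [0, 1, 0, 4, 0, 22, 41, 81, 158]), (17, [0, 0, 0, 0, 5, 26, 3, 109, 94]), (16, [0, 1, 1, 0,
  0, 26, 44, 82, 157]), (16, [0, 1, 1, 0, 0, 28, 26, 42, 213]), (16, [0, 1, 1, 0, 0, 28, 42, 82,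
  157]), (16, [0, 1, 0, 1, 4, 12, 38, 50, 217]), (16, [0, 0, 2, 0, 9, 10, 50, 84, 173]), (16, [0, 0,
  2, 0, 1, 26, 26, 52, 205]), (16, [0, 0, 2, 0, 1, 26, 10, 116, 93]), (16, [0, 0, 2, 0, 9, 10, 12,
  114, 117]), (16, [0, 0, 0, 0, 3, 14, 28, 70, 185]), (16, [0, 0, 0, 0, 3, 6, 60, 42, 157]), (16,
  [0, 0, 2, 0, 1, 28, 10, 114, 93]), (16, [0, 0, 0, 0, 5, 26, 26, 38, 205]), (16, [0, 1, 0, 0, 13,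
  6, 42, 44, 209]), (16, [0, 1, 0, 0, 13, 6, 10, 108, 113]), (17, [0, 0, 0, 3, 5, 18, 12, 120,
  103]), (16, [0, 0, 0, 2, 4, 1, 38, 120, 63]), (17, [0, 0, 0, 3, 12, 17, 44, 50, 199]), (16, [0, 0,
  0, 0, 7, 11, 28, 44, 195]), (16, [0, 0, 0, 1, 2, 4, 7, 120, 63]), (17, [0, 0, 0, 3, 12, 12, 49,
  50, 199]), (16, [0, 0, 0, 2, 4, 6, 24, 115, 109]), (16, [0, 0, 0, 4, 2, 6, 56, 43, 213])]
def G10 : List (ℕ × List ℕ) := [(20, [0, 1, 1, 1, 4, 24, 38, 26, 50, 460]), (20, [0, 1, 1, 1, 6,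
  10, 48, 100, 88, 398]), (20, [0, 1, 1, 1, 6, 24, 34, 88, 100, 398]), (20, [0, 1, 3, 1, 9, 10, 10,
  52, 84, 480]), (20, [0, 1, 3, 1, 9, 10, 18, 76, 52, 480]), (20, [0, 1, 3, 1, 1, 26, 18, 76, 76,
  432]), (20, [0, 1, 3, 1, 1, 26, 10, 84, 88, 420]), (20, [0, 1, 3, 1, 1, 26, 10, 20, 216, 228]),
  (20, [0, 1, 1, 3, 5, 6, 6, 24, 232, 240]), (20, [0, 1, 3, 1, 1, 10, 52, 50, 76, 408]), (20, [0, 1,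
  1, 1, 1, 30, 6, 6, 216, 216]), (20, [0, 0, 1, 1, 6, 1, 56, 12, 186, 230]), (20, [0, 0, 1, 2, 9, 1,
  6, 44, 242, 124]), (21, [0, 1, 1, 2, 12, 9, 17, 6, 242, 236]), (20, [0, 0, 0, 1, 1, 18, 10, 45,
  214, 124]), (20, [0, 0, 0, 2, 12, 9, 17, 7, 242, 236]), (20, [0, 0, 1, 1, 10, 6, 12, 112, 149,
  362]), (20, [0, 0, 1, 1, 6, 10, 36, 24, 241, 206]), (21, [0, 1, 1, 1, 6, 10, 36, 24, 241, 206]),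
  (20, [0, 0, 1, 6, 1, 2, 52, 56, 165, 346]), (20, [0, 0, 1, 6, 1, 2, 36, 88, 121, 182]), (20, [0,
  0, 1, 2, 1, 2, 60, 12, 185, 182]), (20, [0, 0, 1, 2, 1, 28, 40, 68, 211, 158]), (20, [0, 0, 2, 5,
  1, 20, 36, 88, 83, 426]), (20, [0, 0, 2, 5, 1, 20, 36, 88, 195, 314]), (20, [0, 0, 2, 5, 1, 20,
  36, 72, 211, 186]), (21, [0, 1, 0, 4, 5, 5, 26, 42, 15, 496]), (21, [0, 1, 0, 4, 5, 9, 38, 26, 15,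
  496]), (20, [0, 1, 1, 6, 2, 20, 18, 56, 104, 453]), (20, [0, 1, 1, 6, 2, 20, 34, 56, 88, 453]),
  (20, [0, 1, 1, 2, 12, 6, 10, 84, 56, 481]), (20, [0, 1, 1, 2, 12, 6, 18, 76, 56, 481]), (20, [0,
  1, 1, 2, 12, 10, 18, 76, 52, 481]), (20, [0, 1, 1, 6, 4, 24, 50, 18, 168, 453]), (20, [0, 1, 1, 2,
  12, 20, 42, 18, 168, 453]), (20, [0, 1, 1, 2, 12, 20, 42, 34, 152, 453]), (20, [0, 0, 1, 6, 1, 2,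
  52, 24, 182, 233]), (20, [0, 0, 0, 1, 2, 28, 17, 10, 220, 231]), (20, [0, 0, 2, 2, 6, 10, 12, 48,
  229, 217]), (20, [0, 0, 2, 2, 10, 6, 12, 112, 85, 425]), (20, [0, 0, 1, 2, 12, 20, 24, 96, 199,
  171]), (21, [0, 0, 2, 2, 2, 20, 12, 121, 43, 341]), (21, [0, 0, 0, 2, 4, 6, 24, 31, 115, 109])]
def G11 : List (ℕ × List ℕ) := [(24, [0, 0, 3, 1, 1, 18, 10, 41, 210, 284, 740]), (24, [0, 1, 0,
  4, 8, 4, 21, 97, 186, 142, 626]), (24, [0, 1, 0, 0, 4, 8, 13, 49, 62, 230, 218]), (24, [0, 1, 0,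
  0, 8, 4, 13, 113, 62, 86, 682]), (24, [0, 0, 3, 1, 1, 18, 10, 4, 169, 466, 252]), (24, [0, 1, 1,
  2, 12, 1, 2, 116, 120, 325, 682]), (24, [0, 0, 0, 3, 5, 6, 33, 18, 12, 455, 504]), (24, [0, 1, 0,
  5, 2, 20, 0, 71, 248, 101, 602]), (25, [0, 0, 1, 2, 0, 25, 22, 89, 54, 99, 908]), (24, [0, 1, 1,
  2, 4, 8, 16, 121, 78, 54, 865]), (24, [0, 1, 0, 5, 2, 20, 0, 71, 248, 102, 601]), (25, [0, 0, 0,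
  4, 1, 2, 7, 105, 90, 436, 63])]
def G12 : List (ℕ × List ℕ) := [(30, [0, 1, 1, 3, 5, 1, 50, 44, 178, 108, 198, 1816])]
def P1 : List (List ℕ) := [[2048]]
def P2 : List (List ℕ) := [[67585, 4224, 36864]]
def P3 : List (List ℕ) := [[626688, 1147009, 1148929], [67969, 590209, 1081729]]
def P4 : List (List ℕ) := [[8526080, 16914560, 25301122, 17438722, 25825280, 26347520], [10035200,
  18391040, 26255361]]
def P5 : List (List ℕ) := [[303728643, 136423681, 421537920, 404918405, 562112646, 555264000,
  436807686, 547000325], [553749125, 562104965, 554271365, 562627205], [279582724, 136423682,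
  270641282, 404918406, 538611846, 279029762, 413306886, 547000326, 421693446, 555386886,
  564725767]]
def P6 : List (List ℕ) := [[6487675014, 8769343494, 11302668297, 11300537088, 8903557272,
  4991365268, 7115714692, 9034608786, 11174686855, 6756108312, 5000245268, 7021867026, 9271062532,
  11300548615, 6755123342, 8902084622, 11041179658], [11300537089, 8886160148, 11158948628,
  4875387668, 7148176148, 8902084619, 11041179661, 9035778061, 11174873099], [4348057737,
  6495539337, 8776132617, 10923614217, 11300537090, 4700385413, 6713651333, 11326259350, 9009541267,
  11156992147, 6763972630, 5000245267, 7147696147, 9271062533, 11284328453, 6755123336, 8902084620,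
  11041179660, 9035778060, 11174873100, 11300702216], [6486559511, 8615793432, 10763766552,
  278569744, 6610391832, 8767734551, 10906338072, 2418187024, 6752963352, 8900936472, 11041014551,
  4431944464, 7147162384, 9286779664, 11300537104], [2191627033, 4339108633, 6486559513,
  11277537434, 8616192790, 10763674390, 420127505, 6722592794, 4473232150, 6620713750, 8750531353,
  10897982233, 2852229905, 6754929430, 8884224793, 11031675673, 4999711505, 9010053913, 11157504793,
  7147162385, 11300537110, 9010053905, 11157504785], [11016450054, 11284447511, 11174155012,
  11159142551, 11300506372, 7115682059, 9262674059, 11299523349, 11016450051, 11284328458,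
  11158990858, 11300548623], [11039945097, 11282880793, 11174155013, 7115837592, 11291167495,
  7115682061, 9262674060, 10772746389, 7124226072, 11291689735, 7124037901, 9271062540, 10906963989,
  11174707982, 9037744143], [11291603350, 11299991830, 11282780936, 11300515990, 11291167496,
  11299523336, 11300548630, 11291689736, 11300045576, 11300537096]]
def P7 : List (List ℕ) := [[45695899930, 208903241985, 78042372250, 211184910465, 144746123267,
  179106351107, 213584513036, 139916324902, 176288804902, 114012852234, 111999617034], [45560639769,
  47841814809, 75894890649, 78176065689, 179233163277, 213309261825, 181222836225, 215731472397],
  [46071812867, 48219296387, 76154407427, 78301890947, 144732360704, 179233163278, 213584513038,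
  181380122638, 215731472398, 217461622784, 105557172261, 139916908581, 176288804901, 210648541221],
  [82143062157, 116636491917, 150603536397, 185096966157, 217459165188, 211153330312, 213158209672,
  217459163295, 212913588255, 217201547272, 215196667912], [211032848409, 213284159757,
  217309220876, 211184787626, 116546605219, 185249366176, 212913588262, 185012885512, 150621292563],
  [211000408091, 213147367451, 217458980867, 82202597540, 116562333860, 181254291616, 212915062823,
  184989292553, 185123508233], [208367393069, 208350057384, 81650098328, 210488691619, 116001417368,
  212644006819, 217434372265, 214766758822, 216922104742, 206580616110, 212880472105, 184838395928,
  210623798182, 150487076888, 212779144102, 214902080419, 217057395619, 209012196270, 212913359775,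
  217199444897, 215194043297, 217458967455], [81782349825, 213306114971, 150998714636, 185230137358,
  209037922308, 150638002342, 176959881375, 179107270793, 211032971274, 215196667938, 217358311435,
  212905723932], [217174882304, 116645921063, 151005135143, 116654309543, 151013523623,
  217316040711, 217450256391, 217458642959, 217459165199], [138256488745, 174755289385,
  210497673373, 210488691620, 212645154973, 212635650980, 214791949216, 216931044261, 210624026653,
  210631263140, 212771508253, 212778222500, 214926164901, 217065259936, 215171475607, 217318989847,
  212877878183, 215058844578, 217198461858, 211159647151, 215193029538, 217332646818, 213306606511],
  [217199444876, 116668991779, 151020863779, 217461588271, 213288984712, 215438033057, 185280762028,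
  213291075617, 215436990472, 185147101228], [217199444877, 185238829219, 217317423139,
  150772189200], [217199444878, 116637534500, 148991869220, 184744511791, 217090490671,
  179047735433, 185238829218, 217317423138, 215429126153, 150772189202], [217458967425,
  181220161700, 217193128106, 213306619940, 184989292586, 150772189201], [217450120067,
  116668807462, 151020863778, 217067389230, 116668840102, 151021387938, 217201606830, 213306619941,
  151012481035], [151012260256, 185246169376, 217441343787, 217458948255, 185221748908,
  150996750508, 217458980895, 185230137388, 151005138988], [140435339272, 174786197514,
  208870651946, 142581807114, 176934139912, 211151796266, 144697800713, 179065370633],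
  [106076125195, 140435339275, 174786689035, 108223576075, 142582790155, 176934139915, 144704190471,
  179063896071, 181211346951], [82144106650, 116645924890, 150998681998, 185232621838, 176936196234,
  150772187301, 179083739297, 213332791470, 142584940577, 184989354021, 211051649070, 144732360714],
  [81648650627, 116142604547, 214885439774, 217032399134, 144748118178, 179107332258, 181253707911,
  142600669218, 176959883298, 181254262791], [82277800089, 150769055770, 217055469851, 82009890984,
  144748118179, 185123537060, 215729903786], [210631670148, 213138516266, 217063856431,
  213273256106, 215058978991, 217493016747, 213306619950, 217335762988, 215196698668], [71716419607,
  106076125207, 140435339287, 108222101524, 142581807124, 217199444871, 144729258004, 217333138311,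
  217458967431, 144203024386, 108222101519, 142581807119, 144729257999], [106076125205,
  217442747288, 184836293512, 217317409688, 142582790165, 184962614152, 217332646792, 217458967432,
  106076125200, 217442747283, 217056412588, 217317409683, 142582790160, 217198461868, 185096799148,
  185238848428], [71716419608, 148362082333, 217055377709, 184845140874, 116275165213, 184985696429,
  217199444874, 150772125846, 185120392073, 217458967433, 185120392106, 217458967466, 71716419603,
  148362082332, 116275165212, 144729749522, 213306128428, 181220194348], [184962614167, 41651615766,
  43798575126, 184853005195, 76011321366, 78158280726, 184987190155, 217458967447, 217315935115,
  217450120075, 41651615761, 43798575121, 174786689067, 76011321361, 78158280721, 176934139947,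
  213289416747, 215436867627], [107570438150, 70920059269, 105279797509, 217441211266, 107427281029,
  217449597826, 217457953666, 107561498629, 217450120066, 217458475906, 217458967426]]
def P8 : List (List ℕ) := [[1353455872166, 1353590087846, 1903211653286, 1903345868966,
  4065725071552, 4061171171392, 2452707514406, 3002463295526, 2452841730086, 3002597511206],
  [3344573929797, 3926408304837, 1800535058723, 1836908093603, 2998693796034, 1902950105184,
  3477726302262, 3964458402127, 3992997070902, 3416984781007, 4065752844290], [], [3343695028704,
  1903345930422, 2453101711542, 1343010644023, 1343019030583, 3964458836044, 3998818572364,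
  3992997068966], [3927777086288, 3929932925648, 3964292731054, 3996496629934, 3923633177168,
  3925789016528, 4061072068654, 4028868169774, 3992507852954, 4061229877310, 4029018114110,
  4065522751514], [], [], [], [3541512634418, 3541646327857, 4063719702560, 2444685477888,
  3002485966929, 4065490157614, 4029510893638, 4065623543856, 3548332474395, 3485837856842,
  3998894266375, 4063484264456, 3002597511251], [3549943661603, 2995924386106, 3548323627041,
  1836419647558, 2970265847888, 4027371798599, 3002748438610, 3997301772336, 1902981562384,
  3546179309598], [3544029216802, 4061069918243, 3997282603066, 2386174937159, 2446832437249,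
  2996579862607, 3962947504174, 3451703789595, 2420525088783, 2833346992218, 3930073079839],
  [3541646327859, 3541780512819, 1894930188290, 2444685477890, 3930601555994, 3417355358237,
  3451706707997], [3541236814917, 4056642851407, 3543375940677, 4058790365647, 3002589028661,
  3002723276981, 3416799848489, 3451284891689, 4065601913158, 4065733644340, 3541806256174,
  4065608337460, 3543820044334, 4065744486598], [3347962315075, 4056642820689, 3929922519235,
  3543394197969, 2446790502593, 3485769408818, 4033512478898, 4065467572680, 3550337568821,
  4065608337461, 4063487920128], [2317944425154, 3002211537460, 2970007701940, 3964408178728,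
  3451284891688, 3550071497161, 3541538838591, 4058948149311, 3550205837639, 4065744486599,
  4063487920129], [], [3451695694848, 4033537410048, 1729323335811, 3996787671257, 3479386194137,
  1733868914691, 2970273712217, 2452872235097], [3451695694850, 4033537410050, 1727310069892,
  3441000448214, 4027120353494, 1731855648772, 2410459957334, 2996579862614], [3451695694849,
  4033537410049, 2420902038610, 3002744245330, 3447668180050, 4029510386770, 1729323335814,
  2891378606238, 2378255319198, 1733868914694, 4059324530718, 3546201243678], [3376827368518,
  3962947273798, 2420903513169, 3002745228369, 1729323335813, 3928336629973, 3410935152853,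
  4061204103174, 2831358363731, 2317983418451], [4065749664790], [1733868914711, 3438182744465,
  4022289416465, 4033519653891, 2892990791825, 3997289253981, 2384663251975, 3479888268381,
  2902080949255, 3447651376211, 4029485257811, 4061204103185, 2970524157021, 3548331475975,
  2453123171421, 4065749173255, 2420893621331, 3002727502931, 4065749664771, 2900060802131,
  4063728534611, 2386685856851, 3550353589331, 3999303042147, 3485928588387], [1731855648792,
  3451685772307, 4033519653907, 4033519653893, 2377594716306, 3447038675396, 4029132572996,
  3545808027666, 2420525236676, 3002619134276, 4065749664772, 2416876981334, 3451695694934,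
  2998718696534, 4033537410134, 3999295177828, 3485912859748], [1729315471510, 4057302309935,
  4057302832175, 3382991503586, 3417351209186, 3545808027668], [1825965322392, 3337785360812,
  3889814454572, 4065731908619, 2892990791827, 4065488637023, 3447667657744, 3548087651423,
  4029509864464, 2453099253966, 2416859778136, 2970508073166, 2998694120536, 3548315163738,
  4065725027418, 4061204103189, 2960182745181, 3548331475976, 2446800457821, 4065749173256,
  4065749664774, 2970525109337, 4065741800532, 2453123632217, 3548340323412], [1340485150915,
  1340755548344, 2452452720837, 3447655045339, 1892254752835, 3002334855237, 1892524658744,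
  3479875719259, 3485703608529, 3451478642769], [2214241511842, 2796084273442, 82070080197,
  1115269761447, 3447655045288, 4033043565005, 668190540357, 1697112031527, 4029497315368,
  3451210269005], [3382959677659, 3855576240860, 3964298070619, 3406857251363, 3439081980329,
  3475580786780, 3892075047209, 4061093040848, 3924294369443, 3543954659408], [3378588945479,
  3960682349639, 2453123632207, 2970525140047, 3550345694288, 4063736398928, 1244244213897,
  2865340088532, 3411186811038, 1826337589257, 2283498375252, 3928588290078], [1826337589273,
  3378051170749, 3960144576829, 4063718642700, 2410443980956, 2865716347103, 3546035261643,
  4063735385103, 3548315225175, 2996563918876, 2283623006303, 4059425937483, 3550344741903,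
  4065733444695, 4065749664777, 2420903513173, 3002745259093], [], [1353596372060, 3962294059061,
  3998792368181, 4027356023865, 4063728503865, 4065524285597, 3993019957284, 3550197452955,
  3002723307675, 3992493754378, 3543796942932, 2994183702612], [1351582614619, 1901337904219,
  2420391886920, 3002601717930, 3548330967225, 4059484487856, 3548339323065, 4061631938736,
  2994183702613, 2996331153493], [4033253311527, 3964433338428, 4029494658100, 3549950120525,
  4033136034111, 4061581575220, 3996787673148, 3002484394445, 4065490370751, 3993020448805,
  2996612237595, 3548381286555, 3919883409439, 3960139419656, 3992493754376], [3927934353462,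
  2452606747065, 3549958510924, 3956514490411, 3930593691710, 3548087664827, 2442144780301],
  [3930073448504, 3002595345449, 3451685968177, 4065355972685, 4063728534581, 3548087664828,
  3541513279576, 2442144780299, 2996331122777], [3541512634459, 3412544725281, 3550337369128,
  4061581575222, 2998717726891, 3964995111250, 1892515319820, 3547823413335], [1343026249768,
  1892781539368, 2420391886921, 3956388446246, 3998926768187, 3544056859084, 3930604013631,
  3999060461627, 3546204342604, 3964963719231, 3925787547663, 3960147283983], [1343026249769,
  3998792368180, 3964565864503, 2420902205619, 4059449376844, 3999059939385, 3546204344525,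
  3990212057104, 3992493539341, 3543796942938], [3954365964330, 4065732953126, 4065606632486,
  3990872660010, 1892523184142, 2444292261902], [2993778966620, 3892089274407, 3924302020647,
  3548088680540, 2792722864216, 3439107084376, 2824935088216, 3406894860376], [567524627350,
  2832667460015, 3416782979375, 4065323129186, 3485911323662, 3956512276653, 3539743283423,
  4033528040461, 2990130073823, 4065748651021, 3956512800813, 3541890766943, 4033528562701,
  2992277557343, 4065749173261, 4065749664778], [3956514275409, 4033270038607, 3993020448848,
  4029510402130, 3550337568842, 3964534407256, 3999028297815, 4065736101974], [4065490142234,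
  4065606509597, 4065740725277, 3962428211414, 3996787425494, 4065591378148, 4065725071588,
  3964567339094, 3998926553174, 4033387511908, 4033521205348], [4059450344494, 4065623835675,
  4063727459376, 3002216333642, 3956388413657, 4029133373653, 4027339509982, 3550352773348,
  4061204103251, 4063484756052, 3002729238627], [4028816790596, 3999287282763, 2989750894926,
  3545538642126, 4065213877279, 4033512250398, 3999295177803, 2991763636686, 3543525900366,
  4065339737119, 4033521128478, 4063461147716, 4065740295198, 4065749173278, 4065749664862],
  [3919998256205, 3954365826125, 3998768268364, 4033135838284, 4056640919905, 4025224806591,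
  3993020416191, 4029486284957, 3927933861978, 3960145625178], [4061028160210, 3998751506736,
  4065354421311, 4061162900050, 4063349541951, 4033244938416, 3999025774910, 4033393868990,
  3954241179735, 3956254967895]]
def P9 : List (List ℕ) := [[74374246498595, 66127918170275, 37124810803230], [37124810803231,
  65165838028800, 73377823918080], [54686352933148, 45924762222748], [], [], [], [30421408849955,
  39799469414435, 48600315432972, 56814306201612], [73918813685761, 64059649658902, 54716082554902,
  28914000537638], [38672213514268, 74428169963522, 64049449635861, 73168160133132, 56903125831691,
  54716082063385], [30453621104674, 39767382988834, 63963926135052, 72244481032332],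
  [63500204540196, 55253875196196, 63502352023716, 55256022679716], [], [], [66018257541122,
  55026125475860], [], [39767430174749, 54166661928962, 74264594749440], [39836510361633,
  62957967513601], [66149259707550, 74432095224990, 20589033244840, 21175153641640, 73365072136345,
  65155099543705, 19493833820200, 20079954217000, 72270107166745, 64060134574105], [73365072136343,
  65155099543703, 63508373882903, 72821867857943], [48110916109468, 57424410084508, 73365072136344,
  65155099543704], [], [31040970330253, 30422361705633, 39319511437453, 39800280190113,
  48628878643213, 47941550113953, 56907419750413, 57319468598433, 66149259707551, 74432095224991,
  72267927734411, 64053669087371, 73371473233931, 65157214586891], [], [73133387287722,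
  44086290629798, 64889071701162, 52916617034918, 61680608392358, 70510934797478, 72067983803562,
  27110699779238, 63823668217002, 35941026184358, 62299335304358, 71129661709478, 54505878848682,
  27729426691238, 46261563262122, 36559753096358, 45323744453798, 54154070858918, 54607166313638,
  72267810737318, 46393175053478, 64053819477158, 73371347879078, 65157356618918], [73122255189161,
  64876043840681, 63261294994601, 72607269625001, 45701606352041, 55047580982441, 45844678055079,
  63505699966119, 55154027533479, 72815049444519, 73371222049959, 65157104960679], [],
  [74339628618264, 74373988356504, 73790015408664, 73824375146904], [66180247720343, 57420661918105,
  48638779760676, 57434610769931], [55852729401613, 48628073761949, 56906749084829],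
  [73809225548188, 66182370040344, 74361128812828, 57422784238104], [73330319462416, 57315177369614,
  73365324072979, 57293406504971, 66078654105612], [72089745377280, 73706668431371, 74288493926411,
  73165248368663, 72652000266263], [], [], [], [], [80852820894723, 39327315792017, 47573645136017,
  64066201098257, 55819871754257], [79822020387844, 75467008414080, 75503515080960, 75465146171520,
  75538159503360], [74427927152645], [72100599859204, 36609255966753, 45952949422113],
  [80275526169606, 66640897286433], [27164124877447], [71032908775688], [10218267853447,
  47597960567061], [48591418166435, 57351161808035, 74434493842592, 48112517466262, 55265911818262,
  72102613125134], [39327047358738, 47573376702738], [72776774549794, 74373980492183,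
  74367657214112, 73274619857305, 74365692610562, 73983916154904], [], [72778905256355,
  72815546630430, 72811182919681, 73442114242572], [], [], [], [53019530766726, 73991684530589,
  57263618918431, 66287066357762], [48625793157127, 73991558670748, 55842149896345, 57263618918432],
  [66149259724806, 62966807560349], [62245392618246], [3340086032649, 45947899052195,
  36604332410915], [13310686429447, 66286557143041, 55850698414116], [], [30834152997126,
  75561396447362, 66801953218562], [72261401088009, 74442791848353, 66196596752673],
  [57422121536674, 66181849449634], [71590800468481, 71675657562242, 72261920040962],
  [72264041310753, 72649584378269, 72169279883551, 72174823248002, 71620940113920],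
  [74324596531210], [27782594724488], [31478822482565, 66729431802269, 75493446230429,
  49206258769949, 57970273198109], [21727325913607, 46495507875880], [73738852485146,
  73223744651561, 73270800520343, 57327086127376, 72676136353961, 72755404967063, 57361454221456,
  66151901859855, 66119697991695], [35266189050246, 75364093372834, 58003995402268],
  [73927561478434, 57297993859230], [54716986949792, 55852728883211], [47560601149448,
  58014547747230, 58014681964830], [54506417326085, 57982335492511, 57982469710111],
  [74429980224040, 66182401073302, 74430877870102, 74443226941461], [48422421043213, 57250717409293,
  74288341370907, 74361764611200, 66084698999059, 66121332017299, 73326803404812, 73844338083852],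
  [74261195761949], [72618370216348, 74356700064033, 73824509399060], [74429948265613,
  48106086629801, 74432093658251, 39823384807721, 66188030252171, 66121317747852, 64047000144014,
  74333538568357, 74402140030092, 73360494151694, 66052983736357, 74429948265615], [72815947034914,
  72686731069469, 66287200542743], [73819961698594, 73274482692502, 66128185989136],
  [74362135783715, 48532202461480, 72686605240348], [72821381278115, 72821485701153,
  57434998149139], [73201689600030, 72821450250280, 66085357916184, 73914945669156, 39829702871078],
  [71585170759712, 39827421168022, 73378184663077, 56909567201295, 72815611543691, 48496946841617],
  [73775635384354, 48497215209636, 66083193782412], [73844322355228, 57289399111703, 48592073656336,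
  72780698388519], [73365306624029, 57280807342101, 66076674232339], [74325131151393,
  57292886937622, 39898253076519], [73775383726115, 48495453573145, 66149779015700, 47569256417294,
  39761620961319], [74333278740511, 57258568488984, 73225915729956], [52828578167047,
  66641526432035, 54753201651874], [63304232110083, 55289855907862, 46496044584982],
  [66155660298258, 73854673257601, 57327154202921, 72755004347542, 73786070275224, 66149754606756,
  48496702001321, 72239741996182, 73270816771224, 66186135473316, 74433966149797, 39696516034602,
  72239883093145, 72755421217945, 66155660298257], [73712976599077, 74365400616997, 73747202088997,
  74331175127077], [39666359900178, 48631936321933, 74434493842562, 48625523247381, 39767429466260,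
  72821481523236], [44547867029765], [], [], [74391435379225, 66147379347865, 66183477100825,
  74435149175077, 74432095486105, 66188819832997, 74434493859878], [66147245130263, 74391569596824,
  66185624060184, 56910880047375, 74429948526743, 48632221434255, 74434493859879]]
def P10 : List (List ℕ) := [[], [], [], [636124579696650, 627878250844170, 470682431621130,
  478928760473610], [], [], [], [1321635586609287], [], [], [], [1338898925035524,
  1332782874828800], [1315134567157765], [], [637481217380485, 769972259901445, 1340936740997124,
  1305958114732161, 1315263187066881], [1067351075279360, 1059139239858560, 1180650687176961,
  1313107621189761], [1043172957685760, 1057501294436481, 926068987566081], [779086558004490,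
  638385434297610, 1340566827868166], [], [1339908279507205], [], [362579213058567],
  [1183708432486410, 1067232047697921], [1331794416865280, 1329593213327363], [1339284809548169,
  1065710425118722], [1296058864177289, 1183743084135687, 1324063475732484, 1065711054264323],
  [1339452209959048, 1339967605543048, 1340996385413128, 1340480989829128], [], [1174876794884489],
  [], [], [], [1303832804462724], [], [], [928176022292485], [505928500858887], [1297664552522244,
  1306428433781124, 1338326978994566], [1038815588864002], [1038815848386563, 1021741355356161,
  873889362759681], [1068876323390729, 786441165639687], [1065703845810571, 1340926146479363,
  1305398292337288, 1209053320643841, 1171844161917448, 1341031112541441], [1306462798555531,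
  1192560268248322, 1157480986257931, 1332715654350082, 1043172956639371, 1341071889040642]]
def P11 : List (List ℕ) := [[], [], [], [], [], [], [], [], [18195934851483648], [], [], []]

set_option maxRecDepth 100000 in
theorem step1 : stepChk 1 1 G2 G1 P1 = true := by decide +kernel
set_option maxRecDepth 100000 in
theorem step2 : stepChk 2 2 G3 G2 P2 = true := by decide +kernel
set_option maxRecDepth 100000 in
theorem step3 : stepChk 3 4 G4 G3 P3 = true := by decide +kernel
set_option maxRecDepth 100000 in
theorem step4 : stepChk 4 6 G5 G4 P4 = true := by decide +kernel
set_option maxRecDepth 100000 in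
theorem step5 : stepChk 5 8 G6 G5 P5 = true := by decide +kernel
set_option maxRecDepth 100000 in
theorem step6 : stepChk 6 10 G7 G6 P6 = true := by decide +kernel
set_option maxRecDepth 100000 in
theorem step7 : stepChk 7 13 G8 G7 P7 = true := by decide +kernel
set_option maxRecDepth 100000 in
theorem step8 : stepChk 8 16 G9 G8 P8 = true := by decide +kernel
set_option maxRecDepth 100000 in
theorem step9 : stepChk 9 20 G10 G9 P9 = true := by decide +kernel
set_option maxRecDepth 100000 in
theorem step10 : stepChk 10 24 G11 G10 P10 = true := by decide +kernel
set_option maxRecDepth 100000 in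
theorem step11 : stepChk 11 30 G12 G11 P11 = true := by decide +kernel
end GRH


namespace GRH
section
open scoped Classical
variable {α K : Type}

theorem tb_eq (m n : ℕ) : tb m n = m.testBit n := by
  unfold tb
  rw [Nat.testBit_eq_decide_div_mod_eq]
  have : Nat.land (Nat.shiftRight m n) 1 = m / 2 ^ n % 2 := by
    have h1 : Nat.shiftRight m n = m / 2 ^ n := Nat.shiftRight_eq_div_pow m n
    rw [h1]
    exact Nat.and_one_is_mod _
  rw [this]
  cases h : Nat.beq (m / 2 ^ n % 2) 1
  · have := Nat.ne_of_beq_eq_false h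
    simp [this]
  · have := Nat.eq_of_beq_eq_true h
    simp [this]

@[simp] theorem force_eq {β : Type} (n : ℕ) (f : ℕ → β) : force n f = f n := by
  cases n <;> rfl

theorem tb_lor (m n i : ℕ) : tb (Nat.lor m n) i = (tb m i || tb n i) := by
  rw [tb_eq, tb_eq, tb_eq]; exact Nat.testBit_or m n i

theorem tb_bit (i j : ℕ) : tb (bit i) j = decide (i = j) := by
  rw [tb_eq]
  have : bit i = 2 ^ i := Nat.one_shiftLeft i
  rw [this, Nat.testBit_two_pow]

theorem tb_zero (i : ℕ) : tb 0 i = false := by rw [tb_eq]; simp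

theorem subm_sound {m S : ℕ} (h : subm m S = true) (i : ℕ) (hi : tb m i = true) : tb S i = true := by
  have h1 : S &&& m = m := Nat.eq_of_beq_eq_true h
  rw [tb_eq] at *
  rw [← h1, Nat.testBit_and] at hi
  simp only [Bool.and_eq_true] at hi
  exact hi.1

theorem dfs_sound (p : ℕ → Prop) (BS BT : ℕ → List ℕ) (n : ℕ)
    (hS : ∀ i < n, ∀ m ∈ BS i, ¬ ∀ x, tb m x = true → p x)
    (hT : ∀ i < n, ∀ m ∈ BT i, ¬ ∀ x, tb m x = true → ¬ p x) :
    ∀ len k S T d, k + len = n → (∀ x, tb S x = true ↔ x < k ∧ p x) →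
      (∀ x, tb T x = true ↔ x < k ∧ ¬ p x) → d = ((Finset.range k).filter p).card →
      ∃ S', (S', ((Finset.range n).filter p).card) ∈
        dfs ((List.range' k len).map fun i => (i, BS i, BT i)) S T d ∧
        ∀ x, tb S' x = true ↔ x < n ∧ p x := by
  intro len
  induction len with
  | zero =>
    intro k S T d hk h1 h2 h3
    obtain rfl : k = n := by omega
    exact ⟨S, by simp [dfs, h3], h1⟩
  | succ len ih =>
    intro k S T d hk h1 h2 h3
    rw [List.range'_succ, List.map_cons]
    simp only [dfs, force_eq, List.mem_append]
    by_cases hp : p k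
    · have h1' : ∀ x, tb (Nat.lor S (bit k)) x = true ↔ x < k + 1 ∧ p x := by
        intro x
        rw [tb_lor, tb_bit, Bool.or_eq_true, h1, decide_eq_true_eq]
        constructor
        · rintro (h | rfl)
          · exact ⟨by omega, h.2⟩
          · exact ⟨by omega, hp⟩
        · rintro ⟨h, h'⟩
          by_cases e : k = x
          · exact Or.inr e
          · exact Or.inl ⟨by omega, h'⟩
      have h2' : ∀ x, tb T x = true ↔ x < k + 1 ∧ ¬ p x := by
        intro x
        rw [h2]
        constructor
        · rintro ⟨h, h'⟩; exact ⟨by omega, h'⟩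
        · rintro ⟨h, h'⟩
          have : x ≠ k := by rintro rfl; exact h' hp
          exact ⟨by omega, h'⟩
      have hc : ((BS k).any fun m => subm m (Nat.lor S (bit k))) = false := by
        rw [Bool.eq_false_iff]
        intro h
        obtain ⟨m, hm, hs⟩ := List.any_eq_true.1 h
        exact hS k (by omega) m hm fun x hx => ((h1' x).1 (subm_sound hs x hx)).2
      rw [hc]
      obtain ⟨S', h4, h5⟩ := ih (k + 1) _ _ (d + 1) (by omega) h1' h2' (by
        rw [Finset.range_add_one, Finset.filter_insert, if_pos hp,
          Finset.card_insert_of_notMem (by simp), h3])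
      exact ⟨S', Or.inl h4, h5⟩
    · have h1' : ∀ x, tb (Nat.lor T (bit k)) x = true ↔ x < k + 1 ∧ ¬ p x := by
        intro x
        rw [tb_lor, tb_bit, Bool.or_eq_true, h2, decide_eq_true_eq]
        constructor
        · rintro (h | rfl)
          · exact ⟨by omega, h.2⟩
          · exact ⟨by omega, hp⟩
        · rintro ⟨h, h'⟩
          by_cases e : k = x
          · exact Or.inr e
          · exact Or.inl ⟨by omega, h'⟩
      have h2' : ∀ x, tb S x = true ↔ x < k + 1 ∧ p x := by
        intro x
        rw [h1]
        constructor
        · rintro ⟨h, h'⟩; exact ⟨by omega, h'⟩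
        · rintro ⟨h, h'⟩
          have : x ≠ k := by rintro rfl; exact hp h'
          exact ⟨by omega, h'⟩
      have hc : ((BT k).any fun m => subm m (Nat.lor T (bit k))) = false := by
        rw [Bool.eq_false_iff]
        intro h
        obtain ⟨m, hm, hs⟩ := List.any_eq_true.1 h
        exact hT k (by omega) m hm fun x hx => ((h1' x).1 (subm_sound hs x hx)).2
      rw [hc]
      obtain ⟨S', h4, h5⟩ := ih (k + 1) _ _ d (by omega) h2' h1' (by
        rw [Finset.range_add_one, Finset.filter_insert, if_neg hp, h3])
      exact ⟨S', Or.inr h4, h5⟩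

/-- `f` realizes the graph `g` on `n` vertices by the edges of color `a`. -/
def Emb (c : α → α → K) (a : K) (n : ℕ) (g : List ℕ) (f : ℕ → α) : Prop :=
  ∀ i < n, ∀ j < i, f i ≠ f j ∧ (Ed c a (f i) (f j) ↔ tb (g.getD i 0) j = true)

theorem Emb.ne {c : α → α → K} {a : K} {n : ℕ} {g : List ℕ} {f : ℕ → α} (h : Emb c a n g f)
    {i j : ℕ} (hi : i < n) (hj : j < n) (n : i ≠ j) : f i ≠ f j := by
  rcases Nat.lt_or_gt_of_ne n with h1 | h1
  · exact (h j hj i h1).1.symm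
  · exact (h i hi j h1).1

theorem Emb.rd {c : α → α → K} (hs : Sy c) {a : K} {n : ℕ} {g : List ℕ} {f : ℕ → α}
    (h : Emb c a n g f) {i j : ℕ} (hi : i < n) (hj : j < n) (ne : i ≠ j) :
    Ed c a (f i) (f j) ↔ rd g i j = true := by
  unfold GRH.rd
  rcases Nat.lt_or_gt_of_ne ne with h1 | h1
  · have e1 : Nat.blt j i = false := by
      rw [Bool.eq_false_iff, Ne, Nat.blt_eq]; omega
    have e2 : Nat.blt i j = true := by rw [Nat.blt_eq]; omega
    rw [e1, e2]
    simp only [cond_false, cond_true]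
    rw [← (h j hj i h1).2]
    exact ⟨fun e => e.symm hs, fun e => e.symm hs⟩
  · have e2 : Nat.blt j i = true := by rw [Nat.blt_eq]; omega
    rw [e2]
    simp only [cond_true]
    rw [← (h i hi j h1).2]

theorem rd_ne {g : List ℕ} {i j : ℕ} (h : rd g i j = true) : i ≠ j := by
  rintro rfl; simp [rd, Nat.blt] at h

theorem bl_ne {g : List ℕ} {i j : ℕ} (h : bl g i j = true) : i ≠ j := by
  rintro rfl; simp [bl, Nat.blt] at h

theorem bl_rd {g : List ℕ} {i j : ℕ} (h : bl g i j = true) : rd g i j = false := by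
  have := bl_ne h
  unfold bl at h
  unfold rd
  cases h1 : Nat.blt j i <;> cases h2 : Nat.blt i j <;> simp_all

theorem rd_bl {g : List ℕ} {i j : ℕ} (n : i ≠ j) (h : rd g i j = false) : bl g i j = true := by
  have h0 : Nat.blt j i = true ∨ Nat.blt i j = true := by
    rw [Nat.blt_eq, Nat.blt_eq]; omega
  unfold bl
  unfold rd at h
  cases h1 : Nat.blt j i <;> cases h2 : Nat.blt i j <;> simp_all

theorem Emb.red {c : α → α → K} (hs : Sy c) {a : K} {n : ℕ} {g : List ℕ} {f : ℕ → α}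
    (h : Emb c a n g f) {i j : ℕ} (hi : i < n) (hj : j < n) (e : GRH.rd g i j = true) :
    Ed c a (f i) (f j) := (h.rd hs hi hj (rd_ne e)).2 e

/-- Everything about a realized two-colored set. -/
structure RS (c : α → α → K) (a b : K) (n : ℕ) (g : List ℕ) (f : ℕ → α) (T : Finset α) : Prop where
  emb : Emb c a n g f
  mem : ∀ i < n, f i ∈ T
  two : Two c a b T

theorem RS.blue {c : α → α → K} (hs : Sy c) {a b : K} {n : ℕ} {g : List ℕ} {f : ℕ → α}
    {T : Finset α} (h : RS c a b n g f T) {i j : ℕ} (hi : i < n) (hj : j < n)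
    (e : bl g i j = true) : Ed c b (f i) (f j) := by
  apply h.two.ed (h.mem i hi) (h.mem j hj) (h.emb.ne hi hj (bl_ne e))
  rw [h.emb.rd hs hi hj (bl_ne e), bl_rd e]; simp

/-- blue obstructions -/
theorem bsT_sound {c : α → α → K} (hs : Sy c) {a b : K} {n : ℕ} {g : List ℕ} {f : ℕ → α}
    {T : Finset α} (h : RS c a b n g f T) (hb : NoH c b T) {v : α} (hv : v ∈ T) (hvf : ∀ i < n, v ≠ f i)
    (p : ℕ → Prop) (hp : ∀ i < n, ¬ p i → Ed c b v (f i)) :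
    ∀ i < n, ∀ m ∈ bsT n g i, ¬ ∀ x, tb m x = true → ¬ p x := by
  intro i hi m hm hx
  have B := fun {i j} hi hj e => h.blue (i := i) (j := j) hs hi hj e
  have M := h.mem
  simp only [bsT, List.mem_flatMap, List.mem_range] at hm
  obtain ⟨j, hj, k, hk, hm⟩ := hm
  have hj' : j < n := by omega
  have hk' : k < n := by omega
  have four : ∀ l < k, m = Nat.lor (Nat.lor (Nat.lor (bit i) (bit j)) (bit k)) (bit l) →
      ¬ p i ∧ ¬ p j ∧ ¬ p k ∧ ¬ p l := by
    rintro l hl rfl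
    refine ⟨hx i ?_, hx j ?_, hx k ?_, hx l ?_⟩ <;> (simp only [tb_lor, tb_bit]; simp)
  have H : ∀ x < n, ∀ y < n, ∀ q < n, ∀ r < n, x ≠ y → ¬ p x → ¬ p y → ¬ p q → ¬ p r →
      bl g x q = true → bl g x r = true → bl g y q = true → bl g y r = true → bl g q r = true →
      False := by
    intro x hx y hy q hq r hr n1 p1 p2 p3 p4 e1 e2 e3 e4 e5
    exact hb (f x) (M x hx) (f y) (M y hy) v hv (f q) (M q hq) (f r) (M r hr) (h.emb.ne hx hy n1)
      (hp q hq p3) (hp r hr p4) (B hq hr e5) ((hp x hx p1).symm hs) (B hx hq e1) (B hx hr e2)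
      ((hp y hy p2).symm hs) (B hy hq e3) (B hy hr e4)
  have sy : ∀ x y, bl g x y = bl g y x := by
    intro x y
    unfold bl
    rcases lt_trichotomy x y with h | h | h
    · have e1 : Nat.blt y x = false := by rw [Bool.eq_false_iff, Ne, Nat.blt_eq]; omega
      have e2 : Nat.blt x y = true := by rw [Nat.blt_eq]; omega
      rw [e1, e2]; rfl
    · rw [h]
    · have e1 : Nat.blt x y = false := by rw [Bool.eq_false_iff, Ne, Nat.blt_eq]; omega
      have e2 : Nat.blt y x = true := by rw [Nat.blt_eq]; omega
      rw [e1, e2]; rfl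
  cases h1 : (bl g i j && bl g i k && bl g j k)
  · rw [h1] at hm
    simp only [cond_false] at hm
    cases h2 : ((bl g i j && (bl g i k || bl g j k)) || (bl g i k && bl g j k))
    · rw [h2] at hm; simp at hm
    · rw [h2] at hm
      simp only [cond_true, List.mem_flatMap, List.mem_range] at hm
      obtain ⟨l, hl, hm⟩ := hm
      cases h3 : (bl g i l && bl g j l && bl g k l)
      · rw [h3] at hm; simp at hm
      · rw [h3] at hm
        simp only [cond_true, List.mem_singleton] at hm
        obtain ⟨p1, p2, p3, p4⟩ := four l hl hm
        simp only [Bool.and_eq_true, Bool.or_eq_true] at h2 h3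
        have hl' : l < n := by omega
        obtain ⟨⟨q1, q2⟩, q3⟩ := h3
        rcases h2 with ⟨r1, r2 | r2⟩ | ⟨r1, r2⟩
        · -- ij, ik
          exact H j hj' k hk' i hi l hl' (by omega) p2 p3 p1 p4 (sy i j ▸ r1) q2 (sy i k ▸ r2) q3 q1
        · exact H i hi k hk' j hj' l hl' (by omega) p1 p3 p2 p4 r1 q1 (sy j k ▸ r2) q3 q2
        · exact H i hi j hj' k hk' l hl' (by omega) p1 p2 p3 p4 r1 q1 r2 q2 q3
  · rw [h1] at hm
    simp only [Bool.and_eq_true] at h1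
    obtain ⟨⟨q1, q2⟩, q3⟩ := h1
    simp only [cond_true] at hm
    cases h2 : ((List.range n).any fun l => bl g l i && bl g l j && bl g l k)
    · rw [h2] at hm
      simp only [cond_false, List.mem_flatMap, List.mem_range] at hm
      obtain ⟨l, hl, hm⟩ := hm
      have hl' : l < n := by omega
      cases h3 : ((bl g i l && (bl g j l || bl g k l)) || (bl g j l && bl g k l))
      · rw [h3] at hm; simp at hm
      · rw [h3] at hm
        simp only [cond_true, List.mem_singleton] at hm
        obtain ⟨p1, p2, p3, p4⟩ := four l hl hm
        simp only [Bool.and_eq_true, Bool.or_eq_true] at h3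
        rcases h3 with ⟨r1, r2 | r2⟩ | ⟨r1, r2⟩
        · exact H k hk' l hl' i hi j hj' (by omega) p3 p4 p1 p2 (sy i k ▸ q2) (sy j k ▸ q3)
            (sy i l ▸ r1) (sy j l ▸ r2) q1
        · exact H j hj' l hl' i hi k hk' (by omega) p2 p4 p1 p3 (sy i j ▸ q1) q3
            (sy i l ▸ r1) (sy k l ▸ r2) q2
        · exact H i hi l hl' j hj' k hk' (by omega) p1 p4 p2 p3 q1 q2
            (sy j l ▸ r1) (sy k l ▸ r2) q3
    · rw [h2] at hm
      simp only [cond_true, List.mem_singleton] at hm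
      subst hm
      obtain ⟨l, hl, h3⟩ := List.any_eq_true.1 h2
      simp only [List.mem_range, Bool.and_eq_true] at hl h3
      have p1 := hp i hi (hx i (by simp only [tb_lor, tb_bit]; simp))
      have p2 := hp j hj' (hx j (by simp only [tb_lor, tb_bit]; simp))
      have p3 := hp k hk' (hx k (by simp only [tb_lor, tb_bit]; simp))
      exact hb v hv (f l) (M l hl) (f i) (M i hi) (f j) (M j hj') (f k) (M k hk') (hvf l hl)
          (B hi hj' q1) (B hi hk' q2) (B hj' hk' q3) p1 p2 p3 (B hl hi h3.1.1) (B hl hj' h3.1.2)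
          (B hl hk' h3.2)

theorem bsS_sound {c : α → α → K} (hs : Sy c) {a b : K} {n : ℕ} {g : List ℕ} {f : ℕ → α}
    {T : Finset α} (h : RS c a b n g f T) (ha : NoD c a T) {v : α} (hv : v ∈ T)
    (hvf : ∀ i < n, v ≠ f i) (p : ℕ → Prop) (hp : ∀ i < n, p i → Ed c a v (f i)) :
    ∀ i < n, ∀ m ∈ bsS n g i, ¬ ∀ x, tb m x = true → p x := by
  intro i hi m hm hx
  have R := fun {i j} hi hj e => h.emb.red (i := i) (j := j) hs hi hj e
  have M := h.mem
  simp only [bsS, List.mem_flatMap, List.mem_range] at hm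
  obtain ⟨j, hj, hm⟩ := hm
  have hj' : j < n := by omega
  cases h1 : (rd g i j && (List.range n).any fun k => rd g i k && rd g j k)
  · rw [h1] at hm
    simp only [cond_false, List.mem_flatMap, List.mem_range] at hm
    obtain ⟨k, hk, hm⟩ := hm
    have hk' : k < n := by omega
    cases h2 : ((rd g i j && (rd g i k || rd g j k)) || (rd g i k && rd g j k))
    · rw [h2] at hm; simp at hm
    · rw [h2] at hm
      simp only [cond_true, List.mem_singleton] at hm
      subst hm
      have p1 := hp i hi (hx i (by simp only [tb_lor, tb_bit]; simp))
      have p2 := hp j hj' (hx j (by simp only [tb_lor, tb_bit]; simp))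
      have p3 := hp k hk' (hx k (by simp only [tb_lor, tb_bit]; simp))
      have H : ∀ x < n, ∀ y < n, ∀ q < n, x ≠ y → Ed c a v (f x) → Ed c a v (f y) →
          Ed c a v (f q) → Ed c a (f q) (f x) → Ed c a (f q) (f y) → False := by
        intro x hx y hy q hq n1 e1 e2 e3 e4 e5
        exact ha (f x) (M x hx) (f y) (M y hy) v hv (f q) (M q hq) (h.emb.ne hx hy n1) e3
          (e1.symm hs) (e4.symm hs) (e2.symm hs) (e5.symm hs)
      simp only [Bool.and_eq_true, Bool.or_eq_true] at h2
      rcases h2 with ⟨r1, r2 | r2⟩ | ⟨r1, r2⟩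
      · exact H j hj' k hk' i hi (by omega) p2 p3 p1 (R hi hj' r1) (R hi hk' r2)
      · exact H i hi k hk' j hj' (by omega) p1 p3 p2 ((R hi hj' r1).symm hs) (R hj' hk' r2)
      · exact H i hi j hj' k hk' (by omega) p1 p2 p3 ((R hi hk' r1).symm hs)
          ((R hj' hk' r2).symm hs)
  · rw [h1] at hm
    simp only [cond_true, List.mem_singleton] at hm
    subst hm
    have p1 := hp i hi (hx i (by simp only [tb_lor, tb_bit]; simp))
    have p2 := hp j hj' (hx j (by simp only [tb_lor, tb_bit]; simp))
    rw [Bool.and_eq_true, List.any_eq_true] at h1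
    obtain ⟨h1, k, hk, h3⟩ := h1
    simp only [List.mem_range, Bool.and_eq_true] at hk h3
    exact ha v hv (f k) (M k hk) (f i) (M i hi) (f j) (M j hj') (hvf k hk) (R hi hj' h1) p1 p2
      ((R hi hk h3.1).symm hs) ((R hj' hk h3.2).symm hs)

/-- If `w` and `y` are distinct, `w` is joined to all `f i` in color `a`, then the `a`-neighbours
of `y` contain no triangle. -/
theorem bsC_sound {c : α → α → K} (hs : Sy c) {a b : K} {n : ℕ} {g : List ℕ} {f : ℕ → α}
    {T : Finset α} (h : RS c a b n g f T) (ha : NoH c a T) {v w : α} (hv : v ∈ T) (hw : w ∈ T)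
    (hvw : v ≠ w) (hwf : ∀ i < n, Ed c a w (f i))
    (p : ℕ → Prop) (hp : ∀ i < n, p i → Ed c a v (f i)) :
    ∀ i < n, ∀ m ∈ bsC g i, ¬ ∀ x, tb m x = true → p x := by
  intro i hi m hm hx
  have R := fun {i j} hi hj e => h.emb.red (i := i) (j := j) hs hi hj e
  have M := h.mem
  simp only [bsC, List.mem_flatMap, List.mem_range] at hm
  obtain ⟨j, hj, hm⟩ := hm
  have hj' : j < n := by omega
  cases h1 : rd g i j
  · rw [h1] at hm; simp at hm
  · rw [h1] at hm
    simp only [cond_true, List.mem_flatMap, List.mem_range] at hm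
    obtain ⟨k, hk, hm⟩ := hm
    have hk' : k < n := by omega
    cases h2 : (rd g i k && rd g j k)
    · rw [h2] at hm; simp at hm
    · rw [h2] at hm
      simp only [cond_true, List.mem_singleton] at hm
      subst hm
      have p1 := hp i hi (hx i (by simp only [tb_lor, tb_bit]; simp))
      have p2 := hp j hj' (hx j (by simp only [tb_lor, tb_bit]; simp))
      have p3 := hp k hk' (hx k (by simp only [tb_lor, tb_bit]; simp))
      rw [Bool.and_eq_true] at h2
      exact ha v hv w hw (f i) (M i hi) (f j) (M j hj') (f k) (M k hk') hvw (R hi hj' h1)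
        (R hi hk' h2.1) (R hj' hk' h2.2) p1 p2 p3 (hwf i hi) (hwf j hj') (hwf k hk')

theorem isoChk_sound {c : α → α → K} (hs : Sy c) {a : K} {m n : ℕ} {g h : List ℕ} {p : ℕ}
    {f : ℕ → α} (hf : Emb c a m g f) (hc : isoChk m n g h p = true) :
    Emb c a n h (fun i => f (pm p i)) ∧ ∀ i < n, pm p i < m := by
  simp only [isoChk, force_eq, List.all_eq_true, List.mem_range, Bool.and_eq_true, Nat.blt_eq] at hc
  refine ⟨fun i hi j hj => ?_, fun i hi => (hc i hi).1⟩
  have h1 := (hc i hi).2 j hj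
  have h2 := (hc i hi).1
  have h3 := (hc j (by omega)).1
  have hne : pm p i ≠ pm p j := by
    intro e
    rw [e] at h1
    simp at h1
  refine ⟨hf.ne h2 h3 hne, ?_⟩
  rw [hf.rd hs h2 h3 hne]
  have := h1.2
  rw [beq_iff_eq] at this
  rw [this]

theorem hintChk_sound {m thr e : ℕ} {g : List ℕ} {N : List (ℕ × List ℕ)} {l : List (ℕ × ℕ)}
    {hs : List ℕ} (h : hintChk m thr e g N l hs = true) {S d : ℕ} (hm : (S, d) ∈ l)
    (h1 : d * (m + 1) ≤ 2 * (e + d)) (h2 : thr ≤ e + d) :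
    ∃ g' p, (e + d, g') ∈ N ∧ isoChk (m + 1) (m + 1) (g ++ [S]) g' p = true := by
  induction l generalizing hs with
  | nil => simp at hm
  | cons x r ih =>
    obtain ⟨S', d'⟩ := x
    unfold hintChk at h
    rcases List.mem_cons.1 hm with hm | hm
    · obtain ⟨rfl, rfl⟩ := Prod.mk.inj hm
      have : (Nat.ble (d * (m + 1)) (2 * (e + d)) && Nat.ble thr (e + d)) = true := by
        rw [Bool.and_eq_true, Nat.ble_eq, Nat.ble_eq]; exact ⟨h1, h2⟩
      rw [this] at h
      simp only [cond_true] at h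
      cases hs with
      | nil => simp at h
      | cons k hs =>
        simp only [Bool.and_eq_true] at h
        obtain ⟨h, _⟩ := h
        cases h3 : N[k % 128]? with
        | none => rw [h3] at h; simp at h
        | some y =>
          rw [h3] at h
          obtain ⟨e', g'⟩ := y
          simp only [Bool.and_eq_true] at h
          have he : e' = e + d := Nat.eq_of_beq_eq_true h.1
          exact ⟨g', _, he ▸ List.mem_of_getElem? h3, h.2⟩
    · cases h3 : (Nat.ble (d' * (m + 1)) (2 * (e + d')) && Nat.ble thr (e + d'))
      · rw [h3] at h
        exact ih h hm
      · rw [h3] at h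
        simp only [cond_true] at h
        cases hs with
        | nil => simp at h
        | cons k hs =>
          simp only [Bool.and_eq_true] at h
          exact ih h.2 hm

theorem stepChk_sound {m thr : ℕ} {N l : List (ℕ × List ℕ)} {hs : List (List ℕ)}
    (h : stepChk m thr N l hs = true) {e : ℕ} {g : List ℕ} (hm : (e, g) ∈ l) :
    ∃ hs', hintChk m thr e g N (dfs (lvS m g) 0 0 0) hs' = true := by
  induction l generalizing hs with
  | nil => simp at hm
  | cons x r ih =>
    obtain ⟨e', g'⟩ := x
    cases hs with
    | nil => simp [stepChk] at h
    | cons k hs =>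
      simp only [stepChk, Bool.and_eq_true] at h
      rcases List.mem_cons.1 hm with hm | hm
      · obtain ⟨rfl, rfl⟩ := Prod.mk.inj hm
        exact ⟨_, h.1⟩
      · exact ih h.2 hm

end
end GRH


namespace GRH
section
open scoped Classical
variable {α K : Type}

theorem Emb.image {c : α → α → K} {a : K} {n : ℕ} {g : List ℕ} {f : ℕ → α} (h : Emb c a n g f)
    {T : Finset α} (hm : ∀ i < n, f i ∈ T) (hc : T.card = n) : (Finset.range n).image f = T := by
  apply Finset.eq_of_subset_of_card_le
  · intro x hx
    obtain ⟨i, hi, rfl⟩ := Finset.mem_image.1 hx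
    exact hm i (Finset.mem_range.1 hi)
  · rw [Finset.card_image_of_injOn, Finset.card_range, hc]
    intro i hi j hj e
    by_contra hne
    exact h.ne (Finset.mem_range.1 hi) (Finset.mem_range.1 hj) hne e

theorem Emb.count {c : α → α → K} {a : K} {n : ℕ} {g : List ℕ} {f : ℕ → α} (h : Emb c a n g f)
    {T : Finset α} (hm : ∀ i < n, f i ∈ T) (hc : T.card = n) (v : α) :
    ((Finset.range n).filter (fun i => Ed c a v (f i))).card = (nb c a v T).card := by
  have h1 : nb c a v T = ((Finset.range n).filter (fun i => Ed c a v (f i))).image f := by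
    unfold nb
    rw [← h.image hm hc, Finset.filter_image]
  rw [h1, Finset.card_image_of_injOn]
  intro i hi j hj e
  have hi' := Finset.mem_range.1 (Finset.mem_filter.1 hi).1
  have hj' := Finset.mem_range.1 (Finset.mem_filter.1 hj).1
  by_contra hne
  exact h.ne hi' hj' hne e

theorem deg2_erase {c : α → α → K} (hs : Sy c) {a : K} {T : Finset α} {v : α} (hv : v ∈ T) :
    deg2 c a T = deg2 c a (T.erase v) + 2 * (nb c a v (T.erase v)).card := by
  have := deg2_insert hs (a := a) (T := T.erase v) (x := v) (by simp)
  rwa [Finset.insert_erase hv] at this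

theorem nb_erase {c : α → α → K} {a : K} {T : Finset α} {v : α} :
    nb c a v (T.erase v) = nb c a v T := by
  ext u
  simp only [mem_nb, Finset.mem_erase, Ed]
  grind

theorem exists_low {c : α → α → K} {a : K} {T : Finset α} (h : 0 < T.card) :
    ∃ v ∈ T, (nb c a v T).card * T.card ≤ deg2 c a T := by
  by_contra hcon
  push Not at hcon
  have hne : T.Nonempty := Finset.card_pos.1 h
  have := Finset.sum_lt_sum_of_nonempty hne hcon
  rw [Finset.sum_const, ← Finset.sum_mul] at this
  simp only [smul_eq_mul] at this
  unfold deg2 at this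
  rw [mul_comm] at this
  omega

/-- `N` contains all the graphs with `m` vertices and at least `thr` edges in the class. -/
def Cls (c : α → α → K) (a b : K) (m thr : ℕ) (N : List (ℕ × List ℕ)) : Prop :=
  ∀ T : Finset α, Two c a b T → NoD c a T → NoH c b T → T.card = m → 2 * thr ≤ deg2 c a T →
    ∃ e g f, (e, g) ∈ N ∧ Emb c a m g f ∧ (∀ i < m, f i ∈ T) ∧ deg2 c a T = 2 * e

theorem Emb.snoc {c : α → α → K} {a : K} {n : ℕ} {g : List ℕ} {f : ℕ → α}
    (h : Emb c a n g f) (hg : g.length = n) {v : α} (hv : ∀ i < n, v ≠ f i) {S : ℕ}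
    (hS : ∀ x, tb S x = true ↔ x < n ∧ Ed c a v (f x)) :
    Emb c a (n + 1) (g ++ [S]) (fun i => if i < n then f i else v) := by
  intro i hi j hj
  by_cases e : i < n
  · have e' : j < n := by omega
    simp only [e, e', if_true]
    have : (g ++ [S]).getD i 0 = g.getD i 0 := by
      rw [List.getD_append _ _ _ _ (by omega)]
    rw [this]
    exact h i e j hj
  · obtain rfl : i = n := by omega
    have : (g ++ [S]).getD i 0 = S := by
      rw [List.getD_append_right _ _ _ _ (by omega), hg]; simp
    simp only [hj, lt_irrefl, if_true, if_false]
    rw [this]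
    refine ⟨hv j hj, ?_⟩
    rw [hS]
    simp [hj]

theorem cls_step {c : α → α → K} (hs : Sy c) {a b : K} {m t t' : ℕ} {N N' : List (ℕ × List ℕ)}
    {H : List (List ℕ)} (hN : Cls c a b m t N) (hchk : stepChk m t' N' N H = true)
    (hlen : ∀ x ∈ N, x.2.length = m)
    (hthr : ∀ d e, t' ≤ e + d → d * (m + 1) ≤ 2 * (e + d) → t ≤ e) :
    Cls c a b (m + 1) t' N' := by
  intro T h2 ha hb hc hd
  obtain ⟨v, hv, hlow⟩ := exists_low (c := c) (a := a) (T := T) (by omega)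
  have hsub : T.erase v ⊆ T := Finset.erase_subset _ _
  have hd' := deg2_erase hs (a := a) hv
  obtain ⟨r, hr⟩ := deg2_even hs (a := a) (T.erase v)
  rw [← nb_erase, hc] at hlow
  set d := (nb c a v (T.erase v)).card with hdd
  have h3 : t ≤ r := by
    apply hthr d r
    · omega
    · refine hlow.trans ?_
      omega
  obtain ⟨e, g, f, hg, hf, hfm, he⟩ := hN (T.erase v) (h2.mono hsub) (ha.mono hsub) (hb.mono hsub)
    (by rw [Finset.card_erase_of_mem hv]; omega) (by omega)
  have hrs : RS c a b m g f T := ⟨hf, fun i hi => hsub (hfm i hi), h2⟩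
  have hvf : ∀ i < m, v ≠ f i := fun i hi => (Finset.ne_of_mem_erase (hfm i hi)).symm
  have hcard : (T.erase v).card = m := by rw [Finset.card_erase_of_mem hv]; omega
  have hcount := hf.count hfm hcard v
  obtain ⟨S, hS1, hS2⟩ := dfs_sound (fun i => Ed c a v (f i)) (bsS m g) (bsT m g) m
    (bsS_sound hs hrs ha hv hvf _ (fun i hi h => h))
    (bsT_sound hs hrs hb hv hvf _ (fun i hi h => h2.ed hv (hsub (hfm i hi)) (hvf i hi) h))
    m 0 0 0 0 (by omega) (by simp [tb_zero]) (by simp [tb_zero]) (by simp)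
  rw [hcount, ← List.range_eq_range'] at hS1
  obtain ⟨H', hH⟩ := stepChk_sound hchk hg
  obtain ⟨g', p, hg', hiso⟩ := hintChk_sound hH hS1 (by
    rw [← hdd]; refine hlow.trans ?_; omega) (by omega)
  have hemb := hf.snoc (hlen _ hg) hvf hS2
  obtain ⟨k1, k2⟩ := isoChk_sound hs hemb hiso
  refine ⟨_, g', _, hg', k1, ?_, by omega⟩
  intro i hi
  by_cases e : pm p i < m
  · simp only [e, if_true]; exact hsub (hfm _ e)
  · simp only [e, if_false]; exact hv

theorem cls1 {c : α → α → K} {a b : K} : Cls c a b 1 0 G1 := by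
  intro T h2 ha hb hc hd
  obtain ⟨v, rfl⟩ := Finset.card_eq_one.1 hc
  refine ⟨0, [0], fun _ => v, by simp [G1], ?_, by simp, ?_⟩
  · intro i hi j hj; omega
  · simp only [deg2, Finset.sum_singleton, mul_zero, Finset.card_eq_zero]
    rw [Finset.eq_empty_iff_forall_notMem]
    intro x hx
    rw [mem_nb, Finset.mem_singleton] at hx
    exact hx.2.1 hx.1.symm

theorem cls2 {c : α → α → K} (hs : Sy c) {a b : K} : Cls c a b 2 1 G2 :=
  cls_step hs cls1 step1 (by decide) (by intro d e; omega)
theorem cls3 {c : α → α → K} (hs : Sy c) {a b : K} : Cls c a b 3 2 G3 :=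
  cls_step hs (cls2 hs) step2 (by decide) (by intro d e; omega)
theorem cls4 {c : α → α → K} (hs : Sy c) {a b : K} : Cls c a b 4 4 G4 :=
  cls_step hs (cls3 hs) step3 (by decide) (by intro d e; omega)
theorem cls5 {c : α → α → K} (hs : Sy c) {a b : K} : Cls c a b 5 6 G5 :=
  cls_step hs (cls4 hs) step4 (by decide) (by intro d e; omega)
theorem cls6 {c : α → α → K} (hs : Sy c) {a b : K} : Cls c a b 6 8 G6 :=
  cls_step hs (cls5 hs) step5 (by decide) (by intro d e; omega)
theorem cls7 {c : α → α → K} (hs : Sy c) {a b : K} : Cls c a b 7 10 G7 :=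
  cls_step hs (cls6 hs) step6 (by decide) (by intro d e; omega)
theorem cls8 {c : α → α → K} (hs : Sy c) {a b : K} : Cls c a b 8 13 G8 :=
  cls_step hs (cls7 hs) step7 (by decide) (by intro d e; omega)
theorem cls9 {c : α → α → K} (hs : Sy c) {a b : K} : Cls c a b 9 16 G9 :=
  cls_step hs (cls8 hs) step8 (by decide +kernel) (by intro d e; omega)
theorem cls10 {c : α → α → K} (hs : Sy c) {a b : K} : Cls c a b 10 20 G10 :=
  cls_step hs (cls9 hs) step9 (by decide +kernel) (by intro d e; omega)
theorem cls11 {c : α → α → K} (hs : Sy c) {a b : K} : Cls c a b 11 24 G11 :=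
  cls_step hs (cls10 hs) step10 (by decide +kernel) (by intro d e; omega)
theorem cls12 {c : α → α → K} (hs : Sy c) {a b : K} : Cls c a b 12 30 G12 :=
  cls_step hs (cls11 hs) step11 (by decide +kernel) (by intro d e; omega)

/-- The number of edges is bounded by the maximum in the list. -/
theorem Cls.bound {c : α → α → K} {a b : K} {m t e : ℕ} {N : List (ℕ × List ℕ)}
    (h : Cls c a b m t N) (hN : ∀ x ∈ N, x.1 ≤ e) (hte : t ≤ e) {T : Finset α} (h2 : Two c a b T)
    (ha : NoD c a T) (hb : NoH c b T) (hc : T.card = m) : deg2 c a T ≤ 2 * e := by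
  by_contra hcon
  obtain ⟨e', g, f, hg, _, _, h4⟩ := h T h2 ha hb hc (by omega)
  have := hN _ hg
  simp only at this
  omega
end
end GRH


namespace GRH
section
open scoped Classical
variable {α K : Type}

/-- Goodman's identity. -/
theorem goodman {c : α → α → K} (hs : Sy c) {a b : K} (hab : a ≠ b) {T : Finset α}
    (h2 : Two c a b T) :
    ∑ v ∈ T, (deg2 c a (nb c a v T) + deg2 c b (nb c b v T)
      + 3 * ((nb c a v T).card * (nb c b v T).card)) = T.card * ((T.card - 1) * (T.card - 2)) := by
  set A : α → α → ℕ := fun x y => if Ed c a x y then 1 else 0 with hA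
  set B : α → α → ℕ := fun x y => if Ed c b x y then 1 else 0 with hB
  have As : ∀ x y, A x y = A y x := fun x y => by
    simp only [hA, show Ed c a x y ↔ Ed c a y x from ⟨fun h => h.symm hs, fun h => h.symm hs⟩]
  have Bs : ∀ x y, B x y = B y x := fun x y => by
    simp only [hB, show Ed c b x y ↔ Ed c b y x from ⟨fun h => h.symm hs, fun h => h.symm hs⟩]
  have AB : ∀ x ∈ T, ∀ y ∈ T, A x y + B x y = if x = y then 0 else 1 := by
    intro x hx y hy
    simp only [hA, hB]
    by_cases e : x = y
    · simp [e, Ed]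
    · rcases h2 x hx y hy e with h | h
      · simp [e, Ed, h, hab]
      · simp [e, Ed, h, hab.symm]
  have ABx : ∀ x y z, A x y * B x z = A x y * B x z * (if y = z then 0 else 1) := by
    intro x y z
    by_cases e : y = z
    · subst e
      by_cases h1 : Ed c a x y
      · by_cases h3 : Ed c b x y
        · exact absurd (h1.2.symm.trans h3.2) hab
        · simp [hB, h3]
      · simp [hA, h1]
    · simp [e]
  have cA : ∀ v, ∀ S : Finset α, (nb c a v S).card = ∑ y ∈ S, A v y := by
    intro v S; simp [nb, hA]
  have cB : ∀ v, ∀ S : Finset α, (nb c b v S).card = ∑ y ∈ S, B v y := by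
    intro v S; simp [nb, hB]
  have dA : ∀ v, deg2 c a (nb c a v T) = ∑ y ∈ T, ∑ z ∈ T, A v y * A v z * A y z := by
    intro v
    unfold deg2
    rw [nb, Finset.sum_filter]
    apply Finset.sum_congr rfl
    intro y _
    rw [cA, Finset.sum_filter]
    split_ifs with h
    · apply Finset.sum_congr rfl
      intro z _
      have : A v y = 1 := by simp [hA, h]
      rw [this]
      by_cases h' : Ed c a v z
      · simp [hA, h']
      · simp [hA, h']
    · have : A v y = 0 := by simp [hA, h]
      simp [this]
  have dB : ∀ v, deg2 c b (nb c b v T) = ∑ y ∈ T, ∑ z ∈ T, B v y * B v z * B y z := by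
    intro v
    unfold deg2
    rw [nb, Finset.sum_filter]
    apply Finset.sum_congr rfl
    intro y _
    rw [cB, Finset.sum_filter]
    split_ifs with h
    · apply Finset.sum_congr rfl
      intro z _
      have : B v y = 1 := by simp [hB, h]
      rw [this]
      by_cases h' : Ed c b v z
      · simp [hB, h']
      · simp [hB, h']
    · have : B v y = 0 := by simp [hB, h]
      simp [this]
  let Sm : (α → α → α → ℕ) → ℕ := fun F => ∑ x ∈ T, ∑ y ∈ T, ∑ z ∈ T, F x y z
  have Sadd : ∀ F G, Sm (fun x y z => F x y z + G x y z) = Sm F + Sm G := by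
    intro F G; simp only [Sm, Finset.sum_add_distrib]
  have Sc : ∀ F G : α → α → α → ℕ, (∀ x ∈ T, ∀ y ∈ T, ∀ z ∈ T, F x y z = G x y z) → Sm F = Sm G := by
    intro F G h
    exact Finset.sum_congr rfl fun x hx => Finset.sum_congr rfl fun y hy =>
      Finset.sum_congr rfl fun z hz => h x hx y hy z hz
  have S12 : ∀ F, Sm F = Sm (fun x y z => F y x z) := by
    intro F; exact Finset.sum_comm
  have S23 : ∀ F, Sm F = Sm (fun x y z => F x z y) := by
    intro F; exact Finset.sum_congr rfl fun x _ => Finset.sum_comm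
  have tot : Sm (fun x y z => (A x y + B x y) * (A x z + B x z) * (A y z + B y z))
      = T.card * ((T.card - 1) * (T.card - 2)) := by
    have : ∀ x ∈ T, ∑ y ∈ T, ∑ z ∈ T, (A x y + B x y) * (A x z + B x z) * (A y z + B y z)
        = (T.card - 1) * (T.card - 2) := by
      intro x hx
      have : ∀ y ∈ T, ∑ z ∈ T, (A x y + B x y) * (A x z + B x z) * (A y z + B y z)
          = if x = y then 0 else (T.card - 2) := by
        intro y hy
        have : ∀ z ∈ T, (A x y + B x y) * (A x z + B x z) * (A y z + B y z)
          = if x = y then 0 else if z ∈ (T.erase x).erase y then 1 else 0 := by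
          intro z hz
          rw [AB x hx y hy, AB x hx z hz, AB y hy z hz]
          simp only [Finset.mem_erase]
          grind
        rw [Finset.sum_congr rfl this]
        by_cases e : x = y
        · simp [e]
        · simp only [e, if_false]
          rw [Finset.sum_ite_mem, Finset.sum_const, Finset.inter_eq_right.2
            ((Finset.erase_subset _ _).trans (Finset.erase_subset _ _)),
            Finset.card_erase_of_mem (by simp [hy, Ne.symm e]), Finset.card_erase_of_mem hx]
          simp; omega
      rw [Finset.sum_congr rfl this, Finset.sum_ite, Finset.sum_const_zero, zero_add,
        Finset.sum_const]
      congr 1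
      have : T.filter (fun y => ¬ x = y) = T.erase x := by
        ext y; simp only [Finset.mem_filter, Finset.mem_erase]; grind
      rw [this, Finset.card_erase_of_mem hx]
    simp only [Sm]
    rw [Finset.sum_congr rfl this, Finset.sum_const, smul_eq_mul]
  have lhs : ∑ v ∈ T, (deg2 c a (nb c a v T) + deg2 c b (nb c b v T)
      + 3 * ((nb c a v T).card * (nb c b v T).card))
      = Sm (fun x y z => A x y * A x z * A y z) + Sm (fun x y z => B x y * B x z * B y z)
        + 3 * Sm (fun x y z => A x y * B x z) := by
    rw [Finset.sum_add_distrib, Finset.sum_add_distrib, ← Finset.mul_sum]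
    simp only [dA, dB, cA, cB, Finset.sum_mul_sum, Sm]
  have mix : Sm (fun x y z => A x y * B x z) = Sm (fun x y z => A x y * B x z * A y z)
      + Sm (fun x y z => A x y * B x z * B y z) := by
    rw [← Sadd]
    apply Sc
    intro x hx y hy z hz
    have h := ABx x y z
    rw [← AB y hy z hz] at h
    rw [mul_add] at h
    exact h
  -- the three arrangements
  have m1 : Sm (fun x y z => A x y * A x z * B y z) = Sm (fun x y z => A x y * B x z * A y z) := by
    rw [S12]; apply Sc; intro x _ y _ z _; simp only [As y x]; ring
  have m2 : Sm (fun x y z => B x y * A x z * A y z) = Sm (fun x y z => A x y * B x z * A y z) := by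
    rw [S23]; apply Sc; intro x _ y _ z _; simp only [As z y]; ring
  have m3 : Sm (fun x y z => B x y * A x z * B y z) = Sm (fun x y z => A x y * B x z * B y z) := by
    rw [S23]; apply Sc; intro x _ y _ z _; simp only [Bs z y]; ring
  have m4 : Sm (fun x y z => B x y * B x z * A y z) = Sm (fun x y z => A x y * B x z * B y z) := by
    rw [← m3, S12]; apply Sc; intro x _ y _ z _; simp only [Bs y x]; ring
  have ex : Sm (fun x y z => (A x y + B x y) * (A x z + B x z) * (A y z + B y z))
      = Sm (fun x y z => A x y * A x z * A y z) + Sm (fun x y z => B x y * B x z * B y z)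
        + Sm (fun x y z => A x y * A x z * B y z) + Sm (fun x y z => A x y * B x z * A y z)
        + Sm (fun x y z => B x y * A x z * A y z) + Sm (fun x y z => B x y * A x z * B y z)
        + Sm (fun x y z => B x y * B x z * A y z) + Sm (fun x y z => A x y * B x z * B y z) := by
    simp only [← Sadd]
    apply Sc; intro x _ y _ z _; ring
  rw [lhs, ← tot, ex, mix, m1, m2, m3, m4]
  ring
end
end GRH


namespace GRH
section
open scoped Classical
variable {α K : Type}

theorem NoD.noH {c : α → α → K} {a : K} {W : Finset α} (h : NoD c a W) : NoH c a W := by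
  intro x hx y hy p hp q hq r hr hne e1 e2 e3 e4 e5 e6 e7 e8 e9
  exact h x hx y hy p hp q hq hne e1 e4 e5 e7 e8

theorem card_P_P {c : α → α → K} {a b : K} {T : Finset α}
    (hs : Sy c) (h2 : Two c a b T) (ha : NoP c a T) (hb : NoP c b T) : T.card ≤ 2 := by
  by_contra hcon
  obtain ⟨x, hx, y, hy, z, hz, h1, h3, h4⟩ := exists3 (T := T) (by omega)
  have e1 := h2 x hx y hy h1
  have e2 := h2 x hx z hz h3
  have e3 := h2 y hy z hz h4
  have s1 := hs x y
  have s2 := hs x z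
  have s3 := hs y z
  have P : ∀ k, NoP c k T → ¬ (c x y = k ∧ c x z = k) ∧ ¬ (c x y = k ∧ c y z = k) ∧
      ¬ (c x z = k ∧ c y z = k) := by
    intro k hk
    refine ⟨fun h => hk x hx y hy z hz h4 ⟨h1, h.1⟩ ⟨h3, h.2⟩,
      fun h => hk y hy x hx z hz h3 ⟨h1.symm, by rw [← s1]; exact h.1⟩ ⟨h4, h.2⟩,
      fun h => hk z hz x hx y hy h1 ⟨h3.symm, by rw [← s2]; exact h.1⟩
        ⟨h4.symm, by rw [← s3]; exact h.2⟩⟩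
  have := P a ha
  have := P b hb
  tauto

theorem nb_noP_card {c : α → α → K} {a : K} {T : Finset α} {v : α} (hv : v ∈ T) (h : NoP c a T) :
    (nb c a v T).card ≤ 1 := by
  rw [Finset.card_le_one]
  intro x hx y hy
  by_contra hne
  exact h v hv x (mem_nb.1 hx).1 y (mem_nb.1 hy).1 hne (mem_nb.1 hx).2 (mem_nb.1 hy).2

theorem card_P_D {c : α → α → K} {a b : K} {T : Finset α} (hab : a ≠ b)
    (hs : Sy c) (h2 : Two c a b T) (ha : NoP c a T) (hb : NoD c b T) : T.card ≤ 4 := by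
  rcases T.eq_empty_or_nonempty with rfl | ⟨v, hv⟩
  · simp
  have := h2.card hab hv
  have := nb_noP_card hv ha
  have := card_P_P hs (h2.mono nb_subset) (ha.mono (nb_subset (c := c) (a := b) (v := v)))
    (nb_noP hs hv hb)
  omega

theorem card_P_H {c : α → α → K} {a b : K} {T : Finset α} (hab : a ≠ b)
    (hs : Sy c) (h2 : Two c a b T) (ha : NoP c a T) (hb : NoH c b T) : T.card ≤ 6 := by
  rcases T.eq_empty_or_nonempty with rfl | ⟨v, hv⟩
  · simp
  have := h2.card hab hv
  have := nb_noP_card hv ha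
  have := card_P_D hab hs (h2.mono nb_subset) (ha.mono (nb_subset (c := c) (a := b) (v := v)))
    (nb_noD hs hv hb)
  omega

theorem card_D_D {c : α → α → K} {a b : K} {T : Finset α} (hab : a ≠ b)
    (hs : Sy c) (h2 : Two c a b T) (ha : NoD c a T) (hb : NoD c b T) : T.card ≤ 9 := by
  rcases T.eq_empty_or_nonempty with rfl | ⟨v, hv⟩
  · simp
  have := h2.card hab hv
  have := card_P_D hab hs (h2.mono nb_subset) (nb_noP hs hv ha)
    (hb.mono (nb_subset (c := c) (a := a) (v := v)))
  have := card_P_D hab.symm hs (h2.mono nb_subset).swap (nb_noP hs hv hb)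
    (ha.mono (nb_subset (c := c) (a := b) (v := v)))
  omega

theorem deg2_noP {c : α → α → K} {a : K} {T : Finset α} (ha : NoP c a T) :
    deg2 c a T ≤ T.card := by
  unfold deg2
  calc ∑ v ∈ T, (nb c a v T).card ≤ ∑ v ∈ T, 1 := Finset.sum_le_sum fun v hv => nb_noP_card hv ha
    _ = T.card := by simp

theorem Emb.noBlueK4 {c : α → α → K} (hs : Sy c) {a b : K} {n : ℕ} {g : List ℕ} {f : ℕ → α}
    {T : Finset α} (h : Emb c a n g f) (hm : ∀ i < n, f i ∈ T) (h2 : Two c a b T) (hb : NoD c b T)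
    (w x y z : ℕ) (hw : w < n) (hx : x < n) (hy : y < n) (hz : z < n)
    (h1 : bl g w x = true) (h3 : bl g y z = true) (h4 : bl g w y = true) (h5 : bl g w z = true)
    (h6 : bl g x y = true) (h7 : bl g x z = true) : False := by
  have R : RS c a b n g f T := ⟨h, hm, h2⟩
  exact hb _ (hm w hw) _ (hm x hx) _ (hm y hy) _ (hm z hz) (R.blue hs hw hx h1).1
    (R.blue hs hy hz h3) (R.blue hs hw hy h4) (R.blue hs hw hz h5)
    (R.blue hs hx hy h6) (R.blue hs hx hz h7)

theorem deg2_7 {c : α → α → K} (hs : Sy c) {a b : K} {T : Finset α}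
    (h2 : Two c a b T) (ha : NoD c a T) (hb : NoD c b T) (hc : T.card = 7) :
    deg2 c a T ≤ 22 := by
  by_contra hcon
  obtain ⟨e, g, f, hg, hE, hm, hd⟩ := cls7 hs T h2 ha hb.noH hc (by omega)
  have : ∀ x ∈ G7, 12 ≤ x.1 → x = (12, [0, 0, 0, 0, 15, 15, 15]) := by decide
  have := this _ hg (by simp; omega)
  obtain ⟨rfl, rfl⟩ := Prod.mk.inj this
  exact hE.noBlueK4 hs hm h2 hb 0 1 2 3 (by omega) (by omega) (by omega) (by omega)
    rfl rfl rfl rfl rfl rfl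

theorem deg2_8 {c : α → α → K} (hs : Sy c) {a b : K} {T : Finset α}
    (h2 : Two c a b T) (ha : NoD c a T) (hb : NoD c b T) (hc : T.card = 8) :
    deg2 c a T ≤ 30 := by
  by_contra hcon
  obtain ⟨e, g, f, hg, hE, hm, hd⟩ := cls8 hs T h2 ha hb.noH hc (by omega)
  have : ∀ x ∈ G8, 16 ≤ x.1 → x = (16, [0, 1, 1, 1, 1, 30, 30, 30]) := by decide
  have := this _ hg (by simp; omega)
  obtain ⟨rfl, rfl⟩ := Prod.mk.inj this
  exact hE.noBlueK4 hs hm h2 hb 1 2 3 4 (by omega) (by omega) (by omega) (by omega)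
    rfl rfl rfl rfl rfl rfl

theorem no13 {c : α → α → K} (hs : Sy c) {a b : K} (hab : a ≠ b) {T : Finset α}
    (h2 : Two c a b T) (ha : NoD c a T) (hb : NoH c b T) : T.card ≠ 13 := by
  intro hc
  have key : ∀ v ∈ T, deg2 c a (nb c a v T) + deg2 c b (nb c b v T)
      + 3 * ((nb c a v T).card * (nb c b v T).card) ≤ 132 ∧
      ((nb c a v T).card ≠ 6 → deg2 c a (nb c a v T) + deg2 c b (nb c b v T)
      + 3 * ((nb c a v T).card * (nb c b v T).card) < 132) := by
    intro v hv
    have h0 := h2.card hab hv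
    have hA2 : Two c a b (nb c a v T) := h2.mono nb_subset
    have hB2 : Two c b a (nb c b v T) := (h2.mono nb_subset).swap
    have hAP := nb_noP hs hv ha
    have hBD := nb_noD hs hv hb
    have hAb : NoH c b (nb c a v T) := hb.mono nb_subset
    have hBa : NoD c a (nb c b v T) := ha.mono nb_subset
    have h6 := card_P_H hab hs hA2 hAP hAb
    have h9 := card_D_D hab.symm hs hB2 hBD hBa
    have hA := deg2_noP hAP
    have hev := deg2_even hs (a := a) (nb c a v T)
    obtain ⟨q, hq⟩ := hev
    have d7 := deg2_7 hs hB2 hBD hBa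
    have d8 := deg2_8 hs hB2 hBD hBa
    have d6 := (cls6 hs (a := b) (b := a)).bound (e := 9) (by decide) (by norm_num) hB2 hBD hBa.noH
    have d9 := (cls9 hs (a := b) (b := a)).bound (e := 18) (by decide) (by norm_num) hB2 hBD hBa.noH
    generalize (nb c a v T).card = x at *
    generalize (nb c b v T).card = y at *
    obtain rfl : y = 12 - x := by omega
    have : x = 3 ∨ x = 4 ∨ x = 5 ∨ x = 6 := by omega
    rcases this with rfl | rfl | rfl | rfl <;> norm_num at * <;> omega
  have G := goodman hs hab h2
  rw [hc] at G
  have all6 : ∀ v ∈ T, (nb c a v T).card = 6 := by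
    intro v hv
    by_contra hne
    have := Finset.sum_lt_sum (fun v hv => (key v hv).1) ⟨v, hv, (key v hv).2 hne⟩
    rw [G, Finset.sum_const, hc] at this
    norm_num at this
  have d : deg2 c a T = 78 := by
    unfold deg2; rw [Finset.sum_congr rfl all6, Finset.sum_const, hc]; norm_num
  obtain ⟨v, hv⟩ := Finset.card_pos.1 (by omega : 0 < T.card)
  have := deg2_erase hs (a := a) hv
  rw [nb_erase, all6 v hv] at this
  have := (cls12 hs (a := a) (b := b)).bound (e := 30) (by decide) (by norm_num)
    (h2.mono (Finset.erase_subset v T)) (ha.mono (Finset.erase_subset v T))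
    (hb.mono (Finset.erase_subset v T)) (by rw [Finset.card_erase_of_mem hv, hc])
  omega

theorem card_D_H {c : α → α → K} (hs : Sy c) {a b : K} (hab : a ≠ b) {T : Finset α}
    (h2 : Two c a b T) (ha : NoD c a T) (hb : NoH c b T) : T.card ≤ 12 := by
  by_contra hcon
  obtain ⟨U, hU, hc⟩ := Finset.exists_subset_card_eq (by omega : 13 ≤ T.card)
  exact no13 hs hab (h2.mono hU) (ha.mono hU) (hb.mono hU) hc
end
end GRH


namespace GRH

/-- Evaluate a list of numbers before passing it on. -/
def forceL {β : Type} : List ℕ → (List ℕ → β) → β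
  | [], f => f []
  | x :: r, f => force x fun x' => forceL r fun r' => f (x' :: r')

def forceP {β : Type} : List (ℕ × ℕ) → (List (ℕ × ℕ) → β) → β
  | [], f => f []
  | (x, y) :: r, f => force x fun x' => force y fun y' => forceP r fun r' => f ((x', y') :: r')

/-- The set of the indices `k` such that the `k`-th mask satisfies `t`. -/
def colv (t : ℕ → Bool) : List ℕ → ℕ
  | [] => 0
  | S :: r => Nat.lor (Nat.shiftLeft (colv t r) 1) (cond (t S) 1 0)

def msk (i j k : ℕ) : ℕ := Nat.lor (Nat.lor (bit i) (bit j)) (bit k)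

def vc (cs : List ℕ) (i j k : ℕ) : ℕ :=
  Nat.land (Nat.land (cs.getD i 0) (cs.getD j 0)) (cs.getD k 0)

def p3r (rel : ℕ → ℕ → Bool) (m : ℕ) (cs : List ℕ) : List (ℕ × ℕ) :=
  (List.range m).flatMap fun i => (List.range m).flatMap fun j => cond (rel i j)
    ((List.range j).flatMap fun k => cond (rel i k) [(msk i j k, vc cs i j k)] []) []

def trr (rel : ℕ → ℕ → Bool) (m : ℕ) (f : ℕ → ℕ → ℕ → List (ℕ × ℕ)) : List (ℕ × ℕ) :=
  (List.range m).flatMap fun i => (List.range i).flatMap fun j => cond (rel i j)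
    ((List.range j).flatMap fun k => cond (rel i k && rel j k) (f i j k) []) []

def tr1 (cs : List ℕ) (i j k : ℕ) : List (ℕ × ℕ) := [(msk i j k, vc cs i j k)]

def tr2 (cs : List ℕ) (i j k : ℕ) : List (ℕ × ℕ) :=
  [(msk i j j, vc cs i j k), (msk i k k, vc cs i j k), (msk j k k, vc cs i j k),
    (msk i j k, vc cs i j j), (msk i j k, vc cs i k k), (msk i j k, vc cs j k k)]

def viol (t : ℕ → Bool) (l : List (ℕ × ℕ)) : ℕ → ℕ :=
  List.rec (motive := fun _ => ℕ → ℕ) (fun acc => acc)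
    (fun mv _ ih acc => cond (t mv.1) (force (Nat.lor acc mv.2) fun acc' => ih acc') (ih acc)) l

def tbl (N full : ℕ) : List ℕ → ℕ
  | [] => 0
  | r :: rs => Nat.lor (Nat.shiftLeft (tbl N full rs) N) (Nat.land r full)

def row (N full t k : ℕ) : ℕ := Nat.land (Nat.shiftRight t (N * k)) full

def upd (i br bb : ℕ) (l : List (ℕ × ℕ)) : (List (ℕ × ℕ) → Bool) → Bool :=
  List.rec (motive := fun _ => (List (ℕ × ℕ) → Bool) → Bool) (fun k => k [])
    (fun pd _ ih k =>
      force (Nat.xor pd.2 (Nat.land pd.2 (cond (tb pd.1 i) bb br))) fun d' =>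
      cond (Nat.beq d' 0) true (ih fun l => k ((pd.1, d') :: l))) l

/-- Exhaustive search; `true` means that there is no solution. -/
def srch (N full tR tB : ℕ) (F : ℕ) : ℕ → ℕ → List (ℕ × ℕ) → Bool :=
  Nat.rec (motive := fun _ => ℕ → ℕ → List (ℕ × ℕ) → Bool) (fun _ _ _ => false)
    (fun _ ih i dom rest => cond (Nat.beq dom 0) true
    (force (Nat.log2 dom) fun k =>
      cond (force (row N full tR k) fun br => force (row N full tB k) fun bb =>
      (upd i br bb rest fun l => List.casesOn (motive := fun _ => Bool) l false
        (fun pd r => force (i + 1) fun i' => ih i' pd.2 r)))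
        (force (Nat.xor dom (bit k)) fun dom' => ih i dom' rest) false)) F

def srchP (N full tR tB : ℕ) : List ℕ → Bool
  | [] => false
  | _ :: r => srch N full tR tB 1500 0 full (r.map fun p => (p, full))

def embChk (m : ℕ) (pats : List (List ℕ)) : List (List ℕ) → List ℕ → Bool
  | [], _ => true
  | _ :: _, [] => false
  | y :: r, h :: hs => (match pats[h % 8]? with
      | none => false
      | some P => isoChk m P.length y P (h / 8)) && embChk m pats r hs

def glueChk (m : ℕ) (g : List ℕ) (pats : List (List ℕ)) : Bool :=
  forceL ((dfs (lvC m g) 0 0 0).map Prod.fst) fun L =>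
  force L.length fun N => force (Nat.pow 2 N - 1) fun full =>
  forceL ((List.range m).map fun x => colv (fun S => tb S x) L) fun cp =>
  forceL ((List.range m).map fun x => colv (fun S => !tb S x) L) fun cn =>
  forceP (p3r (rd g) m cp) fun r1 =>
  forceP (trr (bl g) m (tr1 cn)) fun r2 =>
  forceP (p3r (bl g) m cn ++ trr (bl g) m (tr2 cn)) fun r3 =>
  force (tbl N full (L.map fun S => viol (fun m => Nat.beq (Nat.land S m) 0) r2 (viol (fun m => Nat.beq (Nat.land S m) m) r1 0))) fun tR =>
  force (tbl N full (L.map fun S => viol (fun m => Nat.beq (Nat.land S m) 0) r3 0)) fun tB =>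
  pats.all fun P => srchP N full tR tB P

def PA11_0 : List (List ℕ) := [[0, 0, 0, 2, 1, 28, 7], [0, 0, 0, 2, 1, 28, 39]]
def HA11_0 : List ℕ := [482028041, 582060944, 722061568, 596232449, 961063296, 1150878216]
theorem glue11_0 : glueChk 11 (G11.getD 0 (0, [])).2 PA11_0 = true := by decide +kernel
theorem emb11_0 : embChk 10 PA11_0 ((G10.filter fun x => Nat.ble 21 x.1).map Prod.snd) HA11_0 = true := by
  decide +kernel
def PA11_1 : List (List ℕ) := [[0, 1, 0, 4, 6, 9, 58, 69], [0, 1, 0, 6, 5, 25, 26, 38]]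
def HA11_1 : List ℕ := [986460313, 1127914000, 18433153536, 5302432257, 9868163336, 1110132920]
theorem glue11_1 : glueChk 11 (G11.getD 1 (0, [])).2 PA11_1 = true := by decide +kernel
theorem emb11_1 : embChk 10 PA11_1 ((G10.filter fun x => Nat.ble 21 x.1).map Prod.snd) HA11_1 = true := by
  decide +kernel
def PA11_2 : List (List ℕ) := [[0, 0, 0, 5, 6, 7]]
def HA11_2 : List ℕ := [4991240, 2754960, 35172608, 35174656, 68397184, 63701256]
theorem glue11_2 : glueChk 11 (G11.getD 2 (0, [])).2 PA11_2 = true := by decide +kernel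
theorem emb11_2 : embChk 10 PA11_2 ((G10.filter fun x => Nat.ble 21 x.1).map Prod.snd) HA11_2 = true := by
  decide +kernel
def PA11_3 : List (List ℕ) := [[0, 1, 1, 2, 4, 25]]
def HA11_3 : List ℕ := [46928000, 11147520, 43229312, 11774464, 37525768, 78726016]
theorem glue11_3 : glueChk 11 (G11.getD 3 (0, [])).2 PA11_3 = true := by decide +kernel
theorem emb11_3 : embChk 10 PA11_3 ((G10.filter fun x => Nat.ble 21 x.1).map Prod.snd) HA11_3 = true := by
  decide +kernel
def PA11_4 : List (List ℕ) := [[0, 1, 0, 1, 14, 12]]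
def HA11_4 : List ℕ := [51389320, 25700880, 20060288, 28479616, 19172224, 50613128]
theorem glue11_4 : glueChk 11 (G11.getD 4 (0, [])).2 PA11_4 = true := by decide +kernel
theorem emb11_4 : embChk 10 PA11_4 ((G10.filter fun x => Nat.ble 21 x.1).map Prod.snd) HA11_4 = true := by
  decide +kernel
def PA11_5 : List (List ℕ) := [[0, 0, 1, 2, 12, 19]]
def HA11_5 : List ℕ := [2933000, 696720, 36800768, 37325056, 69810304, 59031816]
theorem glue11_5 : glueChk 11 (G11.getD 5 (0, [])).2 PA11_5 = true := by decide +kernel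
theorem emb11_5 : embChk 10 PA11_5 ((G10.filter fun x => Nat.ble 21 x.1).map Prod.snd) HA11_5 = true := by
  decide +kernel
def PA11_6 : List (List ℕ) := [[0, 0, 0, 6]]
def HA11_6 : List ℕ := [309632, 248320, 110848, 112896, 75904, 168064]
theorem glue11_6 : glueChk 11 (G11.getD 6 (0, [])).2 PA11_6 = true := by decide +kernel
theorem emb11_6 : embChk 10 PA11_6 ((G10.filter fun x => Nat.ble 21 x.1).map Prod.snd) HA11_6 = true := by
  decide +kernel
def PA11_7 : List (List ℕ) := [[0, 0, 2, 4, 11, 13]]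
def HA11_7 : List ℕ := [51126656, 25999872, 38056320, 44347648, 63086720, 79894656]
theorem glue11_7 : glueChk 11 (G11.getD 7 (0, [])).2 PA11_7 = true := by decide +kernel
theorem emb11_7 : embChk 10 PA11_7 ((G10.filter fun x => Nat.ble 21 x.1).map Prod.snd) HA11_7 = true := by
  decide +kernel
def PA11_8 : List (List ℕ) := [[0, 1, 0, 4, 15, 10, 9], [0, 1, 0, 4, 10, 5, 9], [0, 1, 0, 4, 9,
  10, 52], [0, 1, 0, 6, 5, 9, 50]]
def HA11_8 : List ℕ := [550214416, 46777232, 592157712, 54149769, 872552712, 1125894274,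
  588499072, 45761680, 873646466, 580075648, 689651843, 566963088, 423865096, 79897480, 591139200,
  423768968, 1124735633, 46775056, 46775056, 566470912, 331557376, 877300624, 12334224, 449088000,
  439599760, 413445120, 1118943745, 734105728, 62177800, 181092608, 70564232, 155372056, 61653384,
  172736768, 172736768, 181125376, 306916248, 441094912, 540318736, 472693000, 28097040,
  591692168, 672969608]
theorem glue11_8 : glueChk 11 (G11.getD 8 (0, [])).2 PA11_8 = true := by decide +kernel
theorem emb11_8 : embChk 10 PA11_8 ((G10.filter fun x => Nat.ble 20 x.1).map Prod.snd) HA11_8 = true := by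
  decide +kernel
def PA11_9 : List (List ℕ) := [[0, 0, 0, 1, 10]]
def HA11_9 : List ℕ := [2308480, 3781120, 3183744, 3324160, 3451264, 1876096]
theorem glue11_9 : glueChk 11 (G11.getD 9 (0, [])).2 PA11_9 = true := by decide +kernel
theorem emb11_9 : embChk 10 PA11_9 ((G10.filter fun x => Nat.ble 21 x.1).map Prod.snd) HA11_9 = true := by
  decide +kernel
def PA11_10 : List (List ℕ) := [[0, 1, 0, 5, 14, 7]]
def HA11_10 : List ℕ := [71936904, 79837968, 70404224, 70928512, 78357504, 63607176]
theorem glue11_10 : glueChk 11 (G11.getD 10 (0, [])).2 PA11_10 = true := by decide +kernel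
theorem emb11_10 : embChk 10 PA11_10 ((G10.filter fun x => Nat.ble 21 x.1).map Prod.snd) HA11_10 = true := by
  decide +kernel
def PA11_11 : List (List ℕ) := [[0, 1, 1, 2, 12]]
def HA11_11 : List ℕ := [2330752, 3838080, 4395136, 3842176, 3872896, 3872896, 3874944, 4399232,
  4890752, 4954240, 4397184, 3283200, 4399360, 2199680, 4399488, 2208384, 4888832, 3807488,
  3313792, 3776768, 3776768, 1786112, 3326208, 2695552, 2695552, 2695552, 4956288, 1253504,
  2756736, 2756736, 2199680, 2199680, 2199680, 2297984, 2199680, 2199680, 3776768, 2273664,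
  2182144, 4987144, 1722624, 672640, 2704256]
theorem glue11_11 : glueChk 11 (G11.getD 11 (0, [])).2 PA11_11 = true := by decide +kernel
theorem emb11_11 : embChk 10 PA11_11 ((G10.filter fun x => Nat.ble 20 x.1).map Prod.snd) HA11_11 = true := by
  decide +kernel
def PA12_0 : List (List ℕ) := [[0, 0, 2, 3, 13]]
def HA12_0 : List ℕ := [1096320, 2208384, 2208384, 1098368]
theorem glue12_0 : glueChk 12 (G12.getD 0 (0, [])).2 PA12_0 = true := by decide +kernel
theorem emb12_0 : embChk 9 PA12_0 ((G9.filter fun x => Nat.ble 18 x.1).map Prod.snd) HA12_0 = true := by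
  decide +kernel
end GRH


namespace GRH
section
open scoped Classical
variable {α K : Type}

theorem forceL_eq {β : Type} (l : List ℕ) (f : List ℕ → β) : forceL l f = f l := by
  induction l generalizing f with
  | nil => rfl
  | cons x r ih => simp [forceL, ih]

theorem forceP_eq {β : Type} (l : List (ℕ × ℕ)) (f : List (ℕ × ℕ) → β) : forceP l f = f l := by
  induction l generalizing f with
  | nil => rfl
  | cons x r ih => obtain ⟨x, y⟩ := x; simp [forceP, ih]

theorem tb_land (m n i : ℕ) : tb (Nat.land m n) i = (tb m i && tb n i) := by
  rw [tb_eq, tb_eq, tb_eq]; exact Nat.testBit_and m n i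

theorem tb_xor (m n i : ℕ) : tb (Nat.xor m n) i = (tb m i ^^ tb n i) := by
  rw [tb_eq, tb_eq, tb_eq]; exact Nat.testBit_xor m n i

theorem tb_shl (m n i : ℕ) : tb (Nat.shiftLeft m n) i = (decide (n ≤ i) && tb m (i - n)) := by
  rw [tb_eq, tb_eq]; exact Nat.testBit_shiftLeft m

theorem tb_shr (m n i : ℕ) : tb (Nat.shiftRight m n) i = tb m (n + i) := by
  rw [tb_eq, tb_eq]; exact Nat.testBit_shiftRight m

theorem tb_full (N i : ℕ) : tb (Nat.pow 2 N - 1) i = decide (i < N) := by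
  rw [tb_eq]; exact Nat.testBit_two_pow_sub_one N i

theorem colv_sound (t : ℕ → Bool) (L : List ℕ) (k S : ℕ) (h : L[k]? = some S)
    (hb : tb (colv t L) k = true) : t S = true := by
  induction L generalizing k with
  | nil => simp at h
  | cons x r ih =>
    rw [colv, tb_lor, tb_shl] at hb
    rcases k with _ | k
    · simp only [List.getElem?_cons_zero, Option.some.injEq] at h
      subst h
      cases ht : t x
      · simp [ht, tb_zero] at hb
      · rfl
    · simp only [List.getElem?_cons_succ] at h
      apply ih k h
      have h1 : tb (cond (t x) 1 0) (k + 1) = false := by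
        cases t x
        · exact tb_zero _
        · rw [tb_eq, cond_true, Nat.testBit_succ]; simp
      rw [h1] at hb
      simpa using hb

theorem viol_sound (t : ℕ → Bool) (l : List (ℕ × ℕ)) (acc k : ℕ)
    (h : tb (viol t l acc) k = true) :
    tb acc k = true ∨ ∃ m v, (m, v) ∈ l ∧ t m = true ∧ tb v k = true := by
  induction l generalizing acc with
  | nil => exact Or.inl h
  | cons x r ih =>
    change tb (cond (t x.1) (force (Nat.lor acc x.2) fun acc' => viol t r acc') (viol t r acc)) k
      = true at h
    rw [force_eq] at h
    cases ht : t x.1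
    · rw [ht] at h
      rcases ih _ h with h | ⟨m, v, h1, h2⟩
      · exact Or.inl h
      · exact Or.inr ⟨m, v, List.mem_cons_of_mem _ h1, h2⟩
    · rw [ht] at h
      rcases ih _ h with h | ⟨m, v, h1, h2⟩
      · rw [tb_lor, Bool.or_eq_true] at h
        rcases h with h | h
        · exact Or.inl h
        · exact Or.inr ⟨x.1, x.2, List.mem_cons_self, ht, h⟩
      · exact Or.inr ⟨m, v, List.mem_cons_of_mem _ h1, h2⟩

theorem tbl_sound (N : ℕ) (L : List ℕ) (k j : ℕ) (hj : j < N)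
    (h : tb (tbl N (Nat.pow 2 N - 1) L) (N * k + j) = true) :
    ∃ r, L[k]? = some r ∧ tb r j = true := by
  induction L generalizing k with
  | nil => simp [tbl, tb_zero] at h
  | cons x r ih =>
    rw [tbl, tb_lor, tb_shl, tb_land, tb_full] at h
    rcases k with _ | k
    · have : ¬ N ≤ j := by omega
      simp [this, hj] at h
      exact ⟨x, rfl, h⟩
    · have e : N * (k + 1) + j - N = N * k + j := by rw [Nat.mul_succ]; omega
      have : ¬ (N * (k + 1) + j < N) := by rw [Nat.mul_succ]; omega
      rw [e] at h
      simp [this] at h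
      exact ih k h.2

theorem row_sound (N : ℕ) (L : List ℕ) (k j : ℕ)
    (h : tb (row N (Nat.pow 2 N - 1) (tbl N (Nat.pow 2 N - 1) L) k) j = true) :
    ∃ r, L[k]? = some r ∧ tb r j = true := by
  rw [row, tb_land, tb_shr, tb_full, Bool.and_eq_true, decide_eq_true_eq] at h
  exact tbl_sound N L k j h.2 h.1

theorem upd_cons (i br bb : ℕ) (pd : ℕ × ℕ) (r : List (ℕ × ℕ)) (k : List (ℕ × ℕ) → Bool) :
    upd i br bb (pd :: r) k = force (Nat.xor pd.2 (Nat.land pd.2 (cond (tb pd.1 i) bb br)))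
      fun d' => cond (Nat.beq d' 0) true (upd i br bb r fun l => k ((pd.1, d') :: l)) := rfl

/-- The new domain of a later vertex. -/
def nd (i br bb : ℕ) (pd : ℕ × ℕ) : ℕ × ℕ :=
  (pd.1, Nat.xor pd.2 (Nat.land pd.2 (cond (tb pd.1 i) bb br)))

theorem upd_sound (i br bb : ℕ) (l : List (ℕ × ℕ)) (k : List (ℕ × ℕ) → Bool)
    (h : ∀ x ∈ l, (nd i br bb x).2 ≠ 0) : upd i br bb l k = k (l.map (nd i br bb)) := by
  induction l generalizing k with
  | nil => rfl
  | cons x r ih =>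
    rw [upd_cons, force_eq]
    have h0 := h x List.mem_cons_self
    have : Nat.beq (Nat.xor x.2 (Nat.land x.2 (cond (tb x.1 i) bb br))) 0 = false := by
      rw [Bool.eq_false_iff]
      intro hh
      exact h0 (Nat.eq_of_beq_eq_true hh)
    rw [this, cond_false, ih _ (fun y hy => h y (List.mem_cons_of_mem _ hy))]
    rfl

theorem srch_sound (N full tR tB : ℕ) (κ : ℕ → ℕ) : ∀ (F i d : ℕ) (rest : List (ℕ × ℕ)),
    tb d (κ i) = true → (∀ t p e, rest[t]? = some (p, e) → tb e (κ (i + 1 + t)) = true ∧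
      ∀ i' ≤ i + t, tb (row N full (cond (tb p i') tB tR) (κ i')) (κ (i + 1 + t)) = false) →
    srch N full tR tB F i d rest = false := by
  intro F
  induction F with
  | zero => intros; rfl
  | succ F ih =>
    intro i d rest hd hr
    have hd0 : Nat.beq d 0 = false := by
      rw [Bool.eq_false_iff]
      intro hh
      rw [Nat.eq_of_beq_eq_true hh, tb_zero] at hd
      exact absurd hd (by simp)
    change cond (Nat.beq d 0) true
      (force (Nat.log2 d) fun k =>
      cond (force (row N full tR k) fun br => force (row N full tB k) fun bb =>
      (upd i br bb rest fun l => List.casesOn (motive := fun _ => Bool) l false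
        (fun pd r => force (i + 1) fun i' => srch N full tR tB F i' pd.2 r)))
        (force (Nat.xor d (bit k)) fun dom' => srch N full tR tB F i dom' rest) false) = false
    rw [hd0]
    simp only [force_eq, cond_false]
    by_cases hk : κ i = Nat.log2 d
    · rw [← hk]
      have key : ∀ t p e, rest[t]? = some (p, e) → 
          tb (nd i (row N full tR (κ i)) (row N full tB (κ i)) (p, e)).2 (κ (i + 1 + t)) = true := by
        intro t p e ht
        obtain ⟨h1, h2⟩ := hr t p e ht
        have h3 := h2 i (by omega)
        simp only [nd, tb_xor, tb_land, h1]
        cases hp : tb p i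
        · rw [hp] at h3; simp only [cond_false] at h3 ⊢; rw [h3]; rfl
        · rw [hp] at h3; simp only [cond_true] at h3 ⊢; rw [h3]; rfl
      rw [upd_sound]
      · rcases rest with _ | ⟨⟨p0, e0⟩, r⟩
        · rfl
        · simp only [List.map_cons]
          rw [ih]
          · rfl
          · have := key 0 p0 e0 rfl
            simpa using this
          · intro t p e ht
            rw [List.getElem?_map] at ht
            obtain ⟨⟨p', e'⟩, h1, h2⟩ := Option.map_eq_some_iff.1 ht
            have hp : p' = p := congrArg Prod.fst h2
            have he := congrArg Prod.snd h2
            subst hp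
            simp only at he
            subst he
            have e1 : i + 1 + 1 + t = i + 1 + (t + 1) := by omega
            rw [e1]
            refine ⟨key (t + 1) p' e' h1, fun i' hi' => (hr (t + 1) p' e' h1).2 i' (by omega)⟩
      · intro x hx
        obtain ⟨t, ht, rfl⟩ := List.getElem_of_mem hx
        have : tb (nd i (row N full tR (κ i)) (row N full tB (κ i)) rest[t]).2 (κ (i + 1 + t)) = true :=
          key t _ _ (List.getElem?_eq_getElem ht)
        intro h0
        rw [h0, tb_zero] at this
        exact absurd this (by simp)
    · rw [ih i _ rest _ hr]
      · cases (upd i _ _ rest _) <;> rfl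
      · rw [tb_xor, hd, tb_bit]
        simp [Ne.symm hk]

theorem srchP_sound (N tR tB : ℕ) (P : List ℕ) (κ : ℕ → ℕ) (hκ : ∀ i < P.length, κ i < N)
    (hc : ∀ j < P.length, ∀ i < j, 
      tb (row N (Nat.pow 2 N - 1) (cond (tb (P.getD j 0) i) tB tR) (κ i)) (κ j) = false) :
    srchP N (Nat.pow 2 N - 1) tR tB P = false := by
  rcases P with _ | ⟨x, r⟩
  · rfl
  · unfold srchP
    apply srch_sound N _ tR tB κ
    · rw [tb_full]; simp [hκ 0 (by simp)]
    · intro t p e ht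
      rw [List.getElem?_map] at ht
      obtain ⟨p', h1, h2⟩ := Option.map_eq_some_iff.1 ht
      have hp : p' = p := congrArg Prod.fst h2
      have he := congrArg Prod.snd h2
      simp only at he
      subst hp he
      have hl := (List.getElem?_eq_some_iff.1 h1).1
      have hl' : 0 + 1 + t < (x :: r).length := by simp; omega
      refine ⟨?_, fun i' hi' => ?_⟩
      · rw [tb_full]; simp only [decide_eq_true_eq]; exact hκ _ hl'
      · have := hc (0 + 1 + t) hl' i' (by omega)
        have e1 : (x :: r).getD (0 + 1 + t) 0 = p' := by
          rw [show 0 + 1 + t = t + 1 by omega, List.getD_cons_succ, List.getD_eq_getElem?_getD, h1]; rfl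
        rwa [e1] at this

theorem k5_p3 {c : α → α → K} (hs : Sy c) {k : K} {T : Finset α} (h : NoH c k T)
    {y z p q r : α} (hy : y ∈ T) (hz : z ∈ T) (hp : p ∈ T) (hq : q ∈ T) (hr : r ∈ T) (n : q ≠ r)
    (e : Ed c k y z) (e1 : Ed c k p q) (e2 : Ed c k p r) (y1 : Ed c k y p) (y2 : Ed c k y q)
    (y3 : Ed c k y r) (z1 : Ed c k z p) (z2 : Ed c k z q) (z3 : Ed c k z r) : False :=
  h q hq r hr y hy z hz p hp n e y1 z1 (y2.symm hs) (z2.symm hs) (e1.symm hs)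
    (y3.symm hs) (z3.symm hs) (e2.symm hs)

theorem k5_tri {c : α → α → K} {k : K} {T : Finset α} (h : NoH c k T)
    {y z p q r : α} (hy : y ∈ T) (hz : z ∈ T) (hp : p ∈ T) (hq : q ∈ T) (hr : r ∈ T) (n : y ≠ z)
    (e1 : Ed c k p q) (e2 : Ed c k p r) (e3 : Ed c k q r) (y1 : Ed c k y p) (y2 : Ed c k y q)
    (y3 : Ed c k y r) (z1 : Ed c k z p) (z2 : Ed c k z q) (z3 : Ed c k z r) : False :=
  h y hy z hz p hp q hq r hr n e1 e2 e3 y1 y2 y3 z1 z2 z3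

/-- `y z`, `p q r` a triangle, `z` joined to all, `y` joined to `p q`. -/
theorem k5_tri2 {c : α → α → K} (hs : Sy c) {k : K} {T : Finset α} (h : NoH c k T)
    {y z p q r : α} (hy : y ∈ T) (hz : z ∈ T) (hp : p ∈ T) (hq : q ∈ T) (hr : r ∈ T) (n : y ≠ r)
    (e : Ed c k y z)
    (e1 : Ed c k p q) (e2 : Ed c k p r) (e3 : Ed c k q r) (y1 : Ed c k y p) (y2 : Ed c k y q)
    (z1 : Ed c k z p) (z2 : Ed c k z q) (z3 : Ed c k z r) : False :=
  h y hy r hr z hz p hp q hq n z1 z2 e1 e y1 y2 (z3.symm hs) (e2.symm hs) (e3.symm hs)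

theorem msk_sub {i j k S : ℕ} (h : Nat.beq (Nat.land S (msk i j k)) (msk i j k) = true) :
    tb S i = true ∧ tb S j = true ∧ tb S k = true := by
  have h' : subm (msk i j k) S = true := h
  refine ⟨subm_sound h' i ?_, subm_sound h' j ?_, subm_sound h' k ?_⟩ <;>
    (simp only [msk, tb_lor, tb_bit]; simp)

theorem msk_disj {i j k S : ℕ} (h : Nat.beq (Nat.land S (msk i j k)) 0 = true) :
    tb S i = false ∧ tb S j = false ∧ tb S k = false := by
  have h' := Nat.eq_of_beq_eq_true h
  have : ∀ x, tb (msk i j k) x = true → tb S x = false := by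
    intro x hx
    have := congrArg (fun n => tb n x) h'
    simp only [tb_land, hx, tb_zero, Bool.and_true] at this
    exact this
  refine ⟨this i ?_, this j ?_, this k ?_⟩ <;> (simp only [msk, tb_lor, tb_bit]; simp)

theorem vc_sound {m : ℕ} {L : List ℕ} {t : ℕ → ℕ → Bool} {i j k κ S : ℕ} (hi : i < m) (hj : j < m)
    (hk : k < m) (hS : L[κ]? = some S)
    (h : tb (vc ((List.range m).map fun x => colv (t x) L) i j k) κ = true) :
    t i S = true ∧ t j S = true ∧ t k S = true := by
  have e : ∀ x < m, ((List.range m).map fun x => colv (t x) L).getD x 0 = colv (t x) L := by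
    intro x hx
    rw [List.getD_eq_getElem?_getD, List.getElem?_map, List.getElem?_range hx]; rfl
  simp only [vc, tb_land, Bool.and_eq_true, e i hi, e j hj, e k hk] at h
  exact ⟨colv_sound _ L κ S hS h.1.1, colv_sound _ L κ S hS h.1.2, colv_sound _ L κ S hS h.2⟩

theorem mem_p3r {rel : ℕ → ℕ → Bool} {m : ℕ} {cs : List ℕ} {u v : ℕ} (h : (u, v) ∈ p3r rel m cs) :
    ∃ i < m, ∃ j < m, ∃ k < m, j ≠ k ∧ rel i j = true ∧ rel i k = true ∧ u = msk i j k ∧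
      v = vc cs i j k := by
  simp only [p3r, List.mem_flatMap, List.mem_range] at h
  obtain ⟨i, hi, j, hj, h⟩ := h
  cases h1 : rel i j
  · rw [h1] at h; simp at h
  rw [h1] at h
  simp only [cond_true, List.mem_flatMap, List.mem_range] at h
  obtain ⟨k, hk, h⟩ := h
  cases h2 : rel i k
  · rw [h2] at h; simp at h
  rw [h2] at h
  simp only [cond_true, List.mem_singleton, Prod.mk.injEq] at h
  exact ⟨i, hi, j, hj, k, by omega, by omega, h1, h2, h.1, h.2⟩

theorem mem_trr {rel : ℕ → ℕ → Bool} {m : ℕ} {f : ℕ → ℕ → ℕ → List (ℕ × ℕ)} {x : ℕ × ℕ}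
    (h : x ∈ trr rel m f) :
    ∃ i < m, ∃ j < m, ∃ k < m, rel i j = true ∧ rel i k = true ∧ rel j k = true ∧ x ∈ f i j k := by
  simp only [trr, List.mem_flatMap, List.mem_range] at h
  obtain ⟨i, hi, j, hj, h⟩ := h
  cases h1 : rel i j
  · rw [h1] at h; simp at h
  rw [h1] at h
  simp only [cond_true, List.mem_flatMap, List.mem_range] at h
  obtain ⟨k, hk, h⟩ := h
  cases h2 : (rel i k && rel j k)
  · rw [h2] at h; simp at h
  rw [h2] at h
  rw [Bool.and_eq_true] at h2
  exact ⟨i, hi, j, by omega, k, by omega, h1, h2.1, h2.2, h⟩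

/-- A pattern excluded by the search does not occur. -/
theorem glue_sound {c : α → α → K} (hs : Sy c) {a b : K} (hab : a ≠ b) {T : Finset α}
    (h2 : Two c a b T) (ha : NoH c a T) (hb : NoH c b T) {v : α} (hv : v ∈ T)
    {m : ℕ} {g : List ℕ} {f : ℕ → α} (hf : Emb c a m g f) (hfm : ∀ i < m, f i ∈ nb c a v T)
    {pats : List (List ℕ)} (hchk : glueChk m g pats = true) {P : List ℕ} (hP : P ∈ pats)
    {y : ℕ → α} (hy : Emb c b P.length P y) (hym : ∀ i < P.length, y i ∈ nb c b v T) : False := by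
  have fT : ∀ i < m, f i ∈ T := fun i hi => (mem_nb.1 (hfm i hi)).1
  have yT : ∀ i < P.length, y i ∈ T := fun i hi => (mem_nb.1 (hym i hi)).1
  have hrs : RS c a b m g f T := ⟨hf, fT, h2⟩
  have yf : ∀ i < P.length, ∀ x < m, y i ≠ f x := by
    intro i hi x hx e
    have h1 := (mem_nb.1 (hym i hi)).2
    have h3 := (mem_nb.1 (hfm x hx)).2
    rw [e] at h1
    exact hab (h3.2.symm.trans h1.2)
  -- the cones
  set L := (dfs (lvC m g) 0 0 0).map Prod.fst with hL
  have cone : ∀ i, ∃ (k : ℕ) (S : ℕ), i < P.length → (L[k]? = some S ∧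
      (∀ x < m, tb S x = true → Ed c a (y i) (f x)) ∧
      (∀ x < m, tb S x = false → Ed c b (y i) (f x))) := by
    intro i
    by_cases hi : i < P.length
    · obtain ⟨S, hS1, hS2⟩ := dfs_sound (fun x => Ed c a (y i) (f x)) (bsC g) (bsT m g) m
        (bsC_sound hs hrs ha (yT i hi) hv (mem_nb.1 (hym i hi)).2.1.symm
          (fun x hx => (mem_nb.1 (hfm x hx)).2) _ (fun i hi h => h))
        (bsT_sound hs hrs hb (yT i hi) (yf i hi) _
          (fun x hx h => h2.ed (yT i hi) (fT x hx) (yf i hi x hx) h))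
        m 0 0 0 0 (by omega) (by simp [tb_zero]) (by simp [tb_zero]) (by simp)
      rw [← List.range_eq_range'] at hS1
      have : S ∈ L := List.mem_map.2 ⟨_, hS1, rfl⟩
      obtain ⟨k, hk⟩ := List.mem_iff_getElem?.1 this
      refine ⟨k, S, fun _ => ⟨hk, fun x hx h => ((hS2 x).1 h).2, fun x hx h => ?_⟩⟩
      apply h2.ed (yT i hi) (fT x hx) (yf i hi x hx)
      intro h'
      rw [(hS2 x).2 ⟨hx, h'⟩] at h
      exact absurd h (by simp)
    · exact ⟨0, 0, fun h => absurd h hi⟩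
  choose κ S hκ using cone
  unfold glueChk at hchk
  simp only [forceL_eq, forceP_eq, force_eq, ← hL] at hchk
  rw [List.all_eq_true] at hchk
  have h0 := hchk P hP
  rw [srchP_sound _ _ _ P κ] at h0
  · exact absurd h0 (by simp)
  · intro i hi
    exact (List.getElem?_eq_some_iff.1 (hκ i hi).1).1
  · intro j hj i hij
    have hi : i < P.length := by omega
    obtain ⟨k1, k2, k3⟩ := hκ i hi
    obtain ⟨l1, l2, l3⟩ := hκ j hj
    have hne : y i ≠ y j := (hy j hj i hij).1.symm
    have hedge := (hy j hj i hij).2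
    rw [Bool.eq_false_iff]
    intro hbad
    have Bl := fun {i j} hi hj e => hrs.blue (i := i) (j := j) hs hi hj e
    have Rd := fun {i j} hi hj e => hf.red (i := i) (j := j) hs hi hj e
    cases hcol : tb (P.getD j 0) i
    · have e : Ed c a (y i) (y j) := by
        apply h2.swap.ed (yT i hi) (yT j hj) hne
        intro h
        rw [hedge.1 (h.symm hs)] at hcol
        exact absurd hcol (by simp)
      rw [hcol, cond_false] at hbad
      obtain ⟨r, hr1, hr2⟩ := row_sound _ _ _ _ hbad
      rw [List.getElem?_map, k1] at hr1
      simp only [Option.map_some, Option.some.injEq] at hr1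
      subst hr1
      rcases viol_sound _ _ _ _ hr2 with hr2 | ⟨u, w, hm, ht, hw⟩
      · rcases viol_sound _ _ _ _ hr2 with hr2 | ⟨u, w, hm, ht, hw⟩
        · rw [tb_zero] at hr2; exact absurd hr2 (by simp)
        · obtain ⟨p, hp, q, hq, r, hr, n, e1, e2, rfl, rfl⟩ := mem_p3r hm
          obtain ⟨s1, s2, s3⟩ := msk_sub ht
          obtain ⟨t1, t2, t3⟩ := vc_sound (t := fun x S => tb S x) hp hq hr l1 hw
          exact k5_p3 hs ha (yT i hi) (yT j hj) (fT p hp) (fT q hq) (fT r hr) (hf.ne hq hr n) e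
            (Rd hp hq e1) (Rd hp hr e2) (k2 p hp s1) (k2 q hq s2) (k2 r hr s3)
            (l2 p hp t1) (l2 q hq t2) (l2 r hr t3)
      · obtain ⟨p, hp, q, hq, r, hr, e1, e2, e3, hx⟩ := mem_trr hm
        simp only [tr1, List.mem_singleton, Prod.mk.injEq] at hx
        obtain ⟨rfl, rfl⟩ := hx
        obtain ⟨s1, s2, s3⟩ := msk_disj ht
        obtain ⟨t1, t2, t3⟩ := vc_sound (t := fun x S => !tb S x) hp hq hr l1 hw
        simp only [Bool.not_eq_true'] at t1 t2 t3
        exact k5_tri hb (yT i hi) (yT j hj) (fT p hp) (fT q hq) (fT r hr) hne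
            (Bl hp hq e1) (Bl hp hr e2) (Bl hq hr e3) (k3 p hp s1) (k3 q hq s2) (k3 r hr s3)
            (l3 p hp t1) (l3 q hq t2) (l3 r hr t3)
    · have e : Ed c b (y i) (y j) := (hedge.2 hcol).symm hs
      rw [hcol, cond_true] at hbad
      obtain ⟨r, hr1, hr2⟩ := row_sound _ _ _ _ hbad
      rw [List.getElem?_map, k1] at hr1
      simp only [Option.map_some, Option.some.injEq] at hr1
      subst hr1
      rcases viol_sound _ _ _ _ hr2 with hr2 | ⟨u, w, hm, ht, hw⟩
      · rw [tb_zero] at hr2; exact absurd hr2 (by simp)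
      rcases List.mem_append.1 hm with hm | hm
      · obtain ⟨p, hp, q, hq, r, hr, n, e1, e2, rfl, rfl⟩ := mem_p3r hm
        obtain ⟨s1, s2, s3⟩ := msk_disj ht
        obtain ⟨t1, t2, t3⟩ := vc_sound (t := fun x S => !tb S x) hp hq hr l1 hw
        simp only [Bool.not_eq_true'] at t1 t2 t3
        exact k5_p3 hs hb (yT i hi) (yT j hj) (fT p hp) (fT q hq) (fT r hr) (hf.ne hq hr n) e
            (Bl hp hq e1) (Bl hp hr e2) (k3 p hp s1) (k3 q hq s2) (k3 r hr s3)
            (l3 p hp t1) (l3 q hq t2) (l3 r hr t3)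
      · obtain ⟨p, hp, q, hq, r, hr, e1, e2, e3, hx⟩ := mem_trr hm
        have E1 := Bl hp hq e1
        have E2 := Bl hp hr e2
        have E3 := Bl hq hr e3
        simp only [tr2, List.mem_cons, Prod.mk.injEq, List.not_mem_nil, or_false] at hx
        rcases hx with ⟨rfl, rfl⟩ | ⟨rfl, rfl⟩ | ⟨rfl, rfl⟩ | ⟨rfl, rfl⟩ | ⟨rfl, rfl⟩ | ⟨rfl, rfl⟩
        · obtain ⟨s1, s2, s3⟩ := msk_disj ht
          obtain ⟨t1, t2, t3⟩ := vc_sound (t := fun x S => !tb S x) hp hq hr l1 hw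
          simp only [Bool.not_eq_true'] at t1 t2 t3
          exact k5_tri2 hs hb (yT i hi) (yT j hj) (fT p hp) (fT q hq) (fT r hr) (yf i hi r hr) e
            E1 E2 E3 (k3 p hp s1) (k3 q hq s2) (l3 p hp t1) (l3 q hq t2) (l3 r hr t3)
        · obtain ⟨s1, s2, s3⟩ := msk_disj ht
          obtain ⟨t1, t2, t3⟩ := vc_sound (t := fun x S => !tb S x) hp hq hr l1 hw
          simp only [Bool.not_eq_true'] at t1 t2 t3
          exact k5_tri2 hs hb (yT i hi) (yT j hj) (fT p hp) (fT r hr) (fT q hq) (yf i hi q hq) e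
            E2 E1 (E3.symm hs) (k3 p hp s1) (k3 r hr s2) (l3 p hp t1) (l3 r hr t3) (l3 q hq t2)
        · obtain ⟨s1, s2, s3⟩ := msk_disj ht
          obtain ⟨t1, t2, t3⟩ := vc_sound (t := fun x S => !tb S x) hp hq hr l1 hw
          simp only [Bool.not_eq_true'] at t1 t2 t3
          exact k5_tri2 hs hb (yT i hi) (yT j hj) (fT q hq) (fT r hr) (fT p hp) (yf i hi p hp) e
            E3 (E1.symm hs) (E2.symm hs) (k3 q hq s1) (k3 r hr s2) (l3 q hq t2) (l3 r hr t3) (l3 p hp t1)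
        · obtain ⟨s1, s2, s3⟩ := msk_disj ht
          obtain ⟨t1, t2, t3⟩ := vc_sound (t := fun x S => !tb S x) hp hq hq l1 hw
          simp only [Bool.not_eq_true'] at t1 t2 t3
          exact k5_tri2 hs hb (yT j hj) (yT i hi) (fT p hp) (fT q hq) (fT r hr) (yf j hj r hr) (e.symm hs)
            E1 E2 E3 (l3 p hp t1) (l3 q hq t2) (k3 p hp s1) (k3 q hq s2) (k3 r hr s3)
        · obtain ⟨s1, s2, s3⟩ := msk_disj ht
          obtain ⟨t1, t2, t3⟩ := vc_sound (t := fun x S => !tb S x) hp hr hr l1 hw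
          simp only [Bool.not_eq_true'] at t1 t2 t3
          exact k5_tri2 hs hb (yT j hj) (yT i hi) (fT p hp) (fT r hr) (fT q hq) (yf j hj q hq) (e.symm hs)
            E2 E1 (E3.symm hs) (l3 p hp t1) (l3 r hr t2) (k3 p hp s1) (k3 r hr s3) (k3 q hq s2)
        · obtain ⟨s1, s2, s3⟩ := msk_disj ht
          obtain ⟨t1, t2, t3⟩ := vc_sound (t := fun x S => !tb S x) hq hr hr l1 hw
          simp only [Bool.not_eq_true'] at t1 t2 t3
          exact k5_tri2 hs hb (yT j hj) (yT i hi) (fT q hq) (fT r hr) (fT p hp) (yf j hj p hp) (e.symm hs)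
            E3 (E1.symm hs) (E2.symm hs) (l3 q hq t1) (l3 r hr t2) (k3 q hq s2) (k3 r hr s3) (k3 p hp s1)

theorem embChk_sound {m : ℕ} {pats : List (List ℕ)} : ∀ {Ys : List (List ℕ)} {H : List ℕ},
    embChk m pats Ys H = true → ∀ g ∈ Ys, ∃ P ∈ pats, ∃ p, isoChk m P.length g P p = true := by
  intro Ys
  induction Ys with
  | nil => intro H _ g hg; simp at hg
  | cons x r ih =>
    intro H h g hg
    rcases H with _ | ⟨h0, H⟩
    · simp [embChk] at h
    rw [embChk, Bool.and_eq_true] at h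
    rcases List.mem_cons.1 hg with rfl | hg
    · have h1 := h.1
      split at h1
      · simp at h1
      · next P hP => exact ⟨P, List.mem_of_getElem? hP, _, h1⟩
    · exact ih h.2 g hg

theorem glue_all {c : α → α → K} (hs : Sy c) {a b : K} (hab : a ≠ b) {T : Finset α}
    (h2 : Two c a b T) (ha : NoH c a T) (hb : NoH c b T) {v : α} (hv : v ∈ T)
    {m : ℕ} {g : List ℕ} {f : ℕ → α} (hf : Emb c a m g f) (hfm : ∀ i < m, f i ∈ nb c a v T)
    {pats : List (List ℕ)} (hchk : glueChk m g pats = true)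
    {m' : ℕ} {g' : List ℕ} {f' : ℕ → α} (hf' : Emb c b m' g' f') (hfm' : ∀ i < m', f' i ∈ nb c b v T)
    {e e' : ℕ} {G : List (ℕ × List ℕ)} {H : List ℕ} (hg' : (e', g') ∈ G) (he : e ≤ e')
    (hemb : embChk m' pats ((G.filter fun x => Nat.ble e x.1).map Prod.snd) H = true) : False := by
  obtain ⟨P, hP, p, hp⟩ := embChk_sound hemb g' (List.mem_map.2 ⟨_, List.mem_filter.2
    ⟨hg', Nat.ble_eq_true_of_le he⟩, rfl⟩)
  obtain ⟨k1, k2⟩ := isoChk_sound hs hf' hp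
  exact glue_sound hs hab h2 ha hb hv hf hfm hchk hP k1 (fun i hi => hfm' _ (k2 i hi))
end
end GRH


namespace GRH
section
open scoped Classical

variable {α K : Type}

theorem glue11 {c : α → α → K} (hs : Sy c) {a b : K} (hab : a ≠ b) {T : Finset α}
    (h2 : Two c a b T) (ha : NoH c a T) (hb : NoH c b T) {v : α} (hv : v ∈ T)
    {e : ℕ} {g : List ℕ} {f : ℕ → α} (hf : Emb c a 11 g f) (hfm : ∀ i < 11, f i ∈ nb c a v T)
    (hg : (e, g) ∈ G11)
    {e' : ℕ} {g' : List ℕ} {f' : ℕ → α} (hf' : Emb c b 10 g' f') (hfm' : ∀ i < 10, f' i ∈ nb c b v T)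
    (hg' : (e', g') ∈ G10) (h20 : 20 ≤ e') (hee : 45 ≤ e + e') : False := by
  obtain ⟨i, hi⟩ := List.mem_iff_getElem?.1 hg
  have hi12 : i < 12 := (List.getElem?_eq_some_iff.1 hi).1
  have hd : G11.getD i (0, []) = (e, g) := by
    rw [List.getD_eq_getElem?_getD, hi]; rfl
  have go : ∀ {P : List (List ℕ)} {H : List ℕ} {t x : ℕ},
      glueChk 11 (G11.getD i (0, [])).2 P = true →
      embChk 10 P ((G10.filter fun x => Nat.ble t x.1).map Prod.snd) H = true →
      (G11.getD i (0, [])).1 = x → (x = e → t ≤ e') → False := by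
    intro P H t x h1 h3 h4 h5
    rw [hd] at h1 h4
    exact glue_all hs hab h2 ha hb hv hf hfm h1 hf' hfm' hg' (h5 h4.symm) h3
  interval_cases i
  · exact go (x := 24) (glue11_0) (emb11_0) (by rfl) (by omega)
  · exact go (x := 24) (glue11_1) (emb11_1) (by rfl) (by omega)
  · exact go (x := 24) (glue11_2) (emb11_2) (by rfl) (by omega)
  · exact go (x := 24) (glue11_3) (emb11_3) (by rfl) (by omega)
  · exact go (x := 24) (glue11_4) (emb11_4) (by rfl) (by omega)
  · exact go (x := 24) (glue11_5) (emb11_5) (by rfl) (by omega)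
  · exact go (x := 24) (glue11_6) (emb11_6) (by rfl) (by omega)
  · exact go (x := 24) (glue11_7) (emb11_7) (by rfl) (by omega)
  · exact go (x := 25) (glue11_8) (emb11_8) (by rfl) (by omega)
  · exact go (x := 24) (glue11_9) (emb11_9) (by rfl) (by omega)
  · exact go (x := 24) (glue11_10) (emb11_10) (by rfl) (by omega)
  · exact go (x := 25) (glue11_11) (emb11_11) (by rfl) (by omega)

theorem no22a {c : α → α → K} (hs : Sy c) {a b : K} (hab : a ≠ b) {T : Finset α}
    (h2 : Two c a b T) (ha : NoH c a T) (hb : NoH c b T) (hc : T.card = 22) {v : α} (hv : v ∈ T)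
    (hd : 420 ≤ deg2 c a (nb c a v T) + deg2 c b (nb c b v T)
      + 3 * ((nb c a v T).card * (nb c b v T).card))
    (h11 : 11 ≤ (nb c a v T).card) : False := by
  have h0 := h2.card hab hv
  have hA2 : Two c a b (nb c a v T) := h2.mono nb_subset
  have hB2 : Two c b a (nb c b v T) := (h2.mono nb_subset).swap
  have hAD := nb_noD hs hv ha
  have hBD := nb_noD hs hv hb
  have hAb : NoH c b (nb c a v T) := hb.mono nb_subset
  have hBa : NoH c a (nb c b v T) := ha.mono nb_subset
  have h12 := card_D_H hs hab hA2 hAD hAb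
  obtain ⟨p, hp⟩ := deg2_even hs (a := a) (nb c a v T)
  obtain ⟨q, hq⟩ := deg2_even hs (a := b) (nb c b v T)
  have : (nb c a v T).card = 11 ∨ (nb c a v T).card = 12 := by omega
  rcases this with hA | hA
  · have hB : (nb c b v T).card = 10 := by omega
    rw [hA, hB] at hd
    have b1 := (cls11 hs (a := a) (b := b)).bound (e := 25) (by decide) (by norm_num) hA2 hAD hAb hA
    have b2 := (cls10 hs (a := b) (b := a)).bound (e := 21) (by decide) (by norm_num) hB2 hBD hBa hB
    obtain ⟨e, g, f, k1, k2, k3, k4⟩ := cls11 hs _ hA2 hAD hAb hA (by omega)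
    obtain ⟨e', g', f', l1, l2, l3, l4⟩ := cls10 hs _ hB2 hBD hBa hB (by omega)
    exact glue11 hs hab h2 ha hb hv k2 k3 k1 l2 l3 l1 (by omega) (by omega)
  · have hB : (nb c b v T).card = 9 := by omega
    rw [hA, hB] at hd
    have b1 := (cls12 hs (a := a) (b := b)).bound (e := 30) (by decide) (by norm_num) hA2 hAD hAb hA
    have b2 := (cls9 hs (a := b) (b := a)).bound (e := 18) (by decide) (by norm_num) hB2 hBD hBa hB
    obtain ⟨e, g, f, k1, k2, k3, k4⟩ := cls12 hs _ hA2 hAD hAb hA (by omega)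
    obtain ⟨e', g', f', l1, l2, l3, l4⟩ := cls9 hs _ hB2 hBD hBa hB (by omega)
    obtain ⟨i, hi⟩ := List.mem_iff_getElem?.1 k1
    have hi12 : i < 1 := (List.getElem?_eq_some_iff.1 hi).1
    obtain rfl : i = 0 := by omega
    have hd' : G12.getD 0 (0, []) = (e, g) := by
      rw [List.getD_eq_getElem?_getD, hi]; rfl
    have hch := glue12_0
    rw [hd'] at hch
    exact glue_all hs hab h2 ha hb hv k2 k3 hch l2 l3 l1 (by omega) emb12_0

/-- The two-colored Ramsey number of `K₅ - e` is at most `22`. -/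
theorem card_H_H {c : α → α → K} (hs : Sy c) {a b : K} (hab : a ≠ b) {T : Finset α}
    (h2 : Two c a b T) (ha : NoH c a T) (hb : NoH c b T) : T.card ≤ 21 := by
  by_contra hcon
  obtain ⟨U, hU, hc⟩ := Finset.exists_subset_card_eq (by omega : 22 ≤ T.card)
  have h2 := h2.mono hU
  have ha := ha.mono hU
  have hb := hb.mono hU
  have G := goodman hs hab h2
  rw [hc] at G
  obtain ⟨v, hv, hle⟩ := Finset.exists_le_of_sum_le (s := U) (f := fun _ => 420)
    (g := fun v => deg2 c a (nb c a v U) + deg2 c b (nb c b v U)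
      + 3 * ((nb c a v U).card * (nb c b v U).card)) (Finset.card_pos.1 (by omega))
    (by rw [G, Finset.sum_const, hc]; norm_num)
  have h0 := h2.card hab hv
  by_cases h : 11 ≤ (nb c a v U).card
  · exact no22a hs hab h2 ha hb hc hv hle h
  · refine no22a hs hab.symm h2.swap hb ha hc hv ?_ (by omega)
    rw [mul_comm (nb c b v U).card]
    omega
end
end GRH


namespace GRH
section
open scoped Classical

variable {α K β : Type}

/-! ### Joins -/

def Jn (c : α → α → K) (a : K) (X Y : Finset α) : Prop := ∀ x ∈ X, ∀ y ∈ Y, Ed c a x y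

theorem Jn.symm {c : α → α → K} (hs : Sy c) {a : K} {X Y : Finset α} (h : Jn c a X Y) :
    Jn c a Y X := fun y hy x hx => (h x hx y hy).symm hs

theorem Jn.mono {c : α → α → K} {a : K} {X Y X' Y' : Finset α} (h : Jn c a X Y) (hX : X' ⊆ X)
    (hY : Y' ⊆ Y) : Jn c a X' Y' := fun x hx y hy => h x (hX hx) y (hY hy)

theorem Jn.noT {c : α → α → K} {a : K} {X Y U : Finset α} (h : Jn c a X Y) (hU : NoH c a U)
    (hX : X ⊆ U) (hY : Y ⊆ U) (h2 : 2 ≤ X.card) : NoT c a Y := by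
  obtain ⟨x, hx, y, hy, n⟩ := exists2 h2
  intro p hp q hq r hr e1 e2 e3
  exact hU x (hX hx) y (hX hy) p (hY hp) q (hY hq) r (hY hr) n e1 e2 e3 (h x hx p hp) (h x hx q hq)
    (h x hx r hr) (h y hy p hp) (h y hy q hq) (h y hy r hr)

theorem Jn.noP {c : α → α → K} (hs : Sy c) {a : K} {X Y U : Finset α} (h : Jn c a X Y) (hU : NoH c a U)
    (hX : X ⊆ U) (hY : Y ⊆ U) (h2 : ¬ NoE c a X) : NoP c a Y := by
  unfold NoE at h2
  push Not at h2
  obtain ⟨x, hx, y, hy, e⟩ := h2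
  intro p hp q hq r hr n e1 e2
  exact hU q (hY hq) r (hY hr) p (hY hp) x (hX hx) y (hX hy) n ((h x hx p hp).symm hs)
    ((h y hy p hp).symm hs) e (e1.symm hs) ((h x hx q hq).symm hs) ((h y hy q hq).symm hs)
    (e2.symm hs) ((h x hx r hr).symm hs) ((h y hy r hr).symm hs)

theorem Jn.noE {c : α → α → K} {a : K} {X Y U : Finset α} (h : Jn c a X Y) (hU : NoT c a U)
    (hX : X ⊆ U) (hY : Y ⊆ U) (h2 : X.Nonempty) : NoE c a Y := by
  obtain ⟨x, hx⟩ := h2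
  intro p hp q hq e
  exact hU x (hX hx) p (hY hp) q (hY hq) (h x hx p hp) (h x hx q hq) e

theorem Jn.empty_of_noP {c : α → α → K} (hs : Sy c) {a : K} {X Y U : Finset α} (h : Jn c a X Y)
    (hU : NoP c a U) (hX : X ⊆ U) (hY : Y ⊆ U) (h2 : 2 ≤ X.card) : Y = ∅ := by
  obtain ⟨x, hx, y, hy, n⟩ := exists2 h2
  by_contra hne
  obtain ⟨p, hp⟩ := Finset.nonempty_iff_ne_empty.2 hne
  exact hU p (hY hp) x (hX hx) y (hX hy) n ((h x hx p hp).symm hs) ((h y hy p hp).symm hs)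

theorem Jn.empty_of_noE {c : α → α → K} {a : K} {X Y U : Finset α} (h : Jn c a X Y)
    (hU : NoE c a U) (hX : X ⊆ U) (hY : Y ⊆ U) (h2 : X.Nonempty) : Y = ∅ := by
  obtain ⟨x, hx⟩ := h2
  by_contra hne
  obtain ⟨p, hp⟩ := Finset.nonempty_iff_ne_empty.2 hne
  exact hU x (hX hx) p (hY hp) (h x hx p hp)

theorem noE_single {c : α → α → K} {a : K} {X : Finset α} (h : X.card ≤ 1) : NoE c a X := by
  intro x hx y hy e
  exact e.1 (Finset.card_le_one.1 h x hx y hy)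

theorem two_of_fat {c : α → α → K} {a : K} {X : Finset α} (h : ¬ NoE c a X) : 2 ≤ X.card := by
  by_contra hc
  exact h (noE_single (by omega))

/-! ### Partitions whose cross edges use two colors -/

structure Q (c : α → α → K) (a b : K) (W : Finset α) (cl : α → β) : Prop where
  cross : ∀ u ∈ W, ∀ v ∈ W, cl u ≠ cl v → c u v = a ∨ c u v = b
  unif : ∀ u ∈ W, ∀ u' ∈ W, ∀ w ∈ W, cl u = cl u' → cl u ≠ cl w → c u w = c u' w

theorem Q.mono {c : α → α → K} {a b : K} {W W' : Finset α} {cl : α → β} (h : Q c a b W cl)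
    (hw : W' ⊆ W) : Q c a b W' cl :=
  ⟨fun u hu v hv => h.cross u (hw hu) v (hw hv),
   fun u hu u' hu' w hw' => h.unif u (hw hu) u' (hw hu') w (hw hw')⟩

theorem Q.swap {c : α → α → K} {a b : K} {W : Finset α} {cl : α → β} (h : Q c a b W cl) :
    Q c b a W cl := ⟨fun u hu v hv n => (h.cross u hu v hv n).symm, h.unif⟩

noncomputable def Pt (cl : α → β) (W : Finset α) (v : α) : Finset α :=
  W.filter (fun u => cl u = cl v)

noncomputable def Rd (c : α → α → K) (a : K) (cl : α → β) (W : Finset α) (v : α) : Finset α :=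
  W.filter (fun u => cl u ≠ cl v ∧ c v u = a)

theorem mem_Pt {cl : α → β} {W : Finset α} {v u : α} : u ∈ Pt cl W v ↔ u ∈ W ∧ cl u = cl v := by
  simp [Pt]
theorem mem_Rd {c : α → α → K} {a : K} {cl : α → β} {W : Finset α} {v u : α} :
    u ∈ Rd c a cl W v ↔ u ∈ W ∧ cl u ≠ cl v ∧ c v u = a := by simp [Rd]
theorem Pt_sub {cl : α → β} {W : Finset α} {v : α} : Pt cl W v ⊆ W := Finset.filter_subset _ _
theorem Rd_sub {c : α → α → K} {a : K} {cl : α → β} {W : Finset α} {v : α} : Rd c a cl W v ⊆ W :=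
  Finset.filter_subset _ _
theorem self_Pt {cl : α → β} {W : Finset α} {v : α} (h : v ∈ W) : v ∈ Pt cl W v := mem_Pt.2 ⟨h, rfl⟩
theorem Pt_mono {cl : α → β} {W W' : Finset α} {v : α} (h : W' ⊆ W) : Pt cl W' v ⊆ Pt cl W v :=
  Finset.filter_subset_filter _ h

theorem Q.card {c : α → α → K} {a b : K} (hab : a ≠ b) {W : Finset α} {cl : α → β}
    (h : Q c a b W cl) {v : α} (hv : v ∈ W) :
    W.card = (Pt cl W v).card + (Rd c a cl W v).card + (Rd c b cl W v).card := by
  have h1 : W = Pt cl W v ∪ Rd c a cl W v ∪ Rd c b cl W v := by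
    ext u
    simp only [Finset.mem_union, mem_Pt, mem_Rd]
    constructor
    · intro hu
      by_cases e : cl u = cl v
      · exact Or.inl (Or.inl ⟨hu, e⟩)
      · rcases h.cross v hv u hu (Ne.symm e) with h' | h'
        · exact Or.inl (Or.inr ⟨hu, e, h'⟩)
        · exact Or.inr ⟨hu, e, h'⟩
    · tauto
  conv_lhs => rw [h1]
  rw [Finset.card_union_of_disjoint, Finset.card_union_of_disjoint]
  · rw [Finset.disjoint_left]
    intro u h1 h2
    exact (mem_Rd.1 h2).2.1 (mem_Pt.1 h1).2
  · rw [Finset.disjoint_left]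
    intro u h1 h2
    rcases Finset.mem_union.1 h1 with h1 | h1
    · exact (mem_Rd.1 h2).2.1 (mem_Pt.1 h1).2
    · exact hab ((mem_Rd.1 h1).2.2.symm.trans (mem_Rd.1 h2).2.2)

theorem Q.jn {c : α → α → K} {a b : K} {W : Finset α} {cl : α → β}
    (h : Q c a b W cl) {v : α} (hv : v ∈ W) (j : K) : Jn c j (Pt cl W v) (Rd c j cl W v) := by
  intro p hp q hq
  rw [mem_Pt] at hp
  rw [mem_Rd] at hq
  refine ⟨fun e => hq.2.1 (by rw [← e, hp.2]), ?_⟩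
  rw [← hq.2.2]
  exact (h.unif v hv p hp.1 q hq.1 hp.2.symm hq.2.1.symm).symm

/-- joining parts -/
theorem Q.jn' {c : α → α → K} (hs : Sy c) {a b : K} {W : Finset α} {cl : α → β}
    (h : Q c a b W cl) {u v : α} (hv : v ∈ W) (j : K) (hu : u ∈ Rd c j cl W v) :
    Jn c j (Pt cl W v) (Pt cl W u) := by
  intro p hp q hq
  have hu' := mem_Rd.1 hu
  have e := (h.jn hv j p hp u hu).symm hs
  rw [mem_Pt] at hp hq
  have hne : cl q ≠ cl p := by rw [hq.2, hp.2]; exact hu'.2.1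
  refine ⟨fun e => hne (by rw [e]), ?_⟩
  rw [hs, h.unif q hq.1 u hu'.1 p hp.1 hq.2 hne]
  exact e.2

theorem Rd_symm {c : α → α → K} (hs : Sy c) {W : Finset α} {cl : α → β} {u v : α} {j : K} (hv : v ∈ W)
    (hu : u ∈ Rd c j cl W v) : v ∈ Rd c j cl W u := by
  rw [mem_Rd] at *
  exact ⟨hv, hu.2.1.symm, by rw [hs]; exact hu.2.2⟩

theorem transversal (cl : α → β) (W : Finset α) : ∃ T ⊆ W, (∀ w ∈ W, ∃ t ∈ T, cl t = cl w) ∧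
    (∀ t ∈ T, ∀ t' ∈ T, cl t = cl t' → t = t') := by
  induction W using Finset.induction_on with
  | empty => exact ⟨∅, by simp, by simp, by simp⟩
  | @insert x W hx ih =>
    obtain ⟨T, h1, h2, h3⟩ := ih
    by_cases h : ∃ t ∈ T, cl t = cl x
    · refine ⟨T, h1.trans (Finset.subset_insert _ _), ?_, h3⟩
      intro w hw
      rcases Finset.mem_insert.1 hw with rfl | hw
      · exact h
      · exact h2 w hw
    · push Not at h
      refine ⟨insert x T, Finset.insert_subset_insert _ h1, ?_, ?_⟩
      · intro w hw
        rcases Finset.mem_insert.1 hw with rfl | hw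
        · exact ⟨w, by simp, rfl⟩
        · obtain ⟨t, ht, e⟩ := h2 w hw
          exact ⟨t, by simp [ht], e⟩
      · intro t ht t' ht' e
        rcases Finset.mem_insert.1 ht with e1 | k <;> rcases Finset.mem_insert.1 ht' with e2 | k'
        · rw [e1, e2]
        · subst e1; exact absurd e.symm (h t' k')
        · subst e2; exact absurd e (h t k)
        · exact h3 t k t' k' e

theorem Q.two {c : α → α → K} {a b : K} {W T : Finset α} {cl : α → β}
    (h : Q c a b W cl) (hT : T ⊆ W) (h3 : ∀ t ∈ T, ∀ t' ∈ T, cl t = cl t' → t = t') :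
    Two c a b T := fun u hu v hv n => h.cross u (hT hu) v (hT hv) (fun e => n (h3 u hu v hv e))

theorem card_le_sum {cl : α → β} {W T : Finset α} (h2 : ∀ w ∈ W, ∃ t ∈ T, cl t = cl w) :
    W.card ≤ ∑ t ∈ T, (Pt cl W t).card := by
  have : W ⊆ T.biUnion (fun t => Pt cl W t) := by
    intro w hw
    obtain ⟨t, ht, e⟩ := h2 w hw
    exact Finset.mem_biUnion.2 ⟨t, ht, mem_Pt.2 ⟨hw, e.symm⟩⟩
  exact (Finset.card_le_card this).trans Finset.card_biUnion_le

theorem sum_e {S : Finset α} {g : α → ℕ} {e F : ℕ} (hS : S.Nonempty) (h : ∀ t ∈ S, g t + e ≤ F) :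
    ∑ t ∈ S, g t + e ≤ S.card * F := by
  have h1 := Finset.sum_le_card_nsmul S (fun t => g t + e) F h
  rw [Finset.sum_add_distrib, Finset.sum_const, smul_eq_mul, smul_eq_mul] at h1
  have h2 : 1 ≤ S.card := Finset.card_pos.2 hS
  nlinarith

/-- number of parts at most `m`, each of size at most `F` -/
theorem card_le_parts {cl : α → β} {W T : Finset α} (h2 : ∀ w ∈ W, ∃ t ∈ T, cl t = cl w) {m F : ℕ}
    (hT : T.card ≤ m) (hF : ∀ t ∈ T, (Pt cl W t).card ≤ F) : W.card ≤ m * F := by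
  have h1 := (card_le_sum h2).trans (Finset.sum_le_card_nsmul T _ F hF)
  rw [smul_eq_mul] at h1
  exact h1.trans (Nat.mul_le_mul_right F hT)

/-- no big parts -/
theorem Q.two_of_small {c : α → α → K} {a b : K} {W : Finset α} {cl : α → β}
    (h : Q c a b W cl) (hn : ∀ v ∈ W, (Pt cl W v).card < 2) : Two c a b W := by
  refine h.two (Finset.Subset.refl _) ?_
  intro t ht t' ht' e
  exact Finset.card_le_one.1 (by have := hn t ht; omega) t (self_Pt ht) t' (mem_Pt.2 ⟨ht', e.symm⟩)
end
end GRH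


namespace GRH
section
open scoped Classical

variable {α K β : Type}

theorem fat_mono {c : α → α → K} {a : K} {X Y : Finset α} (h : ¬ NoE c a X) (hs : X ⊆ Y) :
    ¬ NoE c a Y := fun h' => h (h'.mono hs)

/-- red neighborhood of a big part -/
theorem Q.F1 {c : α → α → K} {a b : K} {W : Finset α} {cl : α → β} (h : Q c a b W cl) {j : K}
    (ha : NoH c j W) {v : α} (hv : v ∈ W) (h2 : 2 ≤ (Pt cl W v).card) : NoT c j (Rd c j cl W v) :=
  (h.jn hv j).noT ha Pt_sub Rd_sub h2

theorem Q.F2 {c : α → α → K} (hs : Sy c) {a b : K} {W : Finset α} {cl : α → β} (h : Q c a b W cl)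
    {j : K} (ha : NoH c j W) {v : α} (hv : v ∈ W) (h2 : ¬ NoE c j (Pt cl W v)) :
    NoP c j (Rd c j cl W v) := (h.jn hv j).noP hs ha Pt_sub Rd_sub h2

theorem Q.F3 {c : α → α → K} (hs : Sy c) {a b : K} {W : Finset α} {cl : α → β} (h : Q c a b W cl)
    {j : K} (ha : NoH c j W) {v : α} (hv : v ∈ W) (h2 : ¬ NoE c j (Rd c j cl W v)) :
    NoP c j (Pt cl W v) := ((h.jn hv j).symm hs).noP hs ha Rd_sub Pt_sub h2

/-- in a set without monochromatic path, a big part has no neighbors -/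
theorem Q.emptyP {c : α → α → K} (hs : Sy c) {a b : K} {W : Finset α} {cl : α → β} (h : Q c a b W cl)
    {j : K} (ha : NoP c j W) {v : α} (hv : v ∈ W) (h2 : 2 ≤ (Pt cl W v).card) : Rd c j cl W v = ∅ :=
  (h.jn hv j).empty_of_noP hs ha Pt_sub Rd_sub h2

theorem Q.emptyE {c : α → α → K} {a b : K} {W : Finset α} {cl : α → β} (h : Q c a b W cl)
    {j : K} (ha : NoE c j W) {v : α} (hv : v ∈ W) : Rd c j cl W v = ∅ :=
  (h.jn hv j).empty_of_noE ha Pt_sub Rd_sub ⟨v, self_Pt hv⟩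

theorem Q.rdE {c : α → α → K} {a b : K} {W : Finset α} {cl : α → β} (h : Q c a b W cl)
    {j : K} (ha : NoT c j W) {v : α} (hv : v ∈ W) : NoE c j (Rd c j cl W v) :=
  (h.jn hv j).noE ha Pt_sub Rd_sub ⟨v, self_Pt hv⟩

theorem Q.ptE {c : α → α → K} (hs : Sy c) {a b : K} {W : Finset α} {cl : α → β} (h : Q c a b W cl)
    {j : K} (ha : NoT c j W) {v : α} (hv : v ∈ W) (hne : (Rd c j cl W v).Nonempty) :
    NoE c j (Pt cl W v) :=
  ((h.jn hv j).symm hs).noE ha Rd_sub Pt_sub hne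

/-- a monochromatic `K₄` of a transversal contains no big part -/
theorem Q.k4_small {c : α → α → K} {a b : K} {W T : Finset α} {cl : α → β}
    (h : Q c a b W cl) (hT : T ⊆ W) (h3 : ∀ t ∈ T, ∀ t' ∈ T, cl t = cl t' → t = t') {j : K}
    (ha : NoH c j W) {w x y z : α} (hw : w ∈ T) (hx : x ∈ T) (hy : y ∈ T) (hz : z ∈ T)
    (e1 : Ed c j w x) (e2 : Ed c j w y) (e3 : Ed c j w z) (e4 : Ed c j x y) (e5 : Ed c j x z)
    (e6 : Ed c j y z) : ¬ 2 ≤ (Pt cl W w).card := by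
  intro h2
  have key : ∀ u ∈ T, Ed c j w u → u ∈ Rd c j cl W w := fun u hu e =>
    mem_Rd.2 ⟨hT hu, fun h => e.1 (h3 u hu w hw h).symm, e.2⟩
  exact h.F1 ha (hT hw) h2 x (key x hx e1) y (key y hy e2) z (key z hz e3) e4 e5 e6

theorem side {c : α → α → K} (hs : Sy c) {a b : K} (hab : a ≠ b) {W : Finset α} {cl : α → β}
    (h : Q c a b W cl) (ha : NoH c a W) (hb : NoT c b W) {F e : ℕ} (hF : 2 ≤ F)
    (heF : e + 1 ≤ F) (hp : ∀ v ∈ W, (Pt cl W v).card + e ≤ F) : W.card + e ≤ 8 * F := by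
  by_cases hbig : ∃ v ∈ W, 2 ≤ (Pt cl W v).card
  · obtain ⟨v, hv, hv2⟩ := hbig
    obtain ⟨T, hT, h2, h3⟩ := transversal cl W
    have hTT := h.two hT h3
    obtain ⟨t, ht, htv⟩ := h2 v hv
    have ht2 : 2 ≤ (Pt cl W t).card := by unfold Pt at *; rw [htv]; exact hv2
    have hc := hTT.card hab ht
    have c1 := card_E_H (hTT.swap.mono nb_subset) (nb_noE ht (hb.mono hT))
      ((ha.mono hT).mono nb_subset)
    have hsub : nb c a t T ⊆ Rd c a cl W t := by
      intro u hu
      rw [mem_nb] at hu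
      exact mem_Rd.2 ⟨hT hu.1, fun h => hu.2.1 (h3 u hu.1 t ht h).symm, hu.2.2⟩
    have c2 := card_T_T hab (hTT.mono nb_subset) ((h.F1 ha (hT ht) ht2).mono hsub)
      ((hb.mono hT).mono nb_subset)
    have hle := card_le_sum h2
    set S := T.filter (fun t => ¬ 2 ≤ (Pt cl W t).card) with hS
    set S' := T.filter (fun t => 2 ≤ (Pt cl W t).card) with hS'
    have hsum : ∑ t ∈ T, (Pt cl W t).card = ∑ t ∈ S', (Pt cl W t).card + ∑ t ∈ S, (Pt cl W t).card :=
      (Finset.sum_filter_add_sum_filter_not T _ _).symm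
    have hcard : S'.card + S.card = T.card := Finset.card_filter_add_card_filter_not _
    have s1 : ∑ t ∈ S, (Pt cl W t).card ≤ S.card * 1 := by
      have := Finset.sum_le_card_nsmul S (fun t => (Pt cl W t).card) 1
        (fun t ht => by have := (Finset.mem_filter.1 ht).2; omega)
      rwa [smul_eq_mul] at this
    have s2 : ∑ t ∈ S', (Pt cl W t).card + e ≤ S'.card * F :=
      sum_e ⟨t, Finset.mem_filter.2 ⟨ht, ht2⟩⟩
        (fun t ht => hp t (hT (Finset.mem_filter.1 ht).1))
    by_cases h4 : 4 ≤ S.card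
    · have : S'.card * F + S.card ≤ 8 * F := by
        have : S'.card + S.card ≤ 10 := by omega
        have h6 : S'.card ≤ 6 := by omega
        have h8 : S.card ≤ 10 - S'.card := by omega
        generalize S'.card = x at *
        interval_cases x <;> omega
      omega
    · have hK : NoK4 c a T := by
        intro w hw x hx y hy z hz e1 e2 e3 e4 e5 e6
        have b1 := h.k4_small hT h3 ha hw hx hy hz e1 e2 e3 e4 e5 e6
        have b2 := h.k4_small hT h3 ha hx hw hy hz (e1.symm hs) e4 e5 e2 e3 e6
        have b3 := h.k4_small hT h3 ha hy hw hx hz (e2.symm hs) (e4.symm hs) e6 e1 e3 e5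
        have b4 := h.k4_small hT h3 ha hz hw hx hy (e3.symm hs) (e5.symm hs) (e6.symm hs) e1 e2 e4
        apply h4
        have : ({w, x, y, z} : Finset α) ⊆ S := by
          intro u hu
          simp only [Finset.mem_insert, Finset.mem_singleton] at hu
          rcases hu with rfl | rfl | rfl | rfl <;> exact Finset.mem_filter.2 ⟨by assumption, by assumption⟩
        have hc := Finset.card_le_card this
        rwa [Finset.card_insert_of_notMem, Finset.card_insert_of_notMem,
          Finset.card_insert_of_notMem, Finset.card_singleton] at hc
        · simpa using e6.1
        · simp [e4.1, e5.1]
        · simp [e1.1, e2.1, e3.1]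
      have := card_T_K4 hs hab.symm hTT.swap (hb.mono hT) hK
      have := sum_e ⟨t, ht⟩ (fun t ht => hp t (hT ht))
      have : T.card * F ≤ 8 * F := Nat.mul_le_mul_right F (by omega)
      omega
  · push Not at hbig
    have := card_H_T hs hab (h.two_of_small hbig) ha hb
    omega

theorem caseTT {c : α → α → K} {a b : K} (hab : a ≠ b) {W : Finset α} {cl : α → β}
    (h : Q c a b W cl) (ha : NoT c a W) (hb : NoT c b W) {F e : ℕ} (hne : W.Nonempty)
    (hp : ∀ v ∈ W, (Pt cl W v).card + e ≤ F) : W.card + e ≤ 5 * F := by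
  obtain ⟨T, hT, h2, h3⟩ := transversal cl W
  have hTT := h.two hT h3
  obtain ⟨v, hv⟩ := hne
  obtain ⟨t, ht, htv⟩ := h2 v hv
  have := sum_e ⟨t, ht⟩ (fun t ht => hp t (hT ht))
  have := card_le_sum h2
  have : T.card * F ≤ 5 * F :=
    Nat.mul_le_mul_right F (card_T_T hab hTT (ha.mono hT) (hb.mono hT))
  omega

/-- at most two parts, of bounded size -/
theorem cardEE {c : α → α → K} {a b : K} {W : Finset α} {cl : α → β}
    (h : Q c a b W cl) (ha : NoE c a W) (hb : NoT c b W) {F : ℕ}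
    (hp : ∀ v ∈ W, (Pt cl W v).card ≤ F) : W.card ≤ 2 * F := by
  obtain ⟨T, hT, h2, h3⟩ := transversal cl W
  exact card_le_parts h2 (card_E_T (h.two hT h3) (ha.mono hT) (hb.mono hT)) (fun t ht => hp t (hT ht))

/-- no path of color `a`, no edge of color `b`: at most two vertices, or only one part. -/
theorem onePart {c : α → α → K} (hs : Sy c) {a b : K} (hab : a ≠ b) {W : Finset α} {cl : α → β}
    (h : Q c a b W cl) (ha : NoP c a W) (hb : NoE c b W) :
    W.card ≤ 2 ∨ ∃ v ∈ W, W = Pt cl W v := by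
  by_cases hbig : ∃ v ∈ W, 2 ≤ (Pt cl W v).card
  · obtain ⟨v, hv, hv2⟩ := hbig
    right
    refine ⟨v, hv, ?_⟩
    have h1 := h.card hab hv
    rw [h.emptyP hs ha hv hv2, h.emptyE hb hv] at h1
    exact (Finset.eq_of_subset_of_card_le Pt_sub (by simp at h1; omega)).symm
  · push Not at hbig
    exact Or.inl (card_E_P (h.two_of_small hbig).swap hb ha)
end
end GRH


namespace GRH
section
open scoped Classical

variable {α K β : Type}

/-- Standing assumptions when no part contains an edge of color `b`. -/
structure S1 (c : α → α → K) (a b : K) (V : Finset α) (cl : α → β) (F FP FT : ℕ) : Prop where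
  q : Q c a b V cl
  nh : NoH c a V
  f2 : 2 ≤ F
  ffp : F ≤ FP
  pe : ∀ v ∈ V, NoE c b (Pt cl V v)
  pt : ∀ v ∈ V, NoT c a (Pt cl V v)
  hEE : ∀ W ⊆ V, NoE c a W → NoE c b W → W.card ≤ F
  hPE : ∀ W ⊆ V, NoP c a W → NoE c b W → W.card ≤ FP
  hTE : ∀ W ⊆ V, NoT c a W → NoE c b W → W.card ≤ FT

theorem S1.mono {c : α → α → K} {a b : K} {V W : Finset α} {cl : α → β} {F FP FT : ℕ}
    (h : S1 c a b V cl F FP FT) (hw : W ⊆ V) : S1 c a b W cl F FP FT :=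
  ⟨h.q.mono hw, h.nh.mono hw, h.f2, h.ffp, fun v hv => (h.pe v (hw hv)).mono (Pt_mono hw),
    fun v hv => (h.pt v (hw hv)).mono (Pt_mono hw),
    fun W' h' => h.hEE W' (h'.trans hw), fun W' h' => h.hPE W' (h'.trans hw),
    fun W' h' => h.hTE W' (h'.trans hw)⟩

theorem S1.zlem {c : α → α → K} (hs : Sy c) {a b : K} (hab : a ≠ b) {W : Finset α} {cl : α → β}
    {F FP FT : ℕ} (h : S1 c a b W cl F FP FT) (hb : NoE c b W) :
    W.card ≤ 3 * F ∨ (∃ z ∈ W, ¬ NoE c a (Pt cl W z) ∧ W.card ≤ (Pt cl W z).card + F) ∨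
    (∃ z ∈ W, ∃ z' ∈ Rd c a cl W z, ¬ NoE c a (Pt cl W z) ∧ ¬ NoE c a (Pt cl W z') ∧
      W.card ≤ 2 * FP) := by
  have f2 := h.f2
  by_cases hfat : ∃ z ∈ W, ¬ NoE c a (Pt cl W z)
  · obtain ⟨z, hz, hzf⟩ := hfat
    have hc := h.q.card hab hz
    rw [h.q.emptyE hb hz, Finset.card_empty] at hc
    have hP := h.q.F2 hs h.nh hz hzf
    by_cases hE : NoE c a (Rd c a cl W z)
    · have := h.hEE _ Rd_sub hE (hb.mono Rd_sub)
      exact Or.inr (Or.inl ⟨z, hz, hzf, by omega⟩)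
    · rcases onePart hs hab (h.q.mono (Rd_sub (a := a) (v := z))) hP (hb.mono Rd_sub) with h1 | ⟨z', hz', h1⟩
      · exact Or.inr (Or.inl ⟨z, hz, hzf, by omega⟩)
      · have e1 := h.hPE _ Pt_sub (h.q.F3 hs h.nh hz hE) (hb.mono Pt_sub)
        have e2 := h.hPE _ Rd_sub hP (hb.mono Rd_sub)
        refine Or.inr (Or.inr ⟨z, hz, z', hz', hzf, ?_, by omega⟩)
        rw [h1] at hE
        exact fat_mono hE (Pt_mono Rd_sub)
  · push Not at hfat
    left
    have hp : ∀ v ∈ W, (Pt cl W v).card ≤ F := fun v hv => h.hEE _ Pt_sub (hfat v hv) (hb.mono Pt_sub)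
    by_cases hbig : ∃ v ∈ W, 2 ≤ (Pt cl W v).card
    · obtain ⟨v, hv, hv2⟩ := hbig
      have hc := h.q.card hab hv
      rw [h.q.emptyE hb hv, Finset.card_empty] at hc
      have := cardEE (h.q.swap.mono (Rd_sub (a := a) (v := v))) (hb.mono Rd_sub) (h.q.F1 h.nh hv hv2)
        (F := F) (fun u hu => (Finset.card_le_card (Pt_mono Rd_sub)).trans (hp u (Rd_sub hu)))
      have := hp v hv
      omega
    · push Not at hbig
      have := card_E_H (h.q.two_of_small hbig).swap hb h.nh
      omega

theorem S1.ylem {c : α → α → K} (hs : Sy c) {a b : K} (hab : a ≠ b) {W : Finset α} {cl : α → β}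
    {F FP FT : ℕ} (h : S1 c a b W cl F FP FT) (ha : NoP c a W) (hb : NoT c b W) :
    W.card ≤ FP + F ∨ (∃ y ∈ W, ∃ u ∈ Rd c b cl W y, ¬ NoE c a (Pt cl W y) ∧ ¬ NoE c a (Pt cl W u) ∧
      W.card ≤ 2 * FP) := by
  have f2 := h.f2
  have ffp := h.ffp
  by_cases hbig : ∃ v ∈ W, 2 ≤ (Pt cl W v).card
  · obtain ⟨y, hy, hy2⟩ := hbig
    have hc := h.q.card hab hy
    rw [h.q.emptyP hs ha hy hy2, Finset.card_empty] at hc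
    have hE := h.q.rdE hb hy
    have e1 := h.hPE _ Pt_sub (ha.mono Pt_sub) (h.pe y hy)
    have e2 := h.hPE _ (Rd_sub (a := b) (v := y)) (ha.mono Rd_sub) hE
    by_cases hyf : NoE c a (Pt cl W y)
    · have := h.hEE _ Pt_sub hyf (h.pe y hy)
      left; omega
    · by_cases hrf : NoE c a (Rd c b cl W y)
      · have := h.hEE _ Rd_sub hrf hE
        left; omega
      · rcases onePart hs hab (h.q.mono (Rd_sub (a := b) (v := y))) (ha.mono Rd_sub) hE with h1 | ⟨u, hu, h1⟩
        · left; omega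
        · refine Or.inr ⟨y, hy, u, hu, hyf, ?_, by omega⟩
          rw [h1] at hrf
          exact fat_mono hrf (Pt_mono Rd_sub)
  · push Not at hbig
    have := card_P_T hab (h.q.two_of_small hbig) ha hb
    left; omega

/-- `z` is joined to one of the two parts in color `a`. -/
theorem Q.redTo {c : α → α → K} (hs : Sy c) {a b : K} (_hab : a ≠ b) {W : Finset α} {cl : α → β}
    (h : Q c a b W cl) (hb : NoT c b W) (ha : NoH c a W) {y u z : α} (hy : y ∈ W)
    (hu : u ∈ Rd c b cl W y) (hz : z ∈ W) (hzy : cl z ≠ cl y) (hzu : cl z ≠ cl u)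
    (hyf : ¬ NoE c a (Pt cl W y)) (huf : ¬ NoE c a (Pt cl W u)) : NoP c a (Pt cl W z) := by
  have hu' := mem_Rd.1 hu
  rcases h.cross z hz y hy hzy with h1 | h1
  · exact ((h.jn' hs hz a (mem_Rd.2 ⟨hy, hzy.symm, h1⟩)).symm hs).noP hs ha Pt_sub Pt_sub hyf
  rcases h.cross z hz u hu'.1 hzu with h2 | h2
  · exact ((h.jn' hs hz a (mem_Rd.2 ⟨hu'.1, hzu.symm, h2⟩)).symm hs).noP hs ha Pt_sub Pt_sub huf
  exfalso
  refine hb z hz y hy u hu'.1 ⟨?_, h1⟩ ⟨?_, h2⟩ ⟨?_, hu'.2.2⟩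
  · exact fun e => hzy (by rw [e])
  · exact fun e => hzu (by rw [e])
  · exact fun e => hu'.2.1 (by rw [e])

theorem caseHT {c : α → α → K} (hs : Sy c) {a b : K} (hab : a ≠ b) {W : Finset α} {cl : α → β}
    {F FP FT e τ : ℕ} (h : S1 c a b W cl F FP FT) (hb : NoT c b W)
    (heF : e + 1 ≤ F) (n1 : 2 * FT ≤ 5 * F) (n2 : 8 * F ≤ τ) (n3 : 5 * FP ≤ τ)
    (n4 : 3 * FP + 3 * F ≤ τ) (n5 : 4 * FP + 9 * F ≤ 2 * τ)
    (pE : ∀ v ∈ W, NoE c a (Pt cl W v) → (Pt cl W v).card + e ≤ F)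
    (pP : ∀ v ∈ W, NoP c a (Pt cl W v) → (Pt cl W v).card + e ≤ FP)
    (pT : ∀ v ∈ W, NoT c a (Pt cl W v) → (Pt cl W v).card + e ≤ FT) : W.card + e ≤ τ := by
  have f2 := h.f2
  have ffp := h.ffp
  by_cases hfat : ∃ v ∈ W, ¬ NoE c a (Pt cl W v)
  · obtain ⟨v, hv, hvf⟩ := hfat
    have hc := h.q.card hab hv
    have hP := h.q.F2 hs h.nh hv hvf
    have hBE := h.q.rdE hb hv
    have hB : S1 c a b (Rd c b cl W v) cl F FP FT := h.mono Rd_sub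
    have hR : S1 c a b (Rd c a cl W v) cl F FP FT := h.mono Rd_sub
    have eT := pT v hv (h.pt v hv)
    have zT : ∀ z ∈ Rd c b cl W v, (Pt cl (Rd c b cl W v) z).card ≤ FT := fun z hz =>
      hB.hTE _ Pt_sub (hB.pt z hz) (hB.pe z hz)
    have hz := hB.zlem hs hab hBE
    by_cases hE : NoE c a (Rd c a cl W v)
    · have hR2 := cardEE hR.q hE (hb.mono Rd_sub) (F := F)
        (fun u hu => hR.hEE _ Pt_sub (hE.mono Pt_sub) (hR.pe u hu))
      rcases hz with hz | ⟨z, hz, -, hz2⟩ | ⟨z, hz, z', hz', -, -, hz2⟩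
      · omega
      · have := zT z hz
        omega
      · omega
    · have eP := pP v hv (h.q.F3 hs h.nh hv hE)
      rcases hR.ylem hs hab hP (hb.mono Rd_sub) with hy | ⟨y, hy, u, hu, hyf, huf, hy2⟩
      · rcases hz with hz | ⟨z, hz, -, hz2⟩ | ⟨z, hz, z', hz', -, -, hz2⟩
        · omega
        · have := zT z hz
          omega
        · omega
      · rcases hz with hz | ⟨z, hz, -, hz2⟩ | ⟨z, hz, z', hz', -, -, hz2⟩
        · omega
        · have hzW := mem_Rd.1 hz
          have hne : ∀ x ∈ Rd c a cl W v, cl z ≠ cl x := by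
            intro x hx e
            have hx := mem_Rd.1 hx
            have := h.q.unif z hzW.1 x hx.1 v hv e hzW.2.1
            rw [hs z, hs x, hzW.2.2, hx.2.2] at this
            exact hab this.symm
          have hu' := mem_Rd.1 hu
          have := h.q.redTo hs hab hb h.nh (mem_Rd.1 hy).1
            (mem_Rd.2 ⟨(mem_Rd.1 hu'.1).1, hu'.2⟩) hzW.1 (hne y hy) (hne u hu'.1)
            (fat_mono hyf (Pt_mono Rd_sub)) (fat_mono huf (Pt_mono Rd_sub))
          have := hB.hPE _ Pt_sub (this.mono (Pt_mono Rd_sub)) (hB.pe z hz)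
          omega
        · omega
  · push Not at hfat
    exact (side hs hab h.q h.nh hb f2 heF (fun v hv => pE v hv (hfat v hv))).trans n2
end
end GRH


namespace GRH
section
open scoped Classical

variable {α K β : Type}

/-- Standing assumptions for two unrestricted colors. -/
structure HB (c : α → α → K) (a b : K) (V : Finset α) (cl : α → β) (F : ℕ) : Prop where
  q : Q c a b V cl
  na : NoH c a V
  nb : NoH c b V
  f2 : 2 ≤ F
  ta : ∀ v ∈ V, NoT c a (Pt cl V v)
  tb : ∀ v ∈ V, NoT c b (Pt cl V v)
  hEE : ∀ W ⊆ V, NoE c a W → NoE c b W → W.card ≤ F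
  hPP : ∀ W ⊆ V, NoP c a W → NoP c b W → W.card ≤ 2 * F
  hTE : ∀ W ⊆ V, NoT c a W → NoE c b W → 2 * W.card ≤ 5 * F
  hET : ∀ W ⊆ V, NoE c a W → NoT c b W → 2 * W.card ≤ 5 * F
  hTT : ∀ W ⊆ V, NoT c a W → NoT c b W → W.card ≤ 5 * F

theorem HB.mono {c : α → α → K} {a b : K} {V W : Finset α} {cl : α → β} {F : ℕ}
    (h : HB c a b V cl F) (hw : W ⊆ V) : HB c a b W cl F :=
  ⟨h.q.mono hw, h.na.mono hw, h.nb.mono hw, h.f2, fun v hv => (h.ta v (hw hv)).mono (Pt_mono hw),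
    fun v hv => (h.tb v (hw hv)).mono (Pt_mono hw),
    fun W' h' => h.hEE W' (h'.trans hw), fun W' h' => h.hPP W' (h'.trans hw),
    fun W' h' => h.hTE W' (h'.trans hw), fun W' h' => h.hET W' (h'.trans hw),
    fun W' h' => h.hTT W' (h'.trans hw)⟩

theorem HB.swap {c : α → α → K} {a b : K} {V : Finset α} {cl : α → β} {F : ℕ}
    (h : HB c a b V cl F) : HB c b a V cl F :=
  ⟨h.q.swap, h.nb, h.na, h.f2, h.tb, h.ta, fun W hw h1 h2 => h.hEE W hw h2 h1,
    fun W hw h1 h2 => h.hPP W hw h2 h1, fun W hw h1 h2 => h.hET W hw h2 h1,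
    fun W hw h1 h2 => h.hTE W hw h2 h1, fun W hw h1 h2 => h.hTT W hw h2 h1⟩

theorem HB.s1 {c : α → α → K} {a b : K} {V : Finset α} {cl : α → β} {F : ℕ}
    (h : HB c a b V cl F) (he : ∀ v ∈ V, NoE c b (Pt cl V v)) :
    S1 c a b V cl F (2 * F) (5 * F / 2) :=
  ⟨h.q, h.na, h.f2, by omega, he, h.ta, h.hEE, fun W hw h1 h2 => h.hPP W hw h1 h2.noP,
    fun W hw h1 h2 => by have := h.hTE W hw h1 h2; omega⟩

theorem HB.z {c : α → α → K} (hs : Sy c) {a b : K} (hab : a ≠ b) {W : Finset α} {cl : α → β} {F : ℕ}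
    (h : HB c a b W cl F) (hb : NoE c b W) : W.card ≤ 4 * F := by
  have f2 := h.f2
  have h1 := h.s1 (fun v _ => hb.mono Pt_sub)
  rcases h1.zlem hs hab hb with hz | ⟨z, hz, -, hz2⟩ | ⟨z, hz, z', hz', -, -, hz2⟩
  · omega
  · have := h1.hTE _ Pt_sub (h1.pt z hz) (h1.pe z hz)
    omega
  · omega

theorem HB.x {c : α → α → K} (hs : Sy c) {a b : K} (hab : a ≠ b) {W : Finset α} {cl : α → β} {F : ℕ}
    (h : HB c a b W cl F) (ha : NoP c a W) : W.card ≤ 7 * F := by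
  have f2 := h.f2
  by_cases hbig : ∃ v ∈ W, 2 ≤ (Pt cl W v).card
  · obtain ⟨w, hw, hw2⟩ := hbig
    have hc := h.q.card hab hw
    rw [h.q.emptyP hs ha hw hw2, Finset.card_empty] at hc
    by_cases hf : NoE c b (Pt cl W w)
    · have := h.hPP _ Pt_sub (ha.mono Pt_sub) hf.noP
      have := h.hTT _ Rd_sub (ha.mono Rd_sub).noT (h.q.F1 h.nb hw hw2)
      omega
    · have := h.hTT _ Pt_sub (h.ta w hw) (h.tb w hw)
      have := h.hPP _ Rd_sub (ha.mono Rd_sub) (h.q.F2 hs h.nb hw hf)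
      omega
  · push Not at hbig
    have := card_P_H hab hs (h.q.two_of_small hbig) ha h.nb
    omega

theorem HB.caseA {c : α → α → K} (hs : Sy c) {a b : K} (hab : a ≠ b) {V : Finset α} {cl : α → β}
    {F e : ℕ} (h : HB c a b V cl F) {v : α} (hv : v ∈ V) (hva : ¬ NoE c a (Pt cl V v))
    (hvb : ¬ NoE c b (Pt cl V v)) (pTT : (Pt cl V v).card + e ≤ 5 * F)
    (pPP : NoP c a (Pt cl V v) → NoP c b (Pt cl V v) → (Pt cl V v).card + e ≤ 2 * F) :
    V.card + e ≤ 17 * F := by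
  have hc := h.q.card hab hv
  have hR : HB c a b (Rd c a cl V v) cl F := h.mono Rd_sub
  have hB : HB c a b (Rd c b cl V v) cl F := h.mono Rd_sub
  have r7 := hR.x hs hab (h.q.F2 hs h.na hv hva)
  have b7 := hB.swap.x hs hab.symm (h.q.F2 hs h.nb hv hvb)
  by_cases h1 : NoE c a (Rd c a cl V v)
  · have := hR.swap.z hs hab.symm h1
    omega
  · by_cases h2 : NoE c b (Rd c b cl V v)
    · have := hB.z hs hab h2
      omega
    · have := pPP (h.q.F3 hs h.na hv h1) (h.q.F3 hs h.nb hv h2)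
      omega

/-- no part contains edges of both colors -/
def ND (c : α → α → K) (a b : K) (V : Finset α) (cl : α → β) : Prop :=
  ∀ v ∈ V, NoE c a (Pt cl V v) ∨ NoE c b (Pt cl V v)

theorem ND.mono {c : α → α → K} {a b : K} {V W : Finset α} {cl : α → β}
    (h : ND c a b V cl) (hw : W ⊆ V) : ND c a b W cl := fun v hv =>
  (h v (hw hv)).imp (fun h => h.mono (Pt_mono hw)) (fun h => h.mono (Pt_mono hw))

theorem ND.swap {c : α → α → K} {a b : K} {V : Finset α} {cl : α → β}
    (h : ND c a b V cl) : ND c b a V cl := fun v hv => (h v hv).symm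

theorem HB.y {c : α → α → K} (hs : Sy c) {a b : K} (hab : a ≠ b) {W : Finset α} {cl : α → β} {F : ℕ}
    (h : HB c a b W cl F) (nd : ND c a b W cl) (ha : NoP c a W) (hb : NoT c b W) :
    W.card ≤ 4 * F := by
  have f2 := h.f2
  by_cases hbig : ∃ v ∈ W, 2 ≤ (Pt cl W v).card
  · obtain ⟨w, hw, hw2⟩ := hbig
    have hc := h.q.card hab hw
    rw [h.q.emptyP hs ha hw hw2, Finset.card_empty] at hc
    rcases Finset.eq_empty_or_nonempty (Rd c b cl W w) with h0 | h0
    · rw [h0, Finset.card_empty] at hc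
      rcases nd w hw with h1 | h1
      · have := h.hET _ Pt_sub h1 (h.tb w hw)
        omega
      · have := h.hTE _ Pt_sub (h.ta w hw) h1
        omega
    · have := h.hPP _ Pt_sub (ha.mono Pt_sub) (h.q.ptE hs hb hw h0).noP
      have := h.hPP _ Rd_sub (ha.mono Rd_sub) (h.q.rdE hb hw).noP
      omega
  · push Not at hbig
    have := card_P_T hab (h.q.two_of_small hbig) ha hb
    omega

theorem HB.r_bfat {c : α → α → K} (hs : Sy c) {a b : K} (hab : a ≠ b) {W : Finset α} {cl : α → β}
    {F : ℕ} (h : HB c a b W cl F) (nd : ND c a b W cl) (ha : NoP c a W) {w : α} (hw : w ∈ W)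
    (hf : ¬ NoE c b (Pt cl W w)) : 2 * W.card ≤ 9 * F := by
  have hc := h.q.card hab hw
  rw [h.q.emptyP hs ha hw (two_of_fat hf), Finset.card_empty] at hc
  have := h.hET _ Pt_sub ((nd w hw).resolve_right hf) (h.tb w hw)
  have := h.hPP _ Rd_sub (ha.mono Rd_sub) (h.q.F2 hs h.nb hw hf)
  omega

theorem HB.r6 {c : α → α → K} (hs : Sy c) {a b : K} (hab : a ≠ b) {W : Finset α} {cl : α → β}
    {F : ℕ} (h : HB c a b W cl F) (nd : ND c a b W cl) (ha : NoP c a W) : W.card ≤ 6 * F := by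
  have f2 := h.f2
  by_cases hbig : ∃ v ∈ W, 2 ≤ (Pt cl W v).card
  · obtain ⟨w, hw, hw2⟩ := hbig
    by_cases hf : NoE c b (Pt cl W w)
    · have hc := h.q.card hab hw
      rw [h.q.emptyP hs ha hw hw2, Finset.card_empty] at hc
      have := h.hPP _ Pt_sub (ha.mono Pt_sub) hf.noP
      have := (h.mono (Rd_sub (c := c) (a := b) (cl := cl) (v := w))).y hs hab (nd.mono Rd_sub) (ha.mono Rd_sub)
        (h.q.F1 h.nb hw hw2)
      omega
    · have := h.r_bfat hs hab nd ha hw hf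
      omega
  · push Not at hbig
    have := card_P_H hab hs (h.q.two_of_small hbig) ha h.nb
    omega

/-- a part with a red edge together with its red neighborhood, without blue triangles -/
theorem HB.pr {c : α → α → K} (hs : Sy c) {a b : K} (hab : a ≠ b) {W : Finset α} {cl : α → β}
    {F : ℕ} (h : HB c a b W cl F) (nd : ND c a b W cl) (hb : NoT c b W) {w : α} (hw : w ∈ W)
    (hf : ¬ NoE c a (Pt cl W w)) : (Pt cl W w).card + (Rd c a cl W w).card ≤ 6 * F := by
  have hP := h.q.F2 hs h.na hw hf
  have hE := (nd w hw).resolve_left hf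
  by_cases h1 : NoE c a (Rd c a cl W w)
  · have := h.hET _ Rd_sub h1 (hb.mono Rd_sub)
    have := h.hTE _ Pt_sub (h.ta w hw) hE
    omega
  · have := h.hPP _ Pt_sub (h.q.F3 hs h.na hw h1) hE.noP
    have := (h.mono (Rd_sub (a := a) (v := w))).y hs hab (nd.mono Rd_sub) hP (hb.mono Rd_sub)
    omega

theorem HB.w10 {c : α → α → K} (hs : Sy c) {a b : K} (hab : a ≠ b) {W : Finset α} {cl : α → β}
    {F : ℕ} (h : HB c a b W cl F) (nd : ND c a b W cl) (hb : NoT c b W) : W.card ≤ 10 * F := by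
  have f2 := h.f2
  by_cases hbf : ∃ v ∈ W, ¬ NoE c b (Pt cl W v)
  · obtain ⟨w, hw, hf⟩ := hbf
    have hc := h.q.card hab hw
    have h0 : Rd c b cl W w = ∅ := by
      by_contra hne
      exact hf (h.q.ptE hs hb hw (Finset.nonempty_iff_ne_empty.2 hne))
    rw [h0, Finset.card_empty] at hc
    have := h.hET _ Pt_sub ((nd w hw).resolve_right hf) (h.tb w hw)
    have := h.hTT _ Rd_sub (h.q.F1 h.na hw (two_of_fat hf)) (hb.mono Rd_sub)
    omega
  · push Not at hbf
    by_cases haf : ∃ v ∈ W, ¬ NoE c a (Pt cl W v)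
    · obtain ⟨w, hw, hf⟩ := haf
      have hc := h.q.card hab hw
      have := h.pr hs hab nd hb hw hf
      have := (h.mono (Rd_sub (c := c) (a := b) (cl := cl) (v := w))).z hs hab (h.q.rdE hb hw)
      omega
    · push Not at haf
      have := side hs hab h.q h.na hb f2 (e := 0) (by omega)
        (fun v hv => h.hEE _ Pt_sub (haf v hv) (hbf v hv))
      omega

/-! ### counting parts -/

noncomputable def fc (f : α → Prop) (cl : α → β) (W : Finset α) : ℕ := ((W.filter f).image cl).card

theorem fc_mono {f : α → Prop} {cl : α → β} {W W' : Finset α} (h : W' ⊆ W) : fc f cl W' ≤ fc f cl W :=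
  Finset.card_le_card (Finset.image_subset_image (Finset.filter_subset_filter _ h))

theorem fc_pos {f : α → Prop} {cl : α → β} {W : Finset α} {v : α} (hv : v ∈ W) (hf : f v) :
    1 ≤ fc f cl W :=
  Finset.card_pos.2 ⟨cl v, Finset.mem_image_of_mem _ (Finset.mem_filter.2 ⟨hv, hf⟩)⟩

theorem Q.ne_of_rd {c : α → α → K} (hs : Sy c) {a b : K} (hab : a ≠ b) {W : Finset α} {cl : α → β}
    (h : Q c a b W cl) {v x y : α} (hv : v ∈ W) (hx : x ∈ Rd c a cl W v) (hy : y ∈ Rd c b cl W v) :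
    cl x ≠ cl y := by
  intro e
  rw [mem_Rd] at hx hy
  have := h.unif x hx.1 y hy.1 v hv e hx.2.1
  rw [hs x, hs y, hx.2.2, hy.2.2] at this
  exact hab this

theorem fc_split {c : α → α → K} (hs : Sy c) {a b : K} (hab : a ≠ b) {W : Finset α} {cl : α → β}
    (h : Q c a b W cl) {f : α → Prop} {v : α} (hv : v ∈ W) (hf : f v) :
    1 + fc f cl (Rd c a cl W v) + fc f cl (Rd c b cl W v) ≤ fc f cl W := by
  unfold fc
  rw [← Finset.card_singleton (cl v), ← Finset.card_union_of_disjoint,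
    ← Finset.card_union_of_disjoint]
  · apply Finset.card_le_card
    intro x hx
    simp only [Finset.mem_union, Finset.mem_singleton, Finset.mem_image, Finset.mem_filter] at hx ⊢
    rcases hx with (rfl | ⟨y, hy, rfl⟩) | ⟨y, hy, rfl⟩
    · exact ⟨v, ⟨hv, hf⟩, rfl⟩
    · exact ⟨y, ⟨Rd_sub hy.1, hy.2⟩, rfl⟩
    · exact ⟨y, ⟨Rd_sub hy.1, hy.2⟩, rfl⟩
  · rw [Finset.disjoint_left]
    intro x hx hx'
    simp only [Finset.mem_union, Finset.mem_singleton, Finset.mem_image, Finset.mem_filter] at hx hx'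
    obtain ⟨y', hy', rfl⟩ := hx'
    rcases hx with hx | ⟨y, hy, hx⟩
    · exact (mem_Rd.1 hy'.1).2.1 hx
    · exact h.ne_of_rd hs hab hv hy.1 hy'.1 hx
  · rw [Finset.disjoint_left]
    intro x hx hx'
    simp only [Finset.mem_singleton, Finset.mem_image, Finset.mem_filter] at hx hx'
    obtain ⟨y', hy', rfl⟩ := hx'
    exact (mem_Rd.1 hy'.1).2.1 hx

theorem HB.fc8 {c : α → α → K} (hs : Sy c) {a b : K} (hab : a ≠ b) {V : Finset α} {cl : α → β}
    {F : ℕ} (h : HB c a b V cl F) : fc (fun x => ¬ NoE c a (Pt cl V x)) cl V ≤ 8 := by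
  obtain ⟨T, hT, h2, h3⟩ := transversal cl (V.filter (fun x => ¬ NoE c a (Pt cl V x)))
  have hTV : T ⊆ V := hT.trans (Finset.filter_subset _ _)
  have hle : fc (fun x => ¬ NoE c a (Pt cl V x)) cl V ≤ T.card := by
    refine (Finset.card_le_card (t := T.image cl) ?_).trans Finset.card_image_le
    intro x hx
    obtain ⟨w, hw, rfl⟩ := Finset.mem_image.1 hx
    obtain ⟨t, ht, e⟩ := h2 w (by simp only [Finset.mem_filter] at hw ⊢; exact hw)
    exact Finset.mem_image.2 ⟨t, ht, e⟩
  have hfat : ∀ t ∈ T, ¬ NoE c a (Pt cl V t) := fun t ht => (Finset.mem_filter.1 (hT ht)).2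
  have key : ∀ x ∈ T, ∀ y ∈ T, ∀ j, Ed c j x y → y ∈ Rd c j cl V x := fun x hx y hy j e =>
    mem_Rd.2 ⟨hTV hy, fun h => e.1 (h3 y hy x hx h).symm, e.2⟩
  refine hle.trans (card_T_K4 hs hab (h.q.two hTV h3) ?_ ?_)
  · intro x hx y hy z hz e1 e2 e3
    have hP := h.q.F2 hs h.na (hTV hx) (hfat x hx)
    have hy' := key x hx y hy a e1
    have hz' := key x hx z hz a e2
    have hzy := key y hy z hz a e3
    have := hfat z hz
    unfold NoE at this
    push Not at this
    obtain ⟨p, hp, q, hq, epq⟩ := this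
    have J := h.q.jn' hs (hTV hy) a hzy y (self_Pt (hTV hy))
    have JR : ∀ p ∈ Pt cl V z, p ∈ Rd c a cl V x := by
      intro p hp
      have e := h.q.jn' hs (hTV hx) a hz' x (self_Pt (hTV hx)) p hp
      rw [mem_Pt] at hp
      exact mem_Rd.2 ⟨hp.1, by rw [hp.2]; exact (mem_Rd.1 hz').2.1, e.2⟩
    exact hP y hy' p (JR p hp) q (JR q hq) epq.1 (J p hp) (J q hq)
  · intro w hw x hx y hy z hz e1 e2 e3 e4 e5 e6
    exact h.q.k4_small hTV h3 h.nb hw hx hy hz e1 e2 e3 e4 e5 e6 (two_of_fat (hfat w hw))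

theorem HB.r5 {c : α → α → K} (hs : Sy c) {a b : K} (hab : a ≠ b) {W : Finset α} {cl : α → β}
    {F : ℕ} (h : HB c a b W cl F) (he : ∀ v ∈ W, NoE c b (Pt cl W v)) (ha : NoP c a W)
    {f : α → Prop} (hf : ∀ x ∈ W, ¬ NoE c a (Pt cl W x) → f x) :
    W.card ≤ 5 * F ∨ 3 ≤ fc f cl W := by
  have f2 := h.f2
  by_cases hbig : ∃ v ∈ W, 2 ≤ (Pt cl W v).card
  · obtain ⟨w, hw, hw2⟩ := hbig
    have hc := h.q.card hab hw
    rw [h.q.emptyP hs ha hw hw2, Finset.card_empty] at hc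
    have e1 := h.hPP _ Pt_sub (ha.mono Pt_sub) (he w hw).noP
    have hS := (h.s1 he).mono (Rd_sub (c := c) (a := b) (cl := cl) (v := w))
    rcases hS.ylem hs hab (ha.mono Rd_sub) (h.q.F1 h.nb hw hw2) with hy | ⟨y, hy, u, hu, hyf, huf, hy2⟩
    · left; omega
    · by_cases hwf : NoE c a (Pt cl W w)
      · have := h.hEE _ Pt_sub hwf (he w hw)
        left; omega
      · right
        have s1 := fc_split hs hab h.q hw (hf w hw hwf)
        have s2 := fc_split hs hab hS.q hy (hf y (Rd_sub hy) (fat_mono hyf (Pt_mono Rd_sub)))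
        have s3 := fc_pos (cl := cl) hu (hf u (Rd_sub (Rd_sub hu)) (fat_mono huf (Pt_mono Rd_sub)))
        omega
  · push Not at hbig
    have := card_P_H hab hs (h.q.two_of_small hbig) ha h.nb
    left; omega

theorem HB.b9 {c : α → α → K} (hs : Sy c) {a b : K} (hab : a ≠ b) {W : Finset α} {cl : α → β}
    {F : ℕ} (h : HB c a b W cl F) (he : ∀ v ∈ W, NoE c b (Pt cl W v)) (hb : NoT c b W)
    {f : α → Prop} (hf : ∀ x ∈ W, ¬ NoE c a (Pt cl W x) → f x) :
    W.card ≤ 9 * F ∨ 5 ≤ fc f cl W := by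
  have f2 := h.f2
  have nd : ND c a b W cl := fun v hv => Or.inr (he v hv)
  by_cases haf : ∃ v ∈ W, ¬ NoE c a (Pt cl W v)
  · obtain ⟨w, hw, hwf⟩ := haf
    have hc := h.q.card hab hw
    have h6 := h.pr hs hab nd hb hw hwf
    have hS := (h.s1 he).mono (Rd_sub (c := c) (a := a) (cl := cl) (v := w))
    have hB := (h.s1 he).mono (Rd_sub (c := c) (a := b) (cl := cl) (v := w))
    have h4 := (h.mono (Rd_sub (c := c) (a := b) (cl := cl) (v := w))).z hs hab (h.q.rdE hb hw)
    by_cases hE : NoE c a (Rd c a cl W w)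
    · have := h.hET _ Rd_sub hE (hb.mono Rd_sub)
      have := h.hTE _ Pt_sub (h.ta w hw) (he w hw)
      left; omega
    have e2 := h.hPP _ Pt_sub (h.q.F3 hs h.na hw hE) (he w hw).noP
    rcases hS.ylem hs hab (h.q.F2 hs h.na hw hwf) (hb.mono Rd_sub) with hy | ⟨y, hy, u, hu, hyf, huf, hy2⟩
    · left; omega
    rcases hB.zlem hs hab (h.q.rdE hb hw) with hz | ⟨z, hz, -, hz2⟩ | ⟨z, hz, z', hz', hzf, hzf', hz2⟩
    · left; omega
    · left
      have hu' := mem_Rd.1 hu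
      have := h.q.redTo hs hab hb h.na (Rd_sub hy) (mem_Rd.2 ⟨Rd_sub hu'.1, hu'.2⟩) (Rd_sub hz)
        (h.q.ne_of_rd hs hab hw hy hz).symm (h.q.ne_of_rd hs hab hw hu'.1 hz).symm
        (fat_mono hyf (Pt_mono Rd_sub)) (fat_mono huf (Pt_mono Rd_sub))
      have := hB.hPE _ Pt_sub (this.mono (Pt_mono Rd_sub)) (hB.pe z hz)
      omega
    · right
      have s1 := fc_split hs hab h.q hw (hf w hw hwf)
      have s2 := fc_split hs hab hS.q hy (hf y (Rd_sub hy) (fat_mono hyf (Pt_mono Rd_sub)))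
      have s3 := fc_pos (cl := cl) hu (hf u (Rd_sub (Rd_sub hu)) (fat_mono huf (Pt_mono Rd_sub)))
      have t2 := fc_split hs hab hB.q hz (hf z (Rd_sub hz) (fat_mono hzf (Pt_mono Rd_sub)))
      have t3 := fc_pos (cl := cl) hz' (hf z' (Rd_sub (Rd_sub hz')) (fat_mono hzf' (Pt_mono Rd_sub)))
      omega
  · push Not at haf
    have := side hs hab h.q h.na hb f2 (e := 0) (by omega)
      (fun v hv => h.hEE _ Pt_sub (haf v hv) (he v hv))
    left; omega

/-- some part has a red edge, some part has a blue edge, the two are joined in red -/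
theorem HB.caseB {c : α → α → K} (hs : Sy c) {a b : K} (hab : a ≠ b) {V : Finset α} {cl : α → β}
    {F e : ℕ} (h : HB c a b V cl F) (nd : ND c a b V cl)
    (pPP : ∀ v ∈ V, NoP c a (Pt cl V v) → NoP c b (Pt cl V v) → (Pt cl V v).card + e ≤ 2 * F)
    (pTE : ∀ v ∈ V, NoT c a (Pt cl V v) → NoE c b (Pt cl V v) → 2 * ((Pt cl V v).card + e) ≤ 5 * F)
    {v u : α} (hv : v ∈ V) (hva : ¬ NoE c a (Pt cl V v)) (hu : u ∈ V) (hub : ¬ NoE c b (Pt cl V u))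
    (huv : u ∈ Rd c a cl V v) : V.card + e ≤ 17 * F := by
  have f2 := h.f2
  have hc := h.q.card hab hv
  have hR : HB c a b (Rd c a cl V v) cl F := h.mono Rd_sub
  have hB : HB c a b (Rd c b cl V v) cl F := h.mono Rd_sub
  have hE := (nd v hv).resolve_left hva
  have h10 := hB.w10 hs hab (nd.mono Rd_sub) (h.q.F1 h.nb hv (two_of_fat hva))
  have hsub : Pt cl V u ⊆ Pt cl (Rd c a cl V v) u := by
    intro p hp
    have e := h.q.jn' hs hv a huv v (self_Pt hv) p hp
    rw [mem_Pt] at hp ⊢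
    exact ⟨mem_Rd.2 ⟨hp.1, by rw [hp.2]; exact (mem_Rd.1 huv).2.1, e.2⟩, hp.2⟩
  have h9 := hR.r_bfat hs hab (nd.mono Rd_sub) (h.q.F2 hs h.na hv hva) huv (fat_mono hub hsub)
  have := pTE v hv (h.ta v hv) hE
  omega

theorem HB.caseC {c : α → α → K} (hs : Sy c) {a b : K} (hab : a ≠ b) {V : Finset α} {cl : α → β}
    {F e : ℕ} (h : HB c a b V cl F) (he : ∀ v ∈ V, NoE c b (Pt cl V v))
    (pPP : ∀ v ∈ V, NoP c a (Pt cl V v) → NoP c b (Pt cl V v) → (Pt cl V v).card + e ≤ 2 * F)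
    (pTE : ∀ v ∈ V, NoT c a (Pt cl V v) → NoE c b (Pt cl V v) → 2 * ((Pt cl V v).card + e) ≤ 5 * F)
    {v : α} (hv : v ∈ V) (hva : ¬ NoE c a (Pt cl V v)) : V.card + e ≤ 17 * F := by
  have f2 := h.f2
  have nd : ND c a b V cl := fun v hv => Or.inr (he v hv)
  have hc := h.q.card hab hv
  have hR : HB c a b (Rd c a cl V v) cl F := h.mono Rd_sub
  have hB : HB c a b (Rd c b cl V v) cl F := h.mono Rd_sub
  have hBT := h.q.F1 h.nb hv (two_of_fat hva)
  have hRP := h.q.F2 hs h.na hv hva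
  have h10 := hB.w10 hs hab (nd.mono Rd_sub) hBT
  have p1 := pTE v hv (h.ta v hv) (he v hv)
  by_cases hE : NoE c a (Rd c a cl V v)
  · have := hR.swap.z hs hab.symm hE
    omega
  have p2 := pPP v hv (h.q.F3 hs h.na hv hE) (he v hv).noP
  have h6 := hR.r6 hs hab (nd.mono Rd_sub) hRP
  rcases hR.r5 hs hab (fun v hv => (he v (Rd_sub hv)).mono (Pt_mono Rd_sub)) hRP
    (f := fun x => ¬ NoE c a (Pt cl V x)) (fun x _ hf => fat_mono hf (Pt_mono Rd_sub)) with h5 | h3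
  · omega
  rcases hB.b9 hs hab (fun v hv => (he v (Rd_sub hv)).mono (Pt_mono Rd_sub)) hBT
    (f := fun x => ¬ NoE c a (Pt cl V x)) (fun x _ hf => fat_mono hf (Pt_mono Rd_sub)) with h5 | h5
  · omega
  have := fc_split hs hab h.q (f := fun x => ¬ NoE c a (Pt cl V x)) hv hva
  have := h.fc8 hs hab
  omega

theorem caseHH {c : α → α → K} (hs : Sy c) {a b : K} (hab : a ≠ b) {V : Finset α} {cl : α → β}
    {F e : ℕ} (h : HB c a b V cl F) (heF : e + 1 ≤ F)
    (pEE : ∀ v ∈ V, NoE c a (Pt cl V v) → NoE c b (Pt cl V v) → (Pt cl V v).card + e ≤ F)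
    (pPP : ∀ v ∈ V, NoP c a (Pt cl V v) → NoP c b (Pt cl V v) → (Pt cl V v).card + e ≤ 2 * F)
    (pTE : ∀ v ∈ V, NoT c a (Pt cl V v) → NoE c b (Pt cl V v) → 2 * ((Pt cl V v).card + e) ≤ 5 * F)
    (pET : ∀ v ∈ V, NoE c a (Pt cl V v) → NoT c b (Pt cl V v) → 2 * ((Pt cl V v).card + e) ≤ 5 * F)
    (pTT : ∀ v ∈ V, NoT c a (Pt cl V v) → NoT c b (Pt cl V v) → (Pt cl V v).card + e ≤ 5 * F) :
    V.card + e ≤ 17 * F := by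
  have f2 := h.f2
  by_cases hd : ∃ v ∈ V, ¬ NoE c a (Pt cl V v) ∧ ¬ NoE c b (Pt cl V v)
  · obtain ⟨v, hv, h1, h2⟩ := hd
    exact h.caseA hs hab hv h1 h2 (pTT v hv (h.ta v hv) (h.tb v hv)) (pPP v hv)
  have nd : ND c a b V cl := by
    intro v hv
    by_contra hcon
    push Not at hcon
    exact hd ⟨v, hv, hcon⟩
  by_cases hfa : ∃ v ∈ V, ¬ NoE c a (Pt cl V v)
  · obtain ⟨v, hv, hva⟩ := hfa
    by_cases hfb : ∃ v ∈ V, ¬ NoE c b (Pt cl V v)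
    · obtain ⟨u, hu, hub⟩ := hfb
      have hne : cl u ≠ cl v := by
        intro e
        have : Pt cl V u = Pt cl V v := by unfold Pt; rw [e]
        rw [this] at hub
        exact hd ⟨v, hv, hva, hub⟩
      rcases h.q.cross v hv u hu hne.symm with hc | hc
      · exact h.caseB hs hab nd pPP pTE hv hva hu hub (mem_Rd.2 ⟨hu, hne, hc⟩)
      · exact h.swap.caseB hs hab.symm nd.swap (fun v hv h1 h2 => pPP v hv h2 h1)
          (fun v hv h1 h2 => pET v hv h2 h1) hu hub hv hva
          (mem_Rd.2 ⟨hv, hne.symm, by rw [hs]; exact hc⟩)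
    · push Not at hfb
      exact h.caseC hs hab hfb pPP pTE hv hva
  · push Not at hfa
    by_cases hfb : ∃ v ∈ V, ¬ NoE c b (Pt cl V v)
    · obtain ⟨u, hu, hub⟩ := hfb
      exact h.swap.caseC hs hab.symm hfa (fun v hv h1 h2 => pPP v hv h2 h1)
          (fun v hv h1 h2 => pET v hv h2 h1) hu hub
    · push Not at hfb
      by_cases hbig : ∃ v ∈ V, 2 ≤ (Pt cl V v).card
      · obtain ⟨v, hv, hv2⟩ := hbig
        have hc := h.q.card hab hv
        have hR : HB c a b (Rd c a cl V v) cl F := h.mono Rd_sub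
        have hB : HB c a b (Rd c b cl V v) cl F := h.mono Rd_sub
        have h1 := side hs hab.symm hR.q.swap hR.nb (h.q.F1 h.na hv hv2) f2 (e := 0) (by omega)
          (fun v hv => hR.hEE _ Pt_sub ((hfa v (Rd_sub hv)).mono (Pt_mono Rd_sub))
            ((hfb v (Rd_sub hv)).mono (Pt_mono Rd_sub)))
        have h2 := side hs hab hB.q hB.na (h.q.F1 h.nb hv hv2) f2 (e := 0) (by omega)
          (fun v hv => hB.hEE _ Pt_sub ((hfa v (Rd_sub hv)).mono (Pt_mono Rd_sub))
            ((hfb v (Rd_sub hv)).mono (Pt_mono Rd_sub)))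
        have := pEE v hv (hfa v hv) (hfb v hv)
        omega
      · push Not at hbig
        have := card_H_H hs hab (h.q.two_of_small hbig) h.na h.nb
        omega
end
end GRH


namespace GRH

/-! ### Numerics -/

def tau : ℕ → ℕ
  | 0 => 1
  | 1 => 2
  | s + 2 => 5 * tau s

def N0 : ℕ → ℕ → ℕ
  | 0, s => tau s
  | 1, s => 2 * tau (s + 1)
  | 2, s => 21 * tau s
  | r + 3, s => 17 * N0 (r + 1) s

def N1 : ℕ → ℕ → ℕ
  | 0, s => 2 * tau s
  | 1, s => 4 * tau (s + 1)
  | r + 2, s => 17 * N1 r s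

def NN (w : Bool) (r s : ℕ) : ℕ := if w then N1 r s else N0 r s

theorem tau_two (s : ℕ) : tau (s + 2) = 5 * tau s := by simp [tau]

theorem tau_lin : ∀ s, 2 * tau s ≤ tau (s + 1) ∧ 2 * tau (s + 1) ≤ 5 * tau s ∧ s + 1 ≤ tau s
  | 0 => by simp [tau]
  | 1 => by simp [tau]
  | s + 2 => by
    have := tau_lin s
    simp only [tau, tau_two, show s + 2 + 1 = s + 1 + 2 from rfl]
    omega

theorem N0_two : ∀ r s, N0 r (s + 2) = 5 * N0 r s
  | 0, s => by simp [N0, tau]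
  | 1, s => by simp only [N0, tau, show s + 2 + 1 = s + 1 + 2 from rfl]; omega
  | 2, s => by simp only [N0, tau]; omega
  | r + 3, s => by have := N0_two (r + 1) s; simp only [N0]; omega

theorem N1_two : ∀ r s, N1 r (s + 2) = 5 * N1 r s
  | 0, s => by simp only [N1, tau]; omega
  | 1, s => by simp only [N1, tau, show s + 2 + 1 = s + 1 + 2 from rfl]; omega
  | r + 2, s => by have := N1_two r s; simp only [N1]; omega

theorem N0_facts : ∀ r s, 2 * N0 r s ≤ N0 r (s + 1) ∧ 2 * N0 r (s + 1) ≤ 5 * N0 r s ∧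
    17 * N0 r s ≤ N0 (r + 2) s ∧ N0 r s ≤ N1 r s ∧ N1 r s ≤ 2 * N0 r s ∧ 3 * r + s + 1 ≤ N0 r s ∧
    N0 r s + N0 r (s + 1) ≤ N0 (r + 1) s ∧ 2 * N1 r s ≤ N0 (r + 1) s ∧
    8 * N0 r s ≤ N0 (r + 1) (s + 1) ∧ 5 * N1 r s ≤ N0 (r + 1) (s + 1) ∧
    3 * N1 r s + 3 * N0 r s ≤ N0 (r + 1) (s + 1) ∧
    4 * N1 r s + 9 * N0 r s ≤ 2 * N0 (r + 1) (s + 1)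
  | 0, s => by
    have := tau_lin s
    have := tau_two s
    simp only [N0, N1, zero_add, show s + 1 + 1 = s + 2 from rfl]
    omega
  | 1, s => by
    have := tau_lin s
    have := tau_two s
    have := tau_two (s + 1)
    simp only [N0, N1, Nat.reduceAdd, zero_add, show s + 1 + 1 = s + 2 from rfl,
      show s + 2 + 1 = s + 1 + 2 from rfl] at *
    omega
  | 2, s => by
    have := tau_lin s
    have := tau_two s
    have := tau_two (s + 1)
    simp only [N0, N1, Nat.reduceAdd, zero_add, show s + 1 + 1 = s + 2 from rfl,
      show 2 + 2 = 1 + 3 from rfl, show 2 + 1 = 0 + 3 from rfl,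
      show s + 2 + 1 = s + 1 + 2 from rfl] at *
    omega
  | r + 3, s => by
    have h := N0_facts (r + 1) s
    simp only [show r + 3 + 2 = (r + 2) + 3 from rfl, show r + 3 + 1 = r + 1 + 3 from rfl, N0,
      show N1 (r + 3) s = 17 * N1 (r + 1) s from rfl] at h ⊢
    simp only [show r + 1 + 2 = r + 3 from rfl, show r + 1 + 1 = r + 2 from rfl,
      show r + 2 + 1 = r + 3 from rfl, N0] at h ⊢
    omega

theorem N1_facts : ∀ r s, 2 * N1 r s ≤ N1 r (s + 1) ∧ 2 * N1 r (s + 1) ≤ 5 * N1 r s ∧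
    3 * r + s + 2 ≤ N1 r s ∧
    N1 r s + N1 r (s + 1) ≤ N1 (r + 1) s ∧ 2 * N1 r s ≤ N1 (r + 1) s ∧
    8 * N1 r s ≤ N1 (r + 1) (s + 1)
  | 0, s => by
    have := tau_lin s
    have := tau_two s
    simp only [N1, zero_add, show s + 1 + 1 = s + 2 from rfl]
    omega
  | 1, s => by
    have := tau_lin s
    have h2 := tau_two s
    have h3 := tau_two (s + 1)
    have e1 : ∀ t, N1 1 t = 4 * tau (t + 1) := fun t => by simp only [N1]
    have e2 : ∀ t, N1 (1 + 1) t = 17 * (2 * tau t) := fun t => by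
      rw [show 1 + 1 = 0 + 2 from rfl]; simp only [N1]
    simp only [e1, e2]
    simp only [show s + 1 + 1 = s + 2 from rfl, show s + 1 + 2 = s + 2 + 1 from rfl] at *
    omega
  | r + 2, s => by
    have h := N1_facts r s
    simp only [show r + 2 + 1 = r + 1 + 2 from rfl, N1] at h ⊢
    omega

theorem NN_mono_w (w : Bool) (r s : ℕ) : NN w r s ≤ NN true r s ∧ NN true r s ≤ 2 * NN w r s := by
  have h := N0_facts r s
  cases w <;> simp [NN] <;> omega

theorem NN_two (w : Bool) (r s : ℕ) : NN w r (s + 2) = 5 * NN w r s := by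
  cases w <;> simp [NN, N0_two, N1_two]

theorem NN_s (w : Bool) (r s : ℕ) : 2 * NN w r s ≤ NN w r (s + 1) ∧
    2 * NN w r (s + 1) ≤ 5 * NN w r s := by
  have h := N0_facts r s
  have h' := N1_facts r s
  cases w <;> simp [NN] <;> omega

theorem NN_17 (w : Bool) (r s : ℕ) : 17 * NN w r s ≤ NN w (r + 2) s := by
  have h := N0_facts r s
  cases w
  · simp [NN]; omega
  · simp [NN, N1]

theorem NN_small (w : Bool) (r s : ℕ) : 3 * r + s + 1 + (if w then 1 else 0) ≤ NN w r s := by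
  have h := N0_facts r s
  have h' := N1_facts r s
  cases w <;> simp [NN] <;> omega

theorem NN_join (w : Bool) (r s : ℕ) : NN w r s + NN w r (s + 1) ≤ NN w (r + 1) s ∧
    2 * NN true r s ≤ NN w (r + 1) s := by
  have h := N0_facts r s
  have h' := N1_facts r s
  cases w <;> simp [NN] <;> omega

theorem NN_HT (w : Bool) (r s : ℕ) : 8 * NN w r s ≤ NN w (r + 1) (s + 1) ∧
    5 * NN true r s ≤ NN w (r + 1) (s + 1) ∧
    3 * NN true r s + 3 * NN w r s ≤ NN w (r + 1) (s + 1) ∧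
    4 * NN true r s + 9 * NN w r s ≤ 2 * NN w (r + 1) (s + 1) := by
  have h := N0_facts r s
  have h' := N1_facts r s
  cases w <;> simp [NN] <;> omega

theorem NN_big (w : Bool) (r s : ℕ) (h : ¬ (w = false ∧ r = 0 ∧ s = 0)) : 2 ≤ NN w r s := by
  have := NN_small w r s
  cases w
  · simp at *; omega
  · simp at *; omega

theorem NN_odd : ∀ j, NN false (2 * j + 1) 0 = 4 * 17 ^ j
  | 0 => by simp [NN, N0, tau]
  | j + 1 => by
    have := NN_odd j
    simp only [NN, Bool.false_eq_true, if_false] at this ⊢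
    rw [show 2 * (j + 1) + 1 = 2 * j + 3 by ring]
    simp only [N0]
    rw [this, pow_succ]; ring

theorem NN_even : ∀ j, NN false (2 * j + 2) 0 = 21 * 17 ^ j
  | 0 => by simp [NN, N0, tau]
  | j + 1 => by
    have := NN_even j
    simp only [NN, Bool.false_eq_true, if_false] at this ⊢
    rw [show 2 * (j + 1) + 2 = 2 * j + 1 + 3 by ring]
    simp only [N0]
    rw [show 2 * j + 1 + 1 = 2 * j + 2 from rfl, this, pow_succ]; ring

end GRH


namespace GRH
section
open scoped Classical

variable {α K β : Type}

/-! ### States -/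

inductive St | H | T | P | E

def OkS (c : α → α → K) (a : K) (W : Finset α) : St → Prop
  | .H => NoH c a W
  | .T => NoT c a W
  | .P => NoP c a W
  | .E => NoE c a W

theorem OkS.mono {c : α → α → K} {a : K} {W W' : Finset α} {t : St} (h : OkS c a W t) (hw : W' ⊆ W) :
    OkS c a W' t := by
  cases t
  · exact NoH.mono h hw
  · exact NoT.mono h hw
  · exact NoP.mono h hw
  · exact NoE.mono h hw

def Ok (c : α → α → K) (σ : K → St) (W : Finset α) : Prop := ∀ a, OkS c a W (σ a)

theorem Ok.mono {c : α → α → K} {σ : K → St} {W W' : Finset α} (h : Ok c σ W) (hw : W' ⊆ W) :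
    Ok c σ W' := fun a => (h a).mono hw

theorem Ok.update {c : α → α → K} {σ : K → St} {W : Finset α} (h : Ok c σ W) {a : K} {t : St}
    (ha : OkS c a W t) : Ok c (Function.update σ a t) W := by
  intro j
  by_cases e : j = a
  · subst e; simpa using ha
  · simpa [Function.update_of_ne e] using h j

noncomputable def cnt [Fintype K] (σ : K → St) (t : St) : ℕ :=
  (Finset.univ.filter (fun a => σ a = t)).card

theorem cnt_update [Fintype K] (σ : K → St) (a : K) (t x : St) :
    cnt (Function.update σ a t) x + (if σ a = x then 1 else 0) =
      cnt σ x + (if t = x then 1 else 0) := by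
  have key : ∀ σ : K → St, cnt σ x =
      ((Finset.univ.erase a).filter (fun j => σ j = x)).card + (if σ a = x then 1 else 0) := by
    intro σ
    unfold cnt
    conv_lhs => rw [← Finset.insert_erase (Finset.mem_univ a)]
    rw [Finset.filter_insert]
    split_ifs with h
    · rw [Finset.card_insert_of_notMem (by simp)]
    · simp
  rw [key σ, key (Function.update σ a t)]
  have : (Finset.univ.erase a).filter (fun j => Function.update σ a t j = x) =
      (Finset.univ.erase a).filter (fun j => σ j = x) := by
    apply Finset.filter_congr
    intro j hj
    rw [Function.update_of_ne (Finset.ne_of_mem_erase hj)]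
  rw [this]
  simp
  omega

def WB (σ : K → St) (w : Bool) : Prop := (∃ a, σ a = St.P) → w = true

theorem WB.up {σ : K → St} {w : Bool} (h : WB σ w) {a : K} {t : St} (ht : t ≠ St.P) :
    WB (Function.update σ a t) w := by
  rintro ⟨j, hj⟩
  by_cases e : j = a
  · subst e; simp at hj; exact absurd hj ht
  · rw [Function.update_of_ne e] at hj; exact h ⟨j, hj⟩

theorem WB.tr {σ : K → St} : WB σ true := fun _ => rfl

/-- induction hypothesis -/
def IH [Fintype K] (c : α → α → K) (m : ℕ) : Prop := ∀ (σ : K → St) (V : Finset α) (w : Bool),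
  2 * cnt σ St.H + cnt σ St.T < m → WB σ w → Ok c σ V → V.card ≤ NN w (cnt σ St.H) (cnt σ St.T)

theorem IH.one [Fintype K] {c : α → α → K} {m : ℕ} (ih : IH c m) {σ : K → St} {a : K} {t : St}
    {w : Bool} {W : Finset α} (ok : Ok c σ W) (ha : OkS c a W t) (hw : WB (Function.update σ a t) w)
    {r s : ℕ} (hm : 2 * r + s < m)
    (hr : r + (if σ a = St.H then 1 else 0) = cnt σ St.H + (if t = St.H then 1 else 0))
    (hs : s + (if σ a = St.T then 1 else 0) = cnt σ St.T + (if t = St.T then 1 else 0)) :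
    W.card ≤ NN w r s := by
  have h1 := cnt_update σ a t St.H
  have h2 := cnt_update σ a t St.T
  have e1 : cnt (Function.update σ a t) St.H = r := by omega
  have e2 : cnt (Function.update σ a t) St.T = s := by omega
  have := ih _ W w (by rw [e1, e2]; exact hm) hw (ok.update ha)
  rwa [e1, e2] at this

theorem IH.two [Fintype K] {c : α → α → K} {m : ℕ} (ih : IH c m) {σ : K → St} {a b : K} (hab : a ≠ b)
    {t u : St} {w : Bool} {W : Finset α} (ok : Ok c σ W) (ha : OkS c a W t) (hb : OkS c b W u)
    (hw : WB (Function.update (Function.update σ a t) b u) w)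
    {r s : ℕ} (hm : 2 * r + s < m)
    (hr : r + (if σ a = St.H then 1 else 0) + (if σ b = St.H then 1 else 0) =
      cnt σ St.H + (if t = St.H then 1 else 0) + (if u = St.H then 1 else 0))
    (hs : s + (if σ a = St.T then 1 else 0) + (if σ b = St.T then 1 else 0) =
      cnt σ St.T + (if t = St.T then 1 else 0) + (if u = St.T then 1 else 0)) :
    W.card ≤ NN w r s := by
  have h1 := cnt_update σ a t St.H
  have h2 := cnt_update σ a t St.T
  have e : Function.update σ a t b = σ b := Function.update_of_ne hab.symm _ _
  refine ih.one (ok.update ha) hb hw hm ?_ ?_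
  · rw [e]; omega
  · rw [e]; omega

/-! ### Confined colors -/

def Conf (c : α → α → K) (j : K) (X X' : Finset α) : Prop :=
  ∀ x ∈ X', ∀ y ∈ X', Ed c j x y → x ∈ X ∧ y ∈ X

theorem Conf.noE {c : α → α → K} {j : K} {X X' : Finset α} (h : Conf c j X X') (hx : NoE c j X) :
    NoE c j X' := fun x hx' y hy' e => hx x (h x hx' y hy' e).1 y (h x hx' y hy' e).2 e

theorem Conf.noP {c : α → α → K} {j : K} {X X' : Finset α} (h : Conf c j X X') (hx : NoP c j X) :
    NoP c j X' := fun x hx' y hy' z hz' n e f =>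
  hx x (h x hx' y hy' e).1 y (h x hx' y hy' e).2 z (h x hx' z hz' f).2 n e f

theorem Conf.noT {c : α → α → K} {j : K} {X X' : Finset α} (h : Conf c j X X') (hx : NoT c j X) :
    NoT c j X' := fun x hx' y hy' z hz' e f g =>
  hx x (h x hx' y hy' e).1 y (h x hx' y hy' e).2 z (h x hx' z hz' f).2 e f g

theorem Conf.ok {c : α → α → K} {j : K} {X X' : Finset α} (h : Conf c j X X') {t : St}
    (ht : t ≠ St.H) (hx : OkS c j X t) : OkS c j X' t := by
  cases t
  · exact absurd rfl ht
  · exact h.noT hx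
  · exact h.noP hx
  · exact h.noE hx

/-- the join lemma -/
theorem join [Fintype K] {c : α → α → K} (hs : Sy c) {σ : K → St} {V : Finset α} {w : Bool}
    (ih : IH c (2 * cnt σ St.H + cnt σ St.T)) (ok : Ok c σ V) (hw : WB σ w) {j : K}
    {X X' Y : Finset α} (hV : V = X' ∪ Y) (hX : X ⊆ X') (hc : Conf c j X X') (hj : Jn c j X Y)
    (hX2 : 2 ≤ X.card) (hY2 : 2 ≤ Y.card) : V.card ≤ NN w (cnt σ St.H) (cnt σ St.T) := by
  have hX'V : X' ⊆ V := by rw [hV]; exact Finset.subset_union_left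
  have hYV : Y ⊆ V := by rw [hV]; exact Finset.subset_union_right
  have hXV := hX.trans hX'V
  have hle : V.card ≤ X'.card + Y.card := by rw [hV]; exact Finset.card_union_le _ _
  have hXne : X.Nonempty := Finset.card_pos.1 (by omega)
  have hYne : Y.Nonempty := Finset.card_pos.1 (by omega)
  have okj := ok j
  have okX := ok.mono hX'V
  have okY := ok.mono hYV
  have hpos : 1 ≤ cnt σ (σ j) := Finset.card_pos.2 ⟨j, by simp⟩
  cases hσ : σ j with
  | E =>
    rw [hσ] at okj
    have := hj.empty_of_noE okj hXV hYV hXne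
    simp [this] at hY2
  | P =>
    rw [hσ] at okj
    have := hj.empty_of_noP hs okj hXV hYV hX2
    simp [this] at hY2
  | T =>
    rw [hσ] at okj hpos
    obtain ⟨s, es⟩ : ∃ s, cnt σ St.T = s + 1 := ⟨cnt σ St.T - 1, by omega⟩
    have h1 : NoE c j Y := hj.noE okj hXV hYV hXne
    have h2 : NoE c j X' := hc.noE ((hj.symm hs).noE okj hYV hXV hYne)
    have b1 : Y.card ≤ NN w (cnt σ St.H) s := ih.one (t := St.E) okY h1 (hw.up (by simp))
      (by omega) (by simp [hσ]) (by simp [hσ, es])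
    have b2 : X'.card ≤ NN w (cnt σ St.H) s := ih.one (t := St.E) okX h2 (hw.up (by simp))
      (by omega) (by simp [hσ]) (by simp [hσ, es])
    have := NN_s w (cnt σ St.H) s
    rw [es]; omega
  | H =>
    rw [hσ] at okj hpos
    obtain ⟨r, er⟩ : ∃ r, cnt σ St.H = r + 1 := ⟨cnt σ St.H - 1, by omega⟩
    have nj := NN_join w r (cnt σ St.T)
    have lE : ∀ Z, Ok c σ Z → NoE c j Z → Z.card ≤ NN w r (cnt σ St.T) := fun Z hZ h1 =>
      ih.one (t := St.E) hZ h1 (hw.up (by simp)) (by omega) (by simp [hσ, er]) (by simp [hσ])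
    have lP : ∀ Z, Ok c σ Z → NoP c j Z → Z.card ≤ NN true r (cnt σ St.T) := fun Z hZ h1 =>
      ih.one (t := St.P) hZ h1 WB.tr (by omega) (by simp [hσ, er]) (by simp [hσ])
    have lT : ∀ Z, Ok c σ Z → NoT c j Z → Z.card ≤ NN w r (cnt σ St.T + 1) := fun Z hZ h1 =>
      ih.one (t := St.T) hZ h1 (hw.up (by simp)) (by omega) (by simp [hσ, er]) (by simp [hσ])
    have tX : NoT c j X' := hc.noT ((hj.symm hs).noT okj hYV hXV hY2)
    have tY : NoT c j Y := hj.noT okj hXV hYV hX2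
    by_cases eX : NoE c j X
    · have := lE X' okX (hc.noE eX)
      have := lT Y okY tY
      rw [er]; omega
    by_cases eY : NoE c j Y
    · have := lT X' okX tX
      have := lE Y okY eY
      rw [er]; omega
    have := lP Y okY (hj.noP hs okj hXV hYV eX)
    have := lP X' okX (hc.noP ((hj.symm hs).noP hs okj hYV hXV eY))
    rw [er]; omega

/-! ### Peeling -/

structure Peel (c : α → α → K) (V A : Finset α) (κ : α → K) : Prop where
  sub : A ⊆ V
  ne : A.Nonempty
  up : ∀ l ∈ V, l ∉ A → ∀ a ∈ A, c l a = κ l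
  out : ∀ l ∈ V, l ∉ A → ∀ l' ∈ V, l' ∉ A → l ≠ l' → c l l' = κ l ∨ c l l' = κ l'

theorem exists_peel {c : α → α → K} (hs : Sy c) (V : Finset α) (κ : α → K) (hV : V.Nonempty) :
    ∃ A κ, Peel c V A κ ∧ (A.card = 1 ∨ ∀ x ∈ A, ∀ j, ¬ ∀ y ∈ A, y ≠ x → c x y = j) := by
  have main : ∀ n A κ, A.card = n → Peel c V A κ →
      ∃ A κ, Peel c V A κ ∧ (A.card = 1 ∨ ∀ x ∈ A, ∀ j, ¬ ∀ y ∈ A, y ≠ x → c x y = j) := by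
    intro n
    induction n with
    | zero =>
      intro A κ hA hp
      have := Finset.card_pos.2 hp.ne
      omega
    | succ n ih =>
      intro A κ hA hp
      by_cases h1 : A.card = 1
      · exact ⟨A, κ, hp, Or.inl h1⟩
      by_cases h2 : ∀ x ∈ A, ∀ j, ¬ ∀ y ∈ A, y ≠ x → c x y = j
      · exact ⟨A, κ, hp, Or.inr h2⟩
      push Not at h2
      obtain ⟨x, hx, j, hxj⟩ := h2
      have hcard := Finset.card_erase_of_mem hx
      refine ih (A.erase x) (Function.update κ x j) (by omega) ⟨?_, ?_, ?_, ?_⟩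
      · exact (Finset.erase_subset _ _).trans hp.sub
      · exact Finset.card_pos.1 (by omega)
      · intro l hl hlA a ha
        rw [Finset.mem_erase] at ha hlA
        by_cases e : l = x
        · subst e; simp; exact hxj a ha.2 ha.1
        · rw [Function.update_of_ne e]
          exact hp.up l hl (fun h => hlA ⟨e, h⟩) a ha.2
      · intro l hl hlA l' hl' hlA' hne
        rw [Finset.mem_erase] at hlA' hlA
        by_cases e : l = x
        · subst e
          have e' : l' ≠ l := hne.symm
          right
          rw [Function.update_of_ne e', hs]
          exact hp.up l' hl' (fun h => hlA' ⟨e', h⟩) l hx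
        · rw [Function.update_of_ne e]
          have hla : l ∉ A := fun h => hlA ⟨e, h⟩
          by_cases e' : l' = x
          · subst e'
            left
            exact hp.up l hl hla l' hx
          · rw [Function.update_of_ne e']
            exact hp.out l hl hla l' hl' (fun h => hlA' ⟨e', h⟩) hne
  exact main _ V κ rfl ⟨subset_rfl, hV, fun l hl h => absurd hl h, fun l hl h => absurd hl h⟩

/-- everything peeled -/
theorem peel_small [Fintype K] {c : α → α → K} (hs : Sy c) {σ : K → St} {V A : Finset α} {κ : α → K}
    {w : Bool} (ok : Ok c σ V) (hw : WB σ w) (hp : Peel c V A κ) (hA : A.card = 1) :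
    V.card ≤ NN w (cnt σ St.H) (cnt σ St.T) := by
  obtain ⟨x, rfl⟩ := Finset.card_eq_one.1 hA
  have hx : x ∈ V := hp.sub (by simp)
  have hup : ∀ l ∈ V.erase x, Ed c (κ l) l x := fun l hl => by
    rw [Finset.mem_erase] at hl
    exact ⟨hl.1, hp.up l hl.2 (by simpa using hl.1) x (by simp)⟩
  have hout : ∀ l ∈ V.erase x, ∀ l' ∈ V.erase x, l ≠ l' → c l l' = κ l ∨ c l l' = κ l' :=
    fun l hl l' hl' n => by
      rw [Finset.mem_erase] at hl hl'
      exact hp.out l hl.2 (by simpa using hl.1) l' hl'.2 (by simpa using hl'.1) n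
  have hsame : ∀ l ∈ V.erase x, ∀ l' ∈ V.erase x, l ≠ l' → κ l = κ l' → Ed c (κ l) l l' :=
    fun l hl l' hl' n e => ⟨n, by
      rcases hout l hl l' hl' n with h | h
      · exact h
      · rw [h, e]⟩
  have hsub : V.erase x ⊆ V := Finset.erase_subset _ _
  let L := fun t => (V.erase x).filter (fun l => σ (κ l) = t)
  have hL : V.erase x ⊆ L St.H ∪ L St.T ∪ L St.P := by
    intro l hl
    simp only [L, Finset.mem_union, Finset.mem_filter]
    have hok := ok (κ l)
    cases hσ : σ (κ l) with
    | E => rw [hσ] at hok; exact absurd (hup l hl) (hok l (hsub hl) x hx)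
    | _ => simp [hl]
  have bH : (L St.H).card ≤ 3 * cnt σ St.H := by
    refine Finset.card_le_mul_card_image_of_maps_to (f := κ) (by simp [L]) 3 ?_
    intro j hj
    by_contra hcon
    obtain ⟨p, hp', q, hq, r, hr, y, hy, n1, n2, n3, n4, n5, n6⟩ := exists4 (by omega :
      4 ≤ ((L St.H).filter (fun l => κ l = j)).card)
    simp only [L, Finset.mem_filter] at hp' hq hr hy
    have hok := ok j
    rw [← hp'.2, hp'.1.2] at hok
    have E : ∀ l ∈ V.erase x, ∀ l' ∈ V.erase x, κ l = j → κ l' = j → l ≠ l' → Ed c (κ p) l l' :=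
      fun l hl l' hl' e e' n => by
        have := hsame l hl l' hl' n (e.trans e'.symm)
        rwa [e, ← hp'.2] at this
    have Ex : ∀ l ∈ V.erase x, κ l = j → Ed c (κ p) l x := fun l hl e => by
      have := hup l hl
      rwa [e, ← hp'.2] at this
    have h1 := hp'.1.1
    have h2 := hq.1.1
    have h3 := hr.1.1
    have h4 := hy.1.1
    have k1 := hp'.2
    have k2 := hq.2
    have k3 := hr.2
    have k4 := hy.2
    exact hok x hx y (hsub h4) p (hsub h1) q (hsub h2) r (hsub h3) (Ex y h4 k4).1.symm
      (E p h1 q h2 k1 k2 (by tauto)) (E p h1 r h3 k1 k3 (by tauto)) (E q h2 r h3 k2 k3 (by tauto))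
      ((Ex p h1 k1).symm hs) ((Ex q h2 k2).symm hs) ((Ex r h3 k3).symm hs)
      (E y h4 p h1 k4 k1 (by tauto)) (E y h4 q h2 k4 k2 (by tauto)) (E y h4 r h3 k4 k3 (by tauto))
  have bT : (L St.T).card ≤ 1 * cnt σ St.T := by
    refine Finset.card_le_mul_card_image_of_maps_to (f := κ) (by simp [L]) 1 ?_
    intro j hj
    by_contra hcon
    obtain ⟨p, hp', q, hq, n1⟩ := exists2 (by omega :
      2 ≤ ((L St.T).filter (fun l => κ l = j)).card)
    simp only [L, Finset.mem_filter] at hp' hq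
    have hok := ok j
    rw [← hp'.2, hp'.1.2] at hok
    have e : κ p = κ q := hp'.2.trans hq.2.symm
    have := hup q hq.1.1
    rw [← e] at this
    exact hok p (hsub hp'.1.1) q (hsub hq.1.1) x hx (hsame p hp'.1.1 q hq.1.1 n1 e) (hup p hp'.1.1)
      this
  have bP : (L St.P).card ≤ if w then 1 else 0 := by
    split_ifs with h
    · rw [Finset.card_le_one]
      intro p hp' q hq
      by_contra n
      simp only [L, Finset.mem_filter] at hp' hq
      have o1 := ok (κ p)
      have o2 := ok (κ q)
      rw [hp'.2] at o1
      rw [hq.2] at o2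
      rcases hout p hp'.1 q hq.1 n with h | h
      · exact o1 p (hsub hp'.1) q (hsub hq.1) x hx (hup q hq.1).1 ⟨n, h⟩ (hup p hp'.1)
      · exact o2 q (hsub hq.1) p (hsub hp'.1) x hx (hup p hp'.1).1
          ⟨Ne.symm n, by rw [hs]; exact h⟩ (hup q hq.1)
    · have : L St.P = ∅ := by
        by_contra hne
        obtain ⟨l, hl⟩ := Finset.nonempty_iff_ne_empty.2 hne
        exact h (hw ⟨κ l, (Finset.mem_filter.1 hl).2⟩)
      simp [this]
  have h1 := Finset.card_le_card hL
  have h2 := Finset.card_union_le (L St.H ∪ L St.T) (L St.P)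
  have h3 := Finset.card_union_le (L St.H) (L St.T)
  have h4 := Finset.card_erase_of_mem hx
  have h5 := NN_small w (cnt σ St.H) (cnt σ St.T)
  omega

end
end GRH


namespace GRH
section
open scoped Classical

variable {α K β : Type}

/-- The outcome of the Gallai decomposition when no join is available. -/
structure NJ (c : α → α → K) (a b : K) (V V1 L : Finset α) (cl : α → β) : Prop where
  cov : V = V1 ∪ L
  dj : Disjoint V1 L
  q : Q c a b V1 cl
  ne : V1.Nonempty
  big : ∀ v ∈ V1, 2 ≤ (Pt cl V1 v).card →
    2 ≤ (Rd c a cl V1 v).card ∧ 2 ≤ (Rd c b cl V1 v).card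
  ca : ∀ v ∈ V1, 2 ≤ (Pt cl V1 v).card → Conf c a (Pt cl V1 v) (Pt cl V1 v ∪ L)
  cb : ∀ v ∈ V1, 2 ≤ (Pt cl V1 v).card → Conf c b (Pt cl V1 v) (Pt cl V1 v ∪ L)
  le : ∃ x ∈ V, x ∉ L ∧ NoE c a (insert x L) ∧ NoE c b (insert x L)

theorem NJ.swap {c : α → α → K} {a b : K} {V V1 L : Finset α} {cl : α → β}
    (h : NJ c a b V V1 L cl) : NJ c b a V V1 L cl :=
  ⟨h.cov, h.dj, h.q.swap, h.ne, fun v hv h2 => (h.big v hv h2).symm, h.cb, h.ca, by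
    obtain ⟨x, h1, h2, h3, h4⟩ := h.le
    exact ⟨x, h1, h2, h4, h3⟩⟩

theorem NJ.sub1 {c : α → α → K} {a b : K} {V V1 L : Finset α} {cl : α → β}
    (h : NJ c a b V V1 L cl) : V1 ⊆ V := by rw [h.cov]; exact Finset.subset_union_left
theorem NJ.subL {c : α → α → K} {a b : K} {V V1 L : Finset α} {cl : α → β}
    (h : NJ c a b V V1 L cl) : L ⊆ V := by rw [h.cov]; exact Finset.subset_union_right

theorem NJ.leF {c : α → α → K} {a b : K} {V V1 L : Finset α} {cl : α → β}
    (h : NJ c a b V V1 L cl) {F : ℕ} (hF : ∀ W ⊆ V, NoE c a W → NoE c b W → W.card ≤ F) :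
    L.card + 1 ≤ F := by
  obtain ⟨x, h1, h2, h3, h4⟩ := h.le
  have := hF _ (Finset.insert_subset h1 h.subL) h3 h4
  rwa [Finset.card_insert_of_notMem h2] at this

theorem NJ.part {c : α → α → K} {a b : K} {V V1 L : Finset α} {cl : α → β}
    (h : NJ c a b V V1 L cl) {t u : St} (ht : t ≠ St.H) (hu : u ≠ St.H) {G : ℕ}
    (hG : ∀ W ⊆ V, OkS c a W t → OkS c b W u → W.card ≤ G) (hL : L.card + 1 ≤ G)
    {v : α} (hv : v ∈ V1) (h1 : OkS c a (Pt cl V1 v) t) (h2 : OkS c b (Pt cl V1 v) u) :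
    (Pt cl V1 v).card + L.card ≤ G := by
  by_cases hb : 2 ≤ (Pt cl V1 v).card
  · rw [← Finset.card_union_of_disjoint (h.dj.mono_left Pt_sub)]
    exact hG _ (Finset.union_subset (Pt_sub.trans h.sub1) h.subL) ((h.ca v hv hb).ok ht h1)
      ((h.cb v hv hb).ok hu h2)
  · omega

theorem cnt_uniq [Fintype K] {σ : K → St} {t : St} {a : K} (h : cnt σ t = 1) (ha : σ a = t) :
    ∀ j, σ j = t → j = a := by
  intro j hj
  exact Finset.card_le_one.1 h.le j (by simp [hj]) a (by simp [ha])

theorem NJ.tt [Fintype K] {c : α → α → K} (hs : Sy c) {σ : K → St} {V V1 L : Finset α} {w : Bool}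
    (ih : IH c (2 * cnt σ St.H + cnt σ St.T)) (ok : Ok c σ V) (hw : WB σ w) {a b : K} (hab : a ≠ b)
    {cl : α → β} (h : NJ c a b V V1 L cl) (ha : σ a = St.T) (hb : σ b = St.T) :
    V.card ≤ NN w (cnt σ St.H) (cnt σ St.T) := by
  have oa := ok a
  have ob := ok b
  rw [ha] at oa
  rw [hb] at ob
  have h2 : 2 ≤ cnt σ St.T := by
    have : ({a, b} : Finset K).card ≤ cnt σ St.T := Finset.card_le_card (by
      intro j hj
      simp only [Finset.mem_insert, Finset.mem_singleton] at hj
      rcases hj with rfl | rfl <;> simp [ha, hb])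
    rwa [Finset.card_pair hab] at this
  obtain ⟨s, es⟩ : ∃ s, cnt σ St.T = s + 2 := ⟨cnt σ St.T - 2, by omega⟩
  have hF : ∀ W ⊆ V, NoE c a W → NoE c b W → W.card ≤ NN w (cnt σ St.H) s := fun W hW h1 h2 =>
    ih.two hab (t := St.E) (u := St.E) (ok.mono hW) h1 h2 ((hw.up (by simp)).up (by simp)) (by omega)
      (by simp [ha, hb]) (by simp [ha, hb, es])
  have hle := h.leF hF
  have := caseTT hab h.q (NoT.mono oa h.sub1) (NoT.mono ob h.sub1) (e := L.card) h.ne (fun v hv => by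
    refine h.part (t := St.E) (u := St.E) (by simp) (by simp) hF hle hv ?_ ?_
    · by_cases hb : 2 ≤ (Pt cl V1 v).card
      · have := (h.big v hv hb).1
        exact ((h.q.jn hv a).symm hs).noE oa (Rd_sub.trans h.sub1) (Pt_sub.trans h.sub1)
          (Finset.card_pos.1 (by omega))
      · exact noE_single (by omega)
    · by_cases hb : 2 ≤ (Pt cl V1 v).card
      · have := (h.big v hv hb).2
        exact ((h.q.jn hv b).symm hs).noE ob (Rd_sub.trans h.sub1) (Pt_sub.trans h.sub1)
          (Finset.card_pos.1 (by omega))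
      · exact noE_single (by omega))
  have hc : V.card = V1.card + L.card := by
    rw [← Finset.card_union_of_disjoint h.dj, ← h.cov]
  rw [es, NN_two]
  omega

theorem NJ.ht [Fintype K] {c : α → α → K} (hs : Sy c) {σ : K → St} {V V1 L : Finset α} {w : Bool}
    (ih : IH c (2 * cnt σ St.H + cnt σ St.T)) (ok : Ok c σ V) (hw : WB σ w) {a b : K} (hab : a ≠ b)
    {cl : α → β} (h : NJ c a b V V1 L cl) (ha : σ a = St.H) (hb : σ b = St.T) :
    V.card ≤ NN w (cnt σ St.H) (cnt σ St.T) := by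
  have oa := ok a
  have ob := ok b
  rw [ha] at oa
  rw [hb] at ob
  have p1 : 1 ≤ cnt σ St.H := Finset.card_pos.2 ⟨a, by simp [ha]⟩
  have p2 : 1 ≤ cnt σ St.T := Finset.card_pos.2 ⟨b, by simp [hb]⟩
  obtain ⟨r, er⟩ : ∃ r, cnt σ St.H = r + 1 := ⟨cnt σ St.H - 1, by omega⟩
  obtain ⟨s, es⟩ : ∃ s, cnt σ St.T = s + 1 := ⟨cnt σ St.T - 1, by omega⟩
  by_cases hsp : w = false ∧ r = 0 ∧ s = 0
  · obtain ⟨rfl, rfl, rfl⟩ := hsp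
    have u1 := cnt_uniq (by omega) ha
    have u2 := cnt_uniq (by omega) hb
    have : V.card ≤ 10 := by
      refine card_H_T hs hab ?_ oa ob
      intro u hu v hv n
      have oj := ok (c u v)
      cases hj : σ (c u v) with
      | H => exact Or.inl (u1 _ hj)
      | T => exact Or.inr (u2 _ hj)
      | P => exact absurd (hw ⟨_, hj⟩) (by simp)
      | E => rw [hj] at oj; exact absurd ⟨n, rfl⟩ (oj u hu v hv)
    rw [er, es]
    simpa [NN, N0, tau] using this
  have f2 := NN_big w r s hsp
  have lEE : ∀ W ⊆ V, NoE c a W → NoE c b W → W.card ≤ NN w r s := fun W hW h1 h2 =>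
    ih.two hab (t := St.E) (u := St.E) (ok.mono hW) h1 h2 ((hw.up (by simp)).up (by simp)) (by omega)
      (by simp [ha, hb, er]) (by simp [ha, hb, es])
  have lPE : ∀ W ⊆ V, NoP c a W → NoE c b W → W.card ≤ NN true r s := fun W hW h1 h2 =>
    ih.two hab (t := St.P) (u := St.E) (ok.mono hW) h1 h2 WB.tr (by omega)
      (by simp [ha, hb, er]) (by simp [ha, hb, es])
  have lTE : ∀ W ⊆ V, NoT c a W → NoE c b W → W.card ≤ NN w r (s + 1) := fun W hW h1 h2 =>
    ih.two hab (t := St.T) (u := St.E) (ok.mono hW) h1 h2 ((hw.up (by simp)).up (by simp)) (by omega)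
      (by simp [ha, hb, er]) (by simp [ha, hb, es])
  have hle := h.leF lEE
  have nw := NN_mono_w w r s
  have ns := NN_s w r s
  obtain ⟨n2, n3, n4, n5⟩ := NN_HT w r s
  have pe : ∀ v ∈ V1, NoE c b (Pt cl V1 v) := fun v hv => by
    by_cases hb : 2 ≤ (Pt cl V1 v).card
    · have := (h.big v hv hb).2
      exact ((h.q.jn hv b).symm hs).noE ob (Rd_sub.trans h.sub1) (Pt_sub.trans h.sub1)
        (Finset.card_pos.1 (by omega))
    · exact noE_single (by omega)
  have pt : ∀ v ∈ V1, NoT c a (Pt cl V1 v) := fun v hv => by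
    by_cases hb : 2 ≤ (Pt cl V1 v).card
    · exact ((h.q.jn hv a).symm hs).noT oa (Rd_sub.trans h.sub1) (Pt_sub.trans h.sub1)
        (h.big v hv hb).1
    · exact (noE_single (by omega)).noT
  have hS : S1 c a b V1 cl (NN w r s) (NN true r s) (NN w r (s + 1)) :=
    ⟨h.q, NoH.mono oa h.sub1, f2, nw.1, pe, pt, fun W hW => lEE W (hW.trans h.sub1),
      fun W hW => lPE W (hW.trans h.sub1), fun W hW => lTE W (hW.trans h.sub1)⟩
  have := caseHT hs hab hS (NoT.mono ob h.sub1) hle ns.2 n2 n3 n4 n5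
    (fun v hv h1 => h.part (t := St.E) (u := St.E) (by simp) (by simp) lEE hle hv h1 (pe v hv))
    (fun v hv h1 => h.part (t := St.P) (u := St.E) (by simp) (by simp) lPE (by omega) hv h1 (pe v hv))
    (fun v hv h1 => h.part (t := St.T) (u := St.E) (by simp) (by simp) lTE (by omega) hv h1 (pe v hv))
  have hc : V.card = V1.card + L.card := by
    rw [← Finset.card_union_of_disjoint h.dj, ← h.cov]
  rw [er, es]
  omega

theorem NJ.hh [Fintype K] {c : α → α → K} (hs : Sy c) {σ : K → St} {V V1 L : Finset α} {w : Bool}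
    (ih : IH c (2 * cnt σ St.H + cnt σ St.T)) (ok : Ok c σ V) (hw : WB σ w) {a b : K} (hab : a ≠ b)
    {cl : α → β} (h : NJ c a b V V1 L cl) (ha : σ a = St.H) (hb : σ b = St.H) :
    V.card ≤ NN w (cnt σ St.H) (cnt σ St.T) := by
  have oa := ok a
  have ob := ok b
  rw [ha] at oa
  rw [hb] at ob
  have hsub : ({a, b} : Finset K) ⊆ Finset.univ.filter (fun j => σ j = St.H) := by
    intro j hj
    simp only [Finset.mem_insert, Finset.mem_singleton] at hj
    rcases hj with rfl | rfl <;> simp [ha, hb]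
  have h2 : 2 ≤ cnt σ St.H := by
    have : ({a, b} : Finset K).card ≤ cnt σ St.H := Finset.card_le_card hsub
    rwa [Finset.card_pair hab] at this
  obtain ⟨r, er⟩ : ∃ r, cnt σ St.H = r + 2 := ⟨cnt σ St.H - 2, by omega⟩
  obtain ⟨s, es⟩ : ∃ s, cnt σ St.T = s := ⟨_, rfl⟩
  by_cases hsp : w = false ∧ r = 0 ∧ s = 0
  · obtain ⟨rfl, rfl, rfl⟩ := hsp
    have u1 : ({a, b} : Finset K) = Finset.univ.filter (fun j => σ j = St.H) :=
      Finset.eq_of_subset_of_card_le hsub (by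
        rw [Finset.card_pair hab]; unfold cnt at er; exact er.le)
    have : V.card ≤ 21 := by
      refine card_H_H hs hab ?_ oa ob
      intro u hu v hv n
      have oj := ok (c u v)
      cases hj : σ (c u v) with
      | H =>
        have : c u v ∈ ({a, b} : Finset K) := by rw [u1]; simp [hj]
        simpa using this
      | T =>
        have : 0 < cnt σ St.T := Finset.card_pos.2 ⟨_, by simpa using hj⟩
        omega
      | P => exact absurd (hw ⟨_, hj⟩) (by simp)
      | E => rw [hj] at oj; exact absurd ⟨n, rfl⟩ (oj u hu v hv)
    rw [er, es]
    simpa [NN, N0, tau] using this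
  have f2 := NN_big w r s hsp
  have lEE : ∀ W ⊆ V, NoE c a W → NoE c b W → W.card ≤ NN w r s := fun W hW h1 h2 =>
    ih.two hab (t := St.E) (u := St.E) (ok.mono hW) h1 h2 ((hw.up (by simp)).up (by simp)) (by omega)
      (by simp [ha, hb, er]) (by simp [ha, hb, es])
  have nw := NN_mono_w w r s
  have ns := NN_s w r s
  have n2 := NN_two w r s
  have n17 := NN_17 w r s
  have lPP : ∀ W ⊆ V, NoP c a W → NoP c b W → W.card ≤ 2 * NN w r s := fun W hW h1 h2 => by
    have : W.card ≤ NN true r s := ih.two hab (t := St.P) (u := St.P) (ok.mono hW) h1 h2 WB.tr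
      (by omega) (by simp [ha, hb, er]) (by simp [ha, hb, es])
    omega
  have lTE : ∀ W ⊆ V, NoT c a W → NoE c b W → W.card ≤ NN w r (s + 1) := fun W hW h1 h2 =>
    ih.two hab (t := St.T) (u := St.E) (ok.mono hW) h1 h2 ((hw.up (by simp)).up (by simp)) (by omega)
      (by simp [ha, hb, er]) (by simp [ha, hb, es])
  have lET : ∀ W ⊆ V, NoE c a W → NoT c b W → W.card ≤ NN w r (s + 1) := fun W hW h1 h2 =>
    ih.two hab (t := St.E) (u := St.T) (ok.mono hW) h1 h2 ((hw.up (by simp)).up (by simp)) (by omega)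
      (by simp [ha, hb, er]) (by simp [ha, hb, es])
  have lTT : ∀ W ⊆ V, NoT c a W → NoT c b W → W.card ≤ 5 * NN w r s := fun W hW h1 h2 => by
    rw [← n2]
    exact ih.two hab (t := St.T) (u := St.T) (ok.mono hW) h1 h2 ((hw.up (by simp)).up (by simp))
      (by omega) (by simp [ha, hb, er]) (by simp [ha, hb, es])
  have hle := h.leF lEE
  have ta : ∀ v ∈ V1, NoT c a (Pt cl V1 v) := fun v hv => by
    by_cases hb : 2 ≤ (Pt cl V1 v).card
    · exact ((h.q.jn hv a).symm hs).noT oa (Rd_sub.trans h.sub1) (Pt_sub.trans h.sub1)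
        (h.big v hv hb).1
    · exact (noE_single (by omega)).noT
  have tb : ∀ v ∈ V1, NoT c b (Pt cl V1 v) := fun v hv => by
    by_cases hb : 2 ≤ (Pt cl V1 v).card
    · exact ((h.q.jn hv b).symm hs).noT ob (Rd_sub.trans h.sub1) (Pt_sub.trans h.sub1)
        (h.big v hv hb).2
    · exact (noE_single (by omega)).noT
  have hB : HB c a b V1 cl (NN w r s) :=
    ⟨h.q, NoH.mono oa h.sub1, NoH.mono ob h.sub1, f2, ta, tb,
      fun W hW => lEE W (hW.trans h.sub1), fun W hW => lPP W (hW.trans h.sub1),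
      fun W hW h1 h2 => by have := lTE W (hW.trans h.sub1) h1 h2; omega,
      fun W hW h1 h2 => by have := lET W (hW.trans h.sub1) h1 h2; omega,
      fun W hW => lTT W (hW.trans h.sub1)⟩
  have := caseHH hs hab hB hle
    (fun v hv h1 h2 => h.part (t := St.E) (u := St.E) (by simp) (by simp) lEE hle hv h1 h2)
    (fun v hv h1 h2 => h.part (t := St.P) (u := St.P) (by simp) (by simp) lPP (by omega) hv h1 h2)
    (fun v hv h1 h2 => by
      have := h.part (t := St.T) (u := St.E) (by simp) (by simp) lTE (by omega) hv h1 h2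
      omega)
    (fun v hv h1 h2 => by
      have := h.part (t := St.E) (u := St.T) (by simp) (by simp) lET (by omega) hv h1 h2
      omega)
    (fun v hv h1 h2 => h.part (t := St.T) (u := St.T) (by simp) (by simp) lTT (by omega) hv h1 h2)
  have hc : V.card = V1.card + L.card := by
    rw [← Finset.card_union_of_disjoint h.dj, ← h.cov]
  rw [er, es]
  omega

end
end GRH


namespace GRH
section
open scoped Classical

variable {α K β : Type}

structure GD (c : α → α → K) (a b : K) (V A V1 L : Finset α) (κ : α → K) (cl : α → β) : Prop where
  p : Peel c V A κ
  uni : ∀ x ∈ A, ∀ j, ¬ ∀ y ∈ A, y ≠ x → c x y = j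
  cov : V = V1 ∪ L
  dj : Disjoint V1 L
  AV1 : A ⊆ V1
  LA : ∀ l ∈ L, l ∉ A
  ka : ∀ l ∈ L, κ l ≠ a
  kb : ∀ l ∈ L, κ l ≠ b
  q : Q c a b V1 cl
  iso : ∀ x ∈ V1, x ∉ A → ∀ y ∈ V1, cl y = cl x → y = x
  ra : ∀ v ∈ A, ∃ z ∈ A, cl z ≠ cl v ∧ c v z = a
  rb : ∀ v ∈ A, ∃ z ∈ A, cl z ≠ cl v ∧ c v z = b

theorem GD.swap {c : α → α → K} {a b : K} {V A V1 L : Finset α} {κ : α → K} {cl : α → β}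
    (h : GD c a b V A V1 L κ cl) : GD c b a V A V1 L κ cl :=
  ⟨h.p, h.uni, h.cov, h.dj, h.AV1, h.LA, h.kb, h.ka, h.q.swap, h.iso, h.rb, h.ra⟩

theorem GD.ptA {c : α → α → K} {a b : K} {V A V1 L : Finset α} {κ : α → K} {cl : α → β}
    (h : GD c a b V A V1 L κ cl) {v : α} (hv : v ∈ A) : Pt cl V1 v ⊆ A := by
  intro x hx
  rw [mem_Pt] at hx
  by_contra hxA
  have := h.iso x hx.1 hxA v (h.AV1 hv) hx.2.symm
  exact hxA (this ▸ hv)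

theorem GD.bigA {c : α → α → K} {a b : K} {V A V1 L : Finset α} {κ : α → K} {cl : α → β}
    (h : GD c a b V A V1 L κ cl) {v : α} (hv : v ∈ V1) (h2 : 2 ≤ (Pt cl V1 v).card) : v ∈ A := by
  by_contra hvA
  obtain ⟨x, hx, y, hy, n⟩ := exists2 h2
  rw [mem_Pt] at hx hy
  exact n ((h.iso v hv hvA x hx.1 hx.2).trans (h.iso v hv hvA y hy.1 hy.2).symm)

/-- colors at the vertices of `L` towards `A ∪ L` -/
theorem GD.edL {c : α → α → K} (hs : Sy c) {a b : K} {V A V1 L : Finset α} {κ : α → K} {cl : α → β}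
    (h : GD c a b V A V1 L κ cl) {x y : α} (hx : x ∈ L) (hy : y ∈ A ∪ L) : ¬ Ed c a x y := by
  intro e
  have hLV : L ⊆ V := by rw [h.cov]; exact Finset.subset_union_right
  rcases Finset.mem_union.1 hy with hy | hy
  · exact h.ka x hx ((h.p.up x (hLV hx) (h.LA x hx) y hy).symm.trans e.2)
  · rcases h.p.out x (hLV hx) (h.LA x hx) y (hLV hy) (h.LA y hy) e.1 with h1 | h1
    · exact h.ka x hx (h1.symm.trans e.2)
    · exact h.ka y hy (h1.symm.trans e.2)

theorem GD.conf {c : α → α → K} (hs : Sy c) {a b : K} {V A V1 L : Finset α} {κ : α → K} {cl : α → β}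
    (h : GD c a b V A V1 L κ cl) {Z : Finset α} (hZ : Z ⊆ A) : Conf c a Z (Z ∪ L) := by
  intro x hx y hy e
  have hsub : Z ∪ L ⊆ A ∪ L := Finset.union_subset_union_left hZ
  constructor
  · rcases Finset.mem_union.1 hx with hx' | hx'
    · exact hx'
    · exact absurd e (h.edL hs hx' (hsub hy))
  · rcases Finset.mem_union.1 hy with hy' | hy'
    · exact hy'
    · exact absurd (e.symm hs) (h.edL hs hy' (hsub hx))

theorem GD.small [Fintype K] {c : α → α → K} (hs : Sy c) {σ : K → St} {w : Bool} {a b : K}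
    (hab : a ≠ b) {V A V1 L : Finset α} {κ : α → K} {cl : α → β}
    (ih : IH c (2 * cnt σ St.H + cnt σ St.T)) (ok : Ok c σ V) (hw : WB σ w)
    (h : GD c a b V A V1 L κ cl) {v : α} (hv : v ∈ V1) (h2 : 2 ≤ (Pt cl V1 v).card)
    (hR : ¬ 2 ≤ (Rd c a cl V1 v).card) : V.card ≤ NN w (cnt σ St.H) (cnt σ St.T) := by
  have hvA := h.bigA hv h2
  obtain ⟨x, hxA, hx1, hx2⟩ := h.ra v hvA
  have hxR : x ∈ Rd c a cl V1 v := mem_Rd.2 ⟨h.AV1 hxA, hx1, hx2⟩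
  have hRx : ∀ z ∈ Rd c a cl V1 v, z = x := fun z hz =>
    Finset.card_le_one.1 (by omega) z hz x hxR
  have hall : ∀ z ∈ V1, z ∈ Pt cl V1 v ∨ z = x ∨ z ∈ Rd c b cl V1 v := by
    intro z hz
    by_cases e : cl z = cl v
    · exact Or.inl (mem_Pt.2 ⟨hz, e⟩)
    · rcases h.q.cross v hv z hz (Ne.symm e) with h' | h'
      · exact Or.inr (Or.inl (hRx z (mem_Rd.2 ⟨hz, e, h'⟩)))
      · exact Or.inr (Or.inr (mem_Rd.2 ⟨hz, e, h'⟩))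
  by_cases hB : 2 ≤ (Rd c b cl V1 v).card
  · have hX : Pt cl V1 v ∪ {x} ⊆ A := Finset.union_subset (h.ptA hvA) (by simpa using hxA)
    refine join hs ih ok hw (j := b) (X := Pt cl V1 v) (X' := Pt cl V1 v ∪ {x} ∪ L)
      (Y := Rd c b cl V1 v) ?_ ?_ ?_ (h.q.jn hv b) h2 hB
    · rw [h.cov]
      ext z
      simp only [Finset.mem_union, Finset.mem_singleton]
      constructor
      · rintro (hz | hz)
        · have := hall z hz
          tauto
        · tauto
      · rintro (((hz | rfl) | hz) | hz)
        · exact Or.inl (Pt_sub hz)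
        · exact Or.inl (h.AV1 hxA)
        · exact Or.inr hz
        · exact Or.inl (Rd_sub hz)
    · exact Finset.subset_union_left.trans Finset.subset_union_left
    · intro y hy z hz e
      obtain ⟨hy', hz'⟩ := h.swap.conf hs hX y hy z hz e
      have hxe : ∀ p ∈ Pt cl V1 v, ¬ Ed c b p x := fun p hp e =>
        hab ((h.q.jn hv a p hp x hxR).2.symm.trans e.2)
      rw [Finset.mem_union, Finset.mem_singleton] at hy' hz'
      rcases hy' with hy' | rfl
      · rcases hz' with hz' | rfl
        · exact ⟨hy', hz'⟩
        · exact absurd e (hxe y hy')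
      · rcases hz' with hz' | rfl
        · exact absurd (e.symm hs) (hxe z hz')
        · exact absurd rfl e.1
  · exfalso
    obtain ⟨y, hyA, hy1, hy2⟩ := h.rb v hvA
    have hyB : y ∈ Rd c b cl V1 v := mem_Rd.2 ⟨h.AV1 hyA, hy1, hy2⟩
    have hBy : ∀ z ∈ Rd c b cl V1 v, z = y := fun z hz =>
      Finset.card_le_one.1 (by omega) z hz y hyB
    have hne := h.q.ne_of_rd hs hab hv hxR hyB
    rcases h.q.cross x (h.AV1 hxA) y (h.AV1 hyA) hne with e | e
    · refine h.uni x hxA a (fun z hz hzx => ?_)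
      rcases hall z (h.AV1 hz) with h' | h' | h'
      · rw [hs]; exact (h.q.jn hv a z h' x hxR).2
      · exact absurd h' hzx
      · rw [hBy z h']; exact e
    · refine h.uni y hyA b (fun z hz hzy => ?_)
      rcases hall z (h.AV1 hz) with h' | h' | h'
      · rw [hs]; exact (h.q.jn hv b z h' y hyB).2
      · rw [h', hs]; exact e
      · exact absurd (hBy z h') hzy

theorem GD.nj {c : α → α → K} (hs : Sy c) {a b : K} {V A V1 L : Finset α} {κ : α → K} {cl : α → β}
    (h : GD c a b V A V1 L κ cl)
    (big : ∀ v ∈ V1, 2 ≤ (Pt cl V1 v).card →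
      2 ≤ (Rd c a cl V1 v).card ∧ 2 ≤ (Rd c b cl V1 v).card) : NJ c a b V V1 L cl := by
  obtain ⟨x, hx⟩ := h.p.ne
  refine ⟨h.cov, h.dj, h.q, ⟨x, h.AV1 hx⟩, big, ?_, ?_, x, h.p.sub hx, fun hl => h.LA x hl hx, ?_, ?_⟩
  · intro v hv h2
    exact h.conf hs (h.ptA (h.bigA hv h2))
  · intro v hv h2
    exact h.swap.conf hs (h.ptA (h.bigA hv h2))
  · rw [Finset.insert_eq]
    exact (h.conf hs (by simpa using hx)).noE (noE_single (by simp))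
  · rw [Finset.insert_eq]
    exact (h.swap.conf hs (by simpa using hx)).noE (noE_single (by simp))

def NoJoin (c : α → α → K) (A : Finset α) : Prop :=
  ¬ ∃ j X Y, A = X ∪ Y ∧ X.Nonempty ∧ Y.Nonempty ∧ Jn c j X Y

theorem exists_ra {c : α → α → K} {a b : K} {A : Finset α} {cl : α → β} (hn : NoJoin c A)
    (q : Q c a b A cl) (h2 : ∀ v ∈ A, ∃ z ∈ A, cl z ≠ cl v) :
    ∀ v ∈ A, ∃ z ∈ A, cl z ≠ cl v ∧ c v z = a := by
  intro v hv
  by_contra hcon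
  push Not at hcon
  obtain ⟨z, hz, hz'⟩ := h2 v hv
  refine hn ⟨b, Pt cl A v, Rd c b cl A v, ?_, ⟨v, self_Pt hv⟩, ⟨z, mem_Rd.2 ⟨hz, hz', ?_⟩⟩, q.jn hv b⟩
  · ext y
    rw [Finset.mem_union, mem_Pt, mem_Rd]
    constructor
    · intro hy
      by_cases e : cl y = cl v
      · exact Or.inl ⟨hy, e⟩
      · exact Or.inr ⟨hy, e, (q.cross v hv y hy (Ne.symm e)).resolve_left (hcon y hy e)⟩
    · tauto
  · exact (q.cross v hv z hz (Ne.symm hz')).resolve_left (hcon z hz hz')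

theorem not_noP {c : α → α → K} (hs : Sy c) {a b : K} (hab : a ≠ b) {A : Finset α} {cl : α → β} (hn : NoJoin c A)
    (q : Q c a b A cl) (hA : A.Nonempty) (ra : ∀ v ∈ A, ∃ z ∈ A, cl z ≠ cl v ∧ c v z = a)
    (rb : ∀ v ∈ A, ∃ z ∈ A, cl z ≠ cl v ∧ c v z = b) : ¬ NoP c a A := by
  intro hP
  have key : ∀ v ∈ A, ∀ u ∈ A, cl u ≠ cl v → c v u = a → ∀ z ∈ A, z ≠ v → z ≠ u → c v z = b := by
    intro v hv u hu huv e z hz h1 h2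
    have hvu : v ≠ u := fun h => huv (by rw [h])
    have hne : cl v ≠ cl z := by
      intro h
      have := q.unif v hv z hz u hu h huv.symm
      exact hP u hu v hv z hz h1.symm ⟨hvu.symm, by rw [hs]; exact e⟩
        ⟨h2.symm, by rw [hs, ← this]; exact e⟩
    rcases q.cross v hv z hz hne with h | h
    · exact (hP v hv u hu z hz h2.symm ⟨hvu, e⟩ ⟨h1.symm, h⟩).elim
    · exact h
  obtain ⟨v, hv⟩ := hA
  obtain ⟨u, hu, huv, e⟩ := ra v hv
  obtain ⟨y, hy, hyv, ey⟩ := rb v hv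
  have hvu : v ≠ u := fun h => huv (by rw [h])
  refine hn ⟨b, {v, u}, (A.erase v).erase u, ?_, ⟨v, by simp⟩, ⟨y, ?_⟩, ?_⟩
  · ext z
    simp only [Finset.mem_union, Finset.mem_insert, Finset.mem_singleton, Finset.mem_erase]
    constructor
    · tauto
    · rintro ((rfl | rfl) | h)
      · exact hv
      · exact hu
      · exact h.2.2
  · simp only [Finset.mem_erase]
    refine ⟨?_, ?_, hy⟩
    · rintro rfl; exact hab (e.symm.trans ey)
    · rintro rfl; exact hyv rfl
  · intro x hx z hz
    simp only [Finset.mem_insert, Finset.mem_singleton, Finset.mem_erase] at hx hz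
    rcases hx with rfl | rfl
    · exact ⟨fun h => hz.2.1 h.symm, key x hv u hu huv e z hz.2.2 hz.2.1 hz.1⟩
    · exact ⟨fun h => hz.1 h.symm, key x hu v hv huv.symm (by rw [hs]; exact e) z hz.2.2 hz.1 hz.2.1⟩

theorem OG_out {c : α → α → K} {hs : Sy c} {A : Finset α} {a b : K} {x y : α}
    (h : (OG c hs A a b).Reachable x y) (hx : x ∉ A) : y = x := by
  obtain ⟨w⟩ := h
  cases w with
  | nil => rfl
  | cons h _ => exact absurd h.2.1 hx

theorem OG_side {c : α → α → K} {hs : Sy c} {A S : Finset α} {a b : K}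
    (hS : ∀ u ∈ S, ∀ v ∈ A, v ∉ S → c u v = a ∨ c u v = b) {x y : α}
    (h : (OG c hs A a b).Reachable x y) (hx : x ∈ S) : y ∈ S := by
  obtain ⟨w⟩ := h
  induction w with
  | nil => exact hx
  | @cons u v _ h _ ih =>
    apply ih
    by_contra hv
    obtain ⟨_, _, h3, h4, h5⟩ := h
    rcases hS u hx v h3 hv with h | h
    · exact h4 h
    · exact h5 h

theorem step [Fintype K] {c : α → α → K} (hs : Sy c) (hg : Gal c) {σ : K → St} {V : Finset α} {w : Bool}
    (ih : IH c (2 * cnt σ St.H + cnt σ St.T)) (ok : Ok c σ V) (hw : WB σ w) :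
    V.card ≤ NN w (cnt σ St.H) (cnt σ St.T) := by
  rcases V.eq_empty_or_nonempty with rfl | hV
  · simp
  obtain ⟨A, κ, hp, h1 | huni⟩ := exists_peel hs V (fun x => c x x) hV
  · exact peel_small hs ok hw hp h1
  by_cases hn : NoJoin c A
  swap
  · unfold NoJoin at hn
    push Not at hn
    obtain ⟨j, X, Y, hA, hX, hY, hJ⟩ := hn
    have hXA : X ⊆ A := by rw [hA]; exact Finset.subset_union_left
    have hYA : Y ⊆ A := by rw [hA]; exact Finset.subset_union_right
    have side2 : ∀ X Y : Finset α, A = X ∪ Y → X ⊆ A → X.Nonempty → Jn c j X Y → 2 ≤ X.card := by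
      intro X Y hA hXA hX hJ
      by_contra hcon
      obtain ⟨x, hx⟩ := hX
      refine huni x (hXA hx) j (fun y hy hyx => ?_)
      rw [hA] at hy
      rcases Finset.mem_union.1 hy with h | h
      · exact absurd (Finset.card_le_one.1 (by omega) y h x hx) hyx
      · exact (hJ x hx y h).2
    have hX2 := side2 X Y hA hXA hX hJ
    have hY2 := side2 Y X (by rw [hA, Finset.union_comm]) hYA hY (hJ.symm hs)
    refine join hs ih ok hw (j := j) (X := X) (X' := X ∪ (V \ A).filter (fun l => κ l ≠ j))
      (Y := Y ∪ (V \ A).filter (fun l => κ l = j)) ?_ Finset.subset_union_left ?_ ?_ hX2 ?_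
    · ext z
      simp only [Finset.mem_union, Finset.mem_filter, Finset.mem_sdiff]
      constructor
      · intro hz
        by_cases hzA : z ∈ A
        · have := hzA
          rw [hA, Finset.mem_union] at this
          tauto
        · tauto
      · rintro ((h | h) | (h | h))
        · exact hp.sub (hXA h)
        · exact h.1.1
        · exact hp.sub (hYA h)
        · exact h.1.1
    · intro x hx y hy e
      simp only [Finset.mem_union, Finset.mem_filter, Finset.mem_sdiff] at hx hy
      rcases hx with hx | ⟨hx, hxj⟩
      · rcases hy with hy | ⟨hy, hyj⟩
        · exact ⟨hx, hy⟩
        · exact absurd ((hp.up y hy.1 hy.2 x (hXA hx)).symm.trans (e.symm hs).2) hyj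
      · rcases hy with hy | ⟨hy, hyj⟩
        · exact absurd ((hp.up x hx.1 hx.2 y (hXA hy)).symm.trans e.2) hxj
        · rcases hp.out x hx.1 hx.2 y hy.1 hy.2 e.1 with h | h
          · exact absurd (h.symm.trans e.2) hxj
          · exact absurd (h.symm.trans e.2) hyj
    · intro x hx y hy
      simp only [Finset.mem_union, Finset.mem_filter, Finset.mem_sdiff] at hy
      rcases hy with hy | ⟨hy, hyj⟩
      · exact hJ x hx y hy
      · refine ⟨fun h => hy.2 (h ▸ hXA hx), ?_⟩
        rw [hs, hp.up y hy.1 hy.2 x (hXA hx), hyj]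
    · exact hY2.trans (Finset.card_le_card Finset.subset_union_left)
  have hA2 : 2 ≤ A.card := by
    by_contra hcon
    obtain ⟨x, hx⟩ := hp.ne
    exact huni x hx (c x x) (fun y hy n => absurd (Finset.card_le_one.1 (by omega) y hy x hx) n)
  obtain ⟨a, b, S, hSA, hSne, hSA', hcr⟩ := gallai_split c hs hg A hA2
  obtain ⟨s, hsS⟩ := hSne
  obtain ⟨t, htA, htS⟩ : ∃ t ∈ A, t ∉ S := by
    by_contra hcon
    push Not at hcon
    exact hSA' (Finset.Subset.antisymm hSA hcon)
  have hab : a ≠ b := by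
    rintro rfl
    refine hn ⟨a, S, A \ S, (Finset.union_sdiff_of_subset hSA).symm, ⟨s, hsS⟩, ⟨t, by simp [htA, htS]⟩, ?_⟩
    intro x hx y hy
    rw [Finset.mem_sdiff] at hy
    exact ⟨fun h => hy.2 (h ▸ hx), (hcr x hx y hy.1 hy.2).elim id id⟩
  let cl : α → (OG c hs A a b).ConnectedComponent := (OG c hs A a b).connectedComponentMk
  have hcl : ∀ x y, cl x = cl y ↔ (OG c hs A a b).Reachable x y := fun x y =>
    SimpleGraph.ConnectedComponent.eq
  let V1 := A ∪ (V \ A).filter (fun l => κ l = a ∨ κ l = b)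
  let L := (V \ A).filter (fun l => ¬ (κ l = a ∨ κ l = b))
  have mV1 : ∀ x, x ∈ V1 ↔ x ∈ A ∨ ((x ∈ V ∧ x ∉ A) ∧ (κ x = a ∨ κ x = b)) := by
    intro x; simp only [V1, Finset.mem_union, Finset.mem_filter, Finset.mem_sdiff]
  have mL : ∀ x, x ∈ L ↔ ((x ∈ V ∧ x ∉ A) ∧ ¬ (κ x = a ∨ κ x = b)) := by
    intro x; simp only [L, Finset.mem_filter, Finset.mem_sdiff]
  have q1 : Q c a b V1 cl := by
    constructor
    · intro u hu v hv n
      rw [mV1] at hu hv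
      rcases hu with hu | ⟨hu, ku⟩
      · rcases hv with hv | ⟨hv, kv⟩
        · exact OG_cross hu hv (fun h => n ((hcl u v).2 h))
        · rw [hs, hp.up v hv.1 hv.2 u hu]; exact kv
      · rcases hv with hv | ⟨hv, kv⟩
        · rw [hp.up u hu.1 hu.2 v hv]; exact ku
        · rcases hp.out u hu.1 hu.2 v hv.1 hv.2 (fun h => n (by rw [h])) with h | h
          · rw [h]; exact ku
          · rw [h]; exact kv
    · intro u hu u' hu' x hx e n
      by_cases heq : u = u'
      · rw [heq]
      have r := (hcl u u').1 e
      have huA : u ∈ A := by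
        by_contra h
        exact heq (OG_out r h).symm
      have huA' := OG_reach_mem r huA
      rw [mV1] at hx
      rcases hx with hx | ⟨hx, kx⟩
      · exact OG_unif hg hx r (fun h => n ((hcl u x).2 h))
      · rw [hs, hp.up x hx.1 hx.2 u huA, hs, hp.up x hx.1 hx.2 u' huA']
  have AV1 : A ⊆ V1 := fun x hx => (mV1 x).2 (Or.inl hx)
  have qA := q1.mono AV1
  have two : ∀ v ∈ A, ∃ z ∈ A, cl z ≠ cl v := by
    intro v hv
    by_cases h : v ∈ S
    · exact ⟨t, htA, fun e => htS (OG_side hcr ((hcl t v).1 e).symm h)⟩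
    · exact ⟨s, hSA hsS, fun e => h (OG_side hcr ((hcl s v).1 e) hsS)⟩
  have ra := exists_ra hn qA two
  have rb := exists_ra hn qA.swap two
  have gd : GD c a b V A V1 L κ cl := by
    refine ⟨hp, huni, ?_, ?_, AV1, fun l hl => ((mL l).1 hl).1.2,
      fun l hl h => ((mL l).1 hl).2 (Or.inl h), fun l hl h => ((mL l).1 hl).2 (Or.inr h), q1, ?_, ra, rb⟩
    · ext x
      rw [Finset.mem_union, mV1, mL]
      have := @hp.sub x
      tauto
    · rw [Finset.disjoint_left]
      intro x h1 h2
      rw [mV1] at h1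
      rw [mL] at h2
      tauto
    · intro x _ hxA y _ e
      exact OG_out ((hcl x y).1 e.symm) hxA
  by_cases big : ∀ v ∈ V1, 2 ≤ (Pt cl V1 v).card →
      2 ≤ (Rd c a cl V1 v).card ∧ 2 ≤ (Rd c b cl V1 v).card
  swap
  · push Not at big
    obtain ⟨v, hv, hv2, hvr⟩ := big
    by_cases h : 2 ≤ (Rd c a cl V1 v).card
    · exact gd.swap.small hs hab.symm ih ok hw hv hv2 (by have := hvr h; omega)
    · exact gd.small hs hab ih ok hw hv hv2 h
  have nj := gd.nj hs big
  have oa := ok a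
  have ob := ok b
  have nPa := not_noP hs hab hn qA hp.ne ra rb
  have nPb := not_noP hs hab.symm hn qA.swap hp.ne rb ra
  cases ha : σ a with
  | E => rw [ha] at oa; exact absurd (NoE.mono oa hp.sub).noP nPa
  | P => rw [ha] at oa; exact absurd (NoP.mono oa hp.sub) nPa
  | T =>
    cases hb : σ b with
    | E => rw [hb] at ob; exact absurd (NoE.mono ob hp.sub).noP nPb
    | P => rw [hb] at ob; exact absurd (NoP.mono ob hp.sub) nPb
    | T => exact nj.tt hs ih ok hw hab ha hb
    | H => exact nj.swap.ht hs ih ok hw hab.symm hb ha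
  | H =>
    cases hb : σ b with
    | E => rw [hb] at ob; exact absurd (NoE.mono ob hp.sub).noP nPb
    | P => rw [hb] at ob; exact absurd (NoP.mono ob hp.sub) nPb
    | T => exact nj.ht hs ih ok hw hab ha hb
    | H => exact nj.hh hs ih ok hw hab ha hb

theorem main [Fintype K] {c : α → α → K} (hs : Sy c) (hg : Gal c) : ∀ m, IH c m
  | 0 => fun _ _ _ h => absurd h (by omega)
  | m + 1 => fun σ V w hm hw ok =>
    step hs hg (fun σ' V' w' h' => main hs hg m σ' V' w' (by omega)) ok hw

theorem upper [Fintype K] {c : α → α → K} (hs : Sy c) (hg : Gal c) (V : Finset α)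
    (h : ∀ a, NoH c a V) : V.card ≤ NN false (Fintype.card K) 0 := by
  have := main hs hg (2 * Fintype.card K + 1) (fun _ => St.H) V false (by simp [cnt]) (by rintro ⟨a, ha⟩; simp at ha)
    (fun a => h a)
  simpa [cnt] using this

end
end GRH


namespace GRH

/-! ### Lower bound -/

def NH {α K : Type} (c : α → α → K) (a : K) : Prop :=
  ∀ x y p q r, x ≠ y → Ed c a p q → Ed c a p r → Ed c a q r →
    Ed c a x p → Ed c a x q → Ed c a x r → Ed c a y p → Ed c a y q → Ed c a y r → False

def Good (K α : Type) : Prop := ∃ c : α → α → K, Sy c ∧ Gal c ∧ ∀ a, NH c a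

theorem Good.transport {K K' α α' : Type} (h : Good K α) (f : K ≃ K') (g : α' ↪ α) : Good K' α' := by
  obtain ⟨c, h1, h2, h3⟩ := h
  refine ⟨fun x y => f (c (g x) (g y)), ?_, ?_, ?_⟩
  · intro x y; simp only; rw [h1]
  · intro u v w a b d
    have := h2 (g u) (g v) (g w) (g.injective.ne a) (g.injective.ne b) (g.injective.ne d)
    simpa using this
  · intro a x y p q r n
    have key : ∀ {u v : α'}, Ed (fun x y => f (c (g x) (g y))) a u v → Ed c (f.symm a) (g u) (g v) := by
      rintro u v ⟨h, e⟩
      exact ⟨g.injective.ne h, by rw [← e]; simp⟩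
    intro e1 e2 e3 e4 e5 e6 e7 e8 e9
    exact h3 (f.symm a) _ _ _ _ _ (g.injective.ne n) (key e1) (key e2) (key e3) (key e4) (key e5)
      (key e6) (key e7) (key e8) (key e9)

/-- adjacency in one of the two colors -/
def adc (red : ℕ → ℕ → Bool) (col : Bool) (i j : ℕ) : Bool := (! Nat.beq i j) && (red i j == col)

def allB (n : ℕ) (f : ℕ → Bool) : Bool := (List.range n).all f

def symB (n : ℕ) (red : ℕ → ℕ → Bool) : Bool := allB n fun i => allB n fun j => red i j == red j i

def chkH (n : ℕ) (ad : ℕ → ℕ → Bool) : Bool :=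
  allB n fun p => allB n fun q => (! ad p q) || allB n fun r => (! (ad p r && ad q r)) ||
    allB n fun x => (! (ad x p && ad x q && ad x r)) ||
      allB n fun y => (! (ad y p && ad y q && ad y r)) || Nat.beq x y

def chkK (n : ℕ) (ad : ℕ → ℕ → Bool) : Bool :=
  allB n fun p => allB n fun q => (! ad p q) || allB n fun r => (! (ad p r && ad q r)) ||
    allB n fun x => ! (ad x p && ad x q && ad x r)

def rows21 : List ℕ := [1398100, 880140, 336867, 1423410, 1347465, 1499340, 1195557, 1803060, 587925,
  920790, 254547, 1586010, 1018185, 52590, 1975587, 210360, 1610895, 841440, 152127, 1268610, 608505]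

def red21 (i j : ℕ) : Bool := tb (rows21.getD i 0) j

def red17 (i j : ℕ) : Bool := tb 107286 ((i + 17 - j) % 17)

theorem sym21 : symB 21 red21 = true := by decide +kernel
theorem chk21t : chkH 21 (adc red21 true) = true := by decide +kernel
theorem chk21f : chkH 21 (adc red21 false) = true := by decide +kernel
theorem sym17 : symB 17 red17 = true := by decide +kernel
theorem chk17t : chkK 17 (adc red17 true) = true := by decide +kernel
theorem chk17f : chkK 17 (adc red17 false) = true := by decide +kernel

theorem allB_fin {n : ℕ} {f : ℕ → Bool} (h : allB n f = true) (i : Fin n) : f i = true := by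
  unfold allB at h
  rw [List.all_eq_true] at h
  exact h i (by simp)

theorem adc_of {n : ℕ} {red : ℕ → ℕ → Bool} {col : Bool} {i j : Fin n}
    (h : Ed (fun i j : Fin n => red i j) col i j) : adc red col i j = true := by
  obtain ⟨h1, h2⟩ := h
  unfold adc
  simp only at h2
  have hb : Nat.beq (i:ℕ) (j:ℕ) = false := by
    cases h : Nat.beq (i:ℕ) (j:ℕ) with
    | false => rfl
    | true => exact absurd (Fin.ext (Nat.eq_of_beq_eq_true h)) h1
  simp [h2, hb]

theorem symB_sy {n : ℕ} {red : ℕ → ℕ → Bool} (h : symB n red = true) :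
    Sy (fun i j : Fin n => red i j) := by
  intro i j
  have := allB_fin (allB_fin h i) j
  simpa using this

theorem chkH_nh {n : ℕ} {red : ℕ → ℕ → Bool} {col : Bool} (h : chkH n (adc red col) = true) :
    NH (fun i j : Fin n => red i j) col := by
  intro x y p q r n e1 e2 e3 e4 e5 e6 e7 e8 e9
  have h1 := allB_fin (allB_fin h p) q
  rw [adc_of e1, Bool.not_true, Bool.false_or] at h1
  have h2 := allB_fin h1 r
  rw [adc_of e2, adc_of e3, Bool.and_self, Bool.not_true, Bool.false_or] at h2
  have h3 := allB_fin h2 x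
  rw [adc_of e4, adc_of e5, adc_of e6, Bool.and_self, Bool.and_self, Bool.not_true,
    Bool.false_or] at h3
  have h4 := allB_fin h3 y
  rw [adc_of e7, adc_of e8, adc_of e9, Bool.and_self, Bool.and_self, Bool.not_true,
    Bool.false_or] at h4
  exact n (Fin.ext (Nat.eq_of_beq_eq_true h4))

theorem chkK_nk {n : ℕ} {red : ℕ → ℕ → Bool} {col : Bool} (h : chkK n (adc red col) = true)
    (x p q r : Fin n) (e1 : Ed (fun i j : Fin n => red i j) col p q)
    (e2 : Ed (fun i j : Fin n => red i j) col p r) (e3 : Ed (fun i j : Fin n => red i j) col q r)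
    (e4 : Ed (fun i j : Fin n => red i j) col x p) (e5 : Ed (fun i j : Fin n => red i j) col x q)
    (e6 : Ed (fun i j : Fin n => red i j) col x r) : False := by
  have h1 := allB_fin (allB_fin h p) q
  rw [adc_of e1, Bool.not_true, Bool.false_or] at h1
  have h2 := allB_fin h1 r
  rw [adc_of e2, adc_of e3, Bool.and_self, Bool.not_true, Bool.false_or] at h2
  have h3 := allB_fin h2 x
  rw [adc_of e4, adc_of e5, adc_of e6, Bool.and_self, Bool.and_self, Bool.not_true] at h3
  exact absurd h3 (by simp)

theorem gal_bool {α : Type} (c : α → α → Bool) : Gal c := by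
  intro u v w _ _ _
  generalize c u v = x
  generalize c u w = y
  generalize c v w = z
  revert x y z
  decide

theorem good21 : Good Bool (Fin 21) := by
  refine ⟨fun i j => red21 i j, symB_sy sym21, gal_bool _, ?_⟩
  intro a
  cases a
  · exact chkH_nh chk21f
  · exact chkH_nh chk21t

theorem good4 : Good Unit (Fin 4) := by
  refine ⟨fun _ _ => (), fun _ _ => rfl, fun _ _ _ _ _ _ => Or.inl rfl, ?_⟩
  intro a x y p q r n e1 e2 e3 e4 e5 e6 e7 e8 e9
  have h1 := e1.1
  have h2 := e2.1
  have h3 := e3.1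
  have h4 := e4.1
  have h5 := e5.1
  have h6 := e6.1
  have h7 := e7.1
  have h8 := e8.1
  have h9 := e9.1
  omega

theorem good_sub {K α : Type} (h : Good K α) : Good (K ⊕ Bool) (α × Fin 17) := by
  classical
  obtain ⟨c, h1, h2, h3⟩ := h
  let d : Fin 17 → Fin 17 → Bool := fun i j => red17 i j
  have dS : Sy d := symB_sy sym17
  have dG : Gal d := gal_bool d
  let c' : α × Fin 17 → α × Fin 17 → K ⊕ Bool := fun x y =>
    if x.2 = y.2 then Sum.inl (c x.1 y.1) else Sum.inr (d x.2 y.2)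
  have ein : ∀ {a x y}, Ed c' (Sum.inl a) x y → x.2 = y.2 ∧ Ed c a x.1 y.1 := by
    rintro a x y ⟨n, e⟩
    simp only [c'] at e
    split_ifs at e with h
    exact ⟨h, fun h' => n (Prod.ext h' h), Sum.inl.inj e⟩
  have eout : ∀ {a x y}, Ed c' (Sum.inr a) x y → Ed d a x.2 y.2 := by
    rintro a x y ⟨n, e⟩
    simp only [c'] at e
    split_ifs at e with h
    exact ⟨h, Sum.inr.inj e⟩
  refine ⟨c', ?_, ?_, ?_⟩
  · intro x y
    simp only [c', eq_comm (a := x.2)]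
    rw [h1, dS]
  · intro u v w n1 n2 n3
    simp only [c']
    by_cases e1 : u.2 = v.2
    · by_cases e2 : u.2 = w.2
      · have e3 : v.2 = w.2 := e1.symm.trans e2
        have := h2 u.1 v.1 w.1 (fun h => n1 (Prod.ext h e1)) (fun h => n2 (Prod.ext h e2))
          (fun h => n3 (Prod.ext h e3))
        simp only [e1, e3, if_true]
        simpa using this
      · have e3 : v.2 ≠ w.2 := fun h => e2 (e1.trans h)
        simp only [e1, e3, if_false]
        simp
    · by_cases e2 : u.2 = w.2
      · have e3 : v.2 ≠ w.2 := fun h => e1 (e2.trans h.symm)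
        have e4 : w.2 ≠ v.2 := Ne.symm e3
        simp only [e2, e3, e4, if_false]
        rw [dS w.2 v.2]
        simp
      · by_cases e3 : v.2 = w.2
        · simp only [e2, e3, if_false]
          simp
        · have := dG u.2 v.2 w.2 e1 e2 e3
          simp only [e1, e2, e3, if_false]
          simpa using this
  · rintro (a | a) x y p q r n e1 e2 e3 e4 e5 e6 e7 e8 e9
    · have hxy : x.1 ≠ y.1 := fun h => n (Prod.ext h ((ein e4).1.trans (ein e7).1.symm))
      exact h3 a x.1 y.1 p.1 q.1 r.1 hxy (ein e1).2 (ein e2).2 (ein e3).2 (ein e4).2 (ein e5).2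
        (ein e6).2 (ein e7).2 (ein e8).2 (ein e9).2
    · have hk : chkK 17 (adc red17 a) = true := by
        cases a
        · exact chk17f
        · exact chk17t
      exact chkK_nk hk x.2 p.2 q.2 r.2 (eout e1) (eout e2) (eout e3) (eout e4) (eout e5) (eout e6)

theorem good_step {k n : ℕ} (h : Good (Fin k) (Fin n)) : Good (Fin (k + 2)) (Fin (17 * n)) := by
  refine (good_sub h).transport ?_ ?_
  · exact Fintype.equivOfCardEq (by simp)
  · exact (Fintype.equivOfCardEq (by simp [mul_comm])).toEmbedding

theorem good_odd : ∀ j, Good (Fin (2 * j + 1)) (Fin (4 * 17 ^ j))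
  | 0 => good4.transport (Fintype.equivOfCardEq (by simp)) (Fintype.equivOfCardEq (by simp)).toEmbedding
  | j + 1 => by
    have := good_step (good_odd j)
    rwa [show 17 * (4 * 17 ^ j) = 4 * 17 ^ (j + 1) by ring] at this

theorem good_even : ∀ j, Good (Fin (2 * j + 2)) (Fin (21 * 17 ^ j))
  | 0 => good21.transport (Fintype.equivOfCardEq (by simp)) (Fintype.equivOfCardEq (by simp)).toEmbedding
  | j + 1 => by
    have := good_step (good_even j)
    rwa [show 17 * (21 * 17 ^ j) = 21 * 17 ^ (j + 1) by ring] at this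

end GRH


namespace GRH

theorem GH3_adj (a b : Fin 5) : GH3.Adj a b ↔
    a ≠ b ∧ ¬ (a = 0 ∧ b = 1) ∧ ¬ (a = 1 ∧ b = 0) := by
  unfold GH3
  simp only [SimpleGraph.sdiff_adj, SimpleGraph.top_adj, SimpleGraph.fromRel_adj]
  revert a b
  decide

theorem copy_of {n k : ℕ} {c : Fin n → Fin n → Fin k} (hs : Sy c) {a : Fin k} {x y p q r : Fin n}
    (n : x ≠ y) (e1 : Ed c a p q) (e2 : Ed c a p r) (e3 : Ed c a q r)
    (e4 : Ed c a x p) (e5 : Ed c a x q) (e6 : Ed c a x r)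
    (e7 : Ed c a y p) (e8 : Ed c a y q) (e9 : Ed c a y r) : HasMonoCopy GH3 c a := by
  obtain ⟨m1, e1⟩ := e1
  obtain ⟨m2, e2⟩ := e2
  obtain ⟨m3, e3⟩ := e3
  obtain ⟨m4, e4⟩ := e4
  obtain ⟨m5, e5⟩ := e5
  obtain ⟨m6, e6⟩ := e6
  obtain ⟨m7, e7⟩ := e7
  obtain ⟨m8, e8⟩ := e8
  obtain ⟨m9, e9⟩ := e9
  refine ⟨![x, y, p, q, r], ?_, ?_⟩
  · intro i j h
    fin_cases i <;> fin_cases j <;> first | rfl | (exfalso; simp at h; first | exact absurd h ‹_› | exact absurd h.symm ‹_›)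
  · intro i j h
    rw [GH3_adj] at h
    fin_cases i <;> fin_cases j <;> first
      | (exfalso; revert h; decide)
      | assumption
      | (rw [hs]; assumption)

theorem GR_eq {k N : ℕ} (hu : NN false k 0 = N) (hl : Good (Fin k) (Fin N)) :
    GR k (fun _ => ⟨Fin 5, GH3⟩) = N + 1 := by
  unfold GR
  apply le_antisymm
  · apply Nat.sInf_le
    rintro c ⟨hs, hg⟩
    by_contra hno
    have h := upper (c := c) hs (by
      intro u v w h1 h2 h3
      by_contra h4
      push Not at h4
      exact hg ⟨u, v, w, h1, h2, h3, h4.1, h4.2.1, h4.2.2⟩) Finset.univ (by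
      intro a x _ y _ p _ q _ r _ n e1 e2 e3 e4 e5 e6 e7 e8 e9
      exact hno ⟨a, copy_of hs n e1 e2 e3 e4 e5 e6 e7 e8 e9⟩)
    rw [Fintype.card_fin, hu, Finset.card_univ, Fintype.card_fin] at h
    omega
  · apply le_csInf
    · refine ⟨N + 1, ?_⟩
      rintro c ⟨hs, hg⟩
      by_contra hno
      have h := upper (c := c) hs (by
        intro u v w h1 h2 h3
        by_contra h4
        push Not at h4
        exact hg ⟨u, v, w, h1, h2, h3, h4.1, h4.2.1, h4.2.2⟩) Finset.univ (by
        intro a x _ y _ p _ q _ r _ n e1 e2 e3 e4 e5 e6 e7 e8 e9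
        exact hno ⟨a, copy_of hs n e1 e2 e3 e4 e5 e6 e7 e8 e9⟩)
      rw [Fintype.card_fin, hu, Finset.card_univ, Fintype.card_fin] at h
      omega
    · intro n hn
      by_contra hlt
      have hle : n ≤ N := by omega
      obtain ⟨c, hs, hg, hh⟩ := hl.transport (Equiv.refl _) (Fin.castLEEmb hle)
      obtain ⟨i, hi⟩ := hn c ⟨hs, by
        rintro ⟨u, v, w, h1, h2, h3, h4, h5, h6⟩
        rcases hg u v w h1 h2 h3 with h | h | h
        · exact h4 h
        · exact h5 h
        · exact h6 h⟩
      have hi2 : HasMonoCopy GH3 c i := hi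
      obtain ⟨f, hf, hc⟩ := hi2
      have key : ∀ a b : Fin 5, a ≠ b ∧ ¬ (a = 0 ∧ b = 1) ∧ ¬ (a = 1 ∧ b = 0) →
          Ed c i (f a) (f b) := fun a b hab => ⟨hf.ne hab.1, hc a b ((GH3_adj a b).2 hab)⟩
      exact hh i (f 0) (f 1) (f 2) (f 3) (f 4) (hf.ne (by decide))
        (key _ _ (by decide)) (key _ _ (by decide)) (key _ _ (by decide))
        (key _ _ (by decide)) (key _ _ (by decide)) (key _ _ (by decide))
        (key _ _ (by decide)) (key _ _ (by decide)) (key _ _ (by decide))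

end GRH

/-- Theorem 1.3 (case H = H₃): for every `k ≥ 1`, `GR_k(H₃)` equals `21·17^((k-2)/2) + 1`
when `k` is even, and `4·17^((k-1)/2) + 1` when `k` is odd. -/
theorem GR_H3_value (k : ℕ) (hk : 1 ≤ k) :
    (Even k → GR k (fun _ => ⟨Fin 5, GH3⟩) = 21 * 17 ^ ((k - 2) / 2) + 1) ∧
    (Odd k → GR k (fun _ => ⟨Fin 5, GH3⟩) = 4 * 17 ^ ((k - 1) / 2) + 1) := by
  constructor
  · rintro ⟨m, hm⟩
    obtain ⟨j, rfl⟩ : ∃ j, k = 2 * j + 2 := ⟨m - 1, by omega⟩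
    have h : (2 * j + 2 - 2) / 2 = j := by omega
    rw [h]
    exact GRH.GR_eq (GRH.NN_even j) (GRH.good_even j)
  · rintro ⟨j, rfl⟩
    have h : (2 * j + 1 - 1) / 2 = j := by omega
    rw [h]
    exact GRH.GR_eq (GRH.NN_odd j) (GRH.good_odd j)
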